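/- Let R = ℤ[δ] with δ an indeterminate and let B_i = B_i(R; δ) be the Brauer algebra. Then for each i ≥ 1 the set ℬ_i = {d_s* c_{(λ,l)} d_t : (λ,l) ∈ B̂_i, s,t ∈ B̂_i^{(λ,l)}} is an R-basis of B_i, and (B_i, *, B̂_i, ⊵, ℬ_i) is a cell datum for B_i. -/

import Mathlib

noncomputable section

/-! ### Combinatorics: permutations, row stabilisers, dominance, reflected branching -/

/-- `Equiv.Perm (Fin n)` viewed as permuting `{1, …, n} ⊆ ℕ`. -/
def applyPerm (n : ℕ) (v : Equiv.Perm (Fin n)) (k : ℕ) : ℕ :=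
  if h : 1 ≤ k ∧ k ≤ n then (v ⟨k - 1, by omega⟩).val + 1 else k

/-- The number of inversions of a permutation (its Coxeter length `ℓ(v)`). -/
def invCount {n : ℕ} (v : Equiv.Perm (Fin n)) : ℕ :=
  (Finset.univ.filter fun p : Fin n × Fin n => p.1 < p.2 ∧ v p.2 < v p.1).card

/-- The adjacent transposition `s_i = (i, i+1)` of `{1, …, n}` (`1 ≤ i ≤ n-1`). -/
def swN (n i : ℕ) : Equiv.Perm (Fin n) :=
  if h : 1 ≤ i ∧ i < n then Equiv.swap ⟨i - 1, by omega⟩ ⟨i, by omega⟩ else 1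

/-- The (0-indexed) row of the entry `k` of the superstandard tableau of shape `μ`. -/
def rowOfNum (μ : YoungDiagram) (k : ℕ) : ℕ :=
  ((Finset.range k).filter (fun r => (∑ i ∈ Finset.range (r+1), μ.rowLen i) < k)).card

/-- The row stabiliser `S_μ ⊆ S_n` of the superstandard tableau `t^μ`. -/
def RowStab (n : ℕ) (μ : YoungDiagram) : Finset (Equiv.Perm (Fin n)) :=
  Finset.univ.filter
    (fun v => ∀ k : Fin n, rowOfNum μ (applyPerm n v (k.val + 1)) = rowOfNum μ (k.val + 1))

/-- The dominance order: `l` dominates `μ`. -/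
def Dominates (l μ : YoungDiagram) : Prop :=
  ∀ k : ℕ, (∑ i ∈ Finset.range k, μ.rowLen i) ≤ ∑ i ∈ Finset.range k, l.rowLen i

/-- For `m = l ∪ {one node}`, the (0-indexed) row of the added node. -/
def addedRow (l m : YoungDiagram) : ℕ :=
  ∑ j ∈ Finset.range (m.card + 1), if m.rowLen j ≠ l.rowLen j then j else 0

/-- For `m = l ∪ {(j, m_j)}`, the value `a = m_1 + ⋯ + m_j` (sum of the row lengths
of `m` up to and including the row of the added node). -/
def aVal (l m : YoungDiagram) : ℕ :=
  ∑ r ∈ Finset.range (addedRow l m + 1), m.rowLen r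

/-- The edge relation of the branching diagram obtained by reflections from Young's
lattice: `(λ,l) → (μ,l)` iff `μ` is obtained from `λ` by adding a node, and
`(λ,l) → (μ,l+1)` iff `μ` is obtained from `λ` by removing a node. -/
def WEdge (a b : YoungDiagram × ℕ) : Prop :=
  (b.2 = a.2 ∧ a.1 ≤ b.1 ∧ b.1.card = a.1.card + 1) ∨
  (b.2 = a.2 + 1 ∧ b.1 ≤ a.1 ∧ a.1.card = b.1.card + 1)

/-- Vertices `(λ, l)` at level `i` of the reflected branching diagram:
`0 ≤ l ≤ ⌊i/2⌋` and `λ ⊢ i - 2l`. -/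
abbrev WLam (i : ℕ) : Type := {x : YoungDiagram × ℕ // 2 * x.2 ≤ i ∧ x.1.card = i - 2 * x.2}

/-- Paths on the reflected branching diagram from `(∅,0)` to `x` at level `i`. -/
def WPath (i : ℕ) (x : YoungDiagram × ℕ) : Type :=
  {pp : Fin (i + 1) → YoungDiagram × ℕ //
    pp 0 = (⊥, 0) ∧ pp (Fin.last i) = x ∧
    ∀ k : Fin i, WEdge (pp k.castSucc) (pp k.succ)}

/-- The strict order `m ▷ l` on the labels `(λ, l)`: larger second component, or
equal second components and strict dominance of the diagrams. -/
def wGT (m l : YoungDiagram × ℕ) : Prop :=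
  l.2 < m.2 ∨ (m.2 = l.2 ∧ Dominates m.1 l.1 ∧ m.1 ≠ l.1)

/-! ### The Brauer algebra, by generators and relations -/

/-- Generators `s_i`, `e_i` (for `1 ≤ i ≤ n-1`) of the Brauer algebra. -/
inductive BrGen (n : ℕ) : Type
  | S (i : {i : ℕ // 1 ≤ i ∧ i < n}) : BrGen n
  | E (i : {i : ℕ // 1 ≤ i ∧ i < n}) : BrGen n

open FreeAlgebra in
/-- The defining relations of the Brauer algebra `B_n(R; δ)` (Morton–Wassermann's
presentation, the specialisation of the BMW presentation at `q = z = 1`). -/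
inductive BrRel (R : Type) [CommRing R] (δ : R) (n : ℕ) :
    FreeAlgebra R (BrGen n) → FreeAlgebra R (BrGen n) → Prop
  | inv (i) : BrRel R δ n (ι R (BrGen.S i) * ι R (BrGen.S i)) 1
  | idem (i) : BrRel R δ n (ι R (BrGen.E i) * ι R (BrGen.E i))
      (algebraMap R _ δ * ι R (BrGen.E i))
  | braid (i j) (h : j.1 = i.1 + 1) :
      BrRel R δ n (ι R (BrGen.S i) * ι R (BrGen.S j) * ι R (BrGen.S i))
        (ι R (BrGen.S j) * ι R (BrGen.S i) * ι R (BrGen.S j))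
  | braidComm (i j) (h : i.1 + 1 < j.1 ∨ j.1 + 1 < i.1) :
      BrRel R δ n (ι R (BrGen.S i) * ι R (BrGen.S j))
        (ι R (BrGen.S j) * ι R (BrGen.S i))
  | seComm (i j) (h : i.1 + 1 < j.1 ∨ j.1 + 1 < i.1) :
      BrRel R δ n (ι R (BrGen.S i) * ι R (BrGen.E j))
        (ι R (BrGen.E j) * ι R (BrGen.S i))
  | eeComm (i j) (h : i.1 + 1 < j.1 ∨ j.1 + 1 < i.1) :
      BrRel R δ n (ι R (BrGen.E i) * ι R (BrGen.E j))
        (ι R (BrGen.E j) * ι R (BrGen.E i))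
  | tangle1 (i j) (h : j.1 = i.1 + 1 ∨ i.1 = j.1 + 1) :
      BrRel R δ n (ι R (BrGen.E i) * ι R (BrGen.E j) * ι R (BrGen.E i))
        (ι R (BrGen.E i))
  | tangle2 (i j) (h : j.1 = i.1 + 1 ∨ i.1 = j.1 + 1) :
      BrRel R δ n (ι R (BrGen.S i) * ι R (BrGen.S j) * ι R (BrGen.E i))
        (ι R (BrGen.E j) * ι R (BrGen.E i))
  | tangle3 (i j) (h : j.1 = i.1 + 1 ∨ i.1 = j.1 + 1) :
      BrRel R δ n (ι R (BrGen.E i) * ι R (BrGen.S j) * ι R (BrGen.S i))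
        (ι R (BrGen.E i) * ι R (BrGen.E j))
  | untwistR (i) :
      BrRel R δ n (ι R (BrGen.S i) * ι R (BrGen.E i)) (ι R (BrGen.E i))
  | untwistL (i) :
      BrRel R δ n (ι R (BrGen.E i) * ι R (BrGen.S i)) (ι R (BrGen.E i))
  | untwistE (i j) (h : j.1 = i.1 + 1 ∨ i.1 = j.1 + 1) :
      BrRel R δ n (ι R (BrGen.E i) * ι R (BrGen.S j) * ι R (BrGen.E i))
        (ι R (BrGen.E i))

/-- The Brauer algebra `B_n(R; δ)`. -/
abbrev Brauer (R : Type) [CommRing R] (δ : R) (n : ℕ) : Type := RingQuot (BrRel R δ n)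

variable (R : Type) [CommRing R] (δ : R) (n : ℕ)

/-- The generator `s_i` (equal to `1` out of range). -/
def brS (i : ℕ) : Brauer R δ n :=
  if h : 1 ≤ i ∧ i < n then
    RingQuot.mkAlgHom R (BrRel R δ n) (FreeAlgebra.ι R (BrGen.S ⟨i, h⟩))
  else 1

/-- The generator `e_i` (equal to `1` out of range). -/
def brE (i : ℕ) : Brauer R δ n :=
  if h : 1 ≤ i ∧ i < n then
    RingQuot.mkAlgHom R (BrRel R δ n) (FreeAlgebra.ι R (BrGen.E ⟨i, h⟩))
  else 1

/-- The ascending product `s_{a,b} = s_a s_{a+1} ⋯ s_{b-1}` (`a ≤ b`). -/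
def sAsc (a b : ℕ) : Brauer R δ n :=
  ((List.range (b - a)).map (fun k => brS R δ n (a + k))).prod

/-- The descending product `s_{b,a} = s_{b-1} s_{b-2} ⋯ s_a` (`b ≥ a`). -/
def sDesc (b a : ℕ) : Brauer R δ n :=
  ((List.range (b - a)).map (fun k => brS R δ n (b - 1 - k))).prod

/-- The element `e^{(l)}_{i-1} = e_{i-2l+1} e_{i-2l+3} ⋯ e_{i-1}` (`l` factors). -/
def eStairBr (i l : ℕ) : Brauer R δ n :=
  ((List.range l).map (fun t => brE R δ n (i - 2 * l + 1 + 2 * t))).prod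

/-- The element `c_{(μ,m)} = (Σ_{v ∈ S_μ} v) e^{(m)}_{i-1}` of `B_i`, given the
elements `s_v` of the symmetric group inside the Brauer algebra. -/
def cBr (sw : Equiv.Perm (Fin n) → Brauer R δ n) (μ : YoungDiagram) (m : ℕ) :
    Brauer R δ n :=
  (∑ v ∈ RowStab n μ, sw v) * eStairBr R δ n n m

/-- The lifted branching coefficient `\bar d^{(i)}_{λ→μ} = s_{a,i}`. -/
def dBarBr (i : ℕ) (lam mu : YoungDiagram) : Brauer R δ n :=
  sAsc R δ n (aVal lam mu) i

/-- The lifted branching coefficient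
`\bar u^{(i)}_{λ→μ} = s_{i,a} Σ_{r=0}^{λ_j} s_{a,a-r}`. -/
def uBarBr (i : ℕ) (lam mu : YoungDiagram) : Brauer R δ n :=
  sDesc R δ n i (aVal lam mu) *
    ∑ r ∈ Finset.range (lam.rowLen (addedRow lam mu) + 1),
      sDesc R δ n (aVal lam mu) (aVal lam mu - r)

/-- The branching coefficient for one step of a path, into level `k+1`. -/
def dStepBr (k : ℕ) (a b : YoungDiagram × ℕ) : Brauer R δ n :=
  if b.2 = a.2 then dBarBr R δ n (k - 2 * a.2 + 1) a.1 b.1 * eStairBr R δ n k a.2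
  else uBarBr R δ n (k - 2 * a.2) b.1 a.1 * eStairBr R δ n k a.2

/-- The path element `d_t`. -/
def dPathBr (i : ℕ) {x : YoungDiagram × ℕ} (t : WPath i x) : Brauer R δ n :=
  ((List.ofFn (fun k : Fin i =>
      dStepBr R δ n k.val (t.1 k.castSucc) (t.1 k.succ))).reverse).prod

/-! ### Permutation diagrams -/

lemma swN_of {n j : ℕ} (h1 : 1 ≤ j) (h2 : j < n) :
    swN n j = Equiv.swap ⟨j - 1, by omega⟩ ⟨j, h2⟩ := by
  simp [swN, h1, h2]

lemma swN_mul_self (n j : ℕ) : swN n j * swN n j = 1 := by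
  unfold swN; split_ifs <;> simp

lemma invCount_swap_mul {n : ℕ} (v : Equiv.Perm (Fin n)) {x y : Fin n} (hxy : y.val = x.val + 1)
    (hlt : v⁻¹ x < v⁻¹ y) : invCount (Equiv.swap x y * v) = invCount v + 1 := by
  unfold invCount
  have key : (Finset.univ.filter fun p : Fin n × Fin n =>
      p.1 < p.2 ∧ (Equiv.swap x y * v) p.2 < (Equiv.swap x y * v) p.1) =
      insert (v⁻¹ x, v⁻¹ y) (Finset.univ.filter fun p : Fin n × Fin n =>
        p.1 < p.2 ∧ v p.2 < v p.1) := by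
    ext ⟨a, b⟩
    simp only [Finset.mem_filter, Finset.mem_univ, true_and, Finset.mem_insert, Prod.mk.injEq]
    simp only [Equiv.Perm.mul_apply, Equiv.Perm.eq_inv_iff_eq]
    have hab : v a = v b → a = b := fun h => v.injective h
    have hne : x ≠ y := by intro h; rw [h] at hxy; omega
    by_cases ha : v a = x
    · have ha' : a = v⁻¹ x := by rw [← ha]; simp
      by_cases hb : v b = y
      · have hb' : b = v⁻¹ y := by rw [← hb]; simp
        simp only [ha, hb, Equiv.swap_apply_left, Equiv.swap_apply_right, and_self, true_or,
          iff_true]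
        exact ⟨by rw [ha', hb']; exact hlt, by rw [Fin.lt_def]; omega⟩
      · by_cases hb2 : v b = x
        · have : a = b := hab (by rw [ha, hb2])
          simp [this, hb2, hne]
        · rw [Equiv.swap_apply_of_ne_of_ne hb2 hb]
          simp only [ha, Equiv.swap_apply_left, hb, and_false, false_or, Fin.lt_def]
          have h1 : (v b).val ≠ x.val := fun h => hb2 (Fin.ext h)
          omega
    · by_cases ha2 : v a = y
      · have ha' : a = v⁻¹ y := by rw [← ha2]; simp
        by_cases hb : v b = x
        · have hb' : b = v⁻¹ x := by rw [← hb]; simp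
          have : ¬ a < b := by rw [ha', hb']; exact not_lt.mpr hlt.le
          simp [ha2, hb, this, hne, hne.symm]
        · by_cases hb2 : v b = y
          · have : a = b := hab (by rw [ha2, hb2])
            simp [this, hb2, hne.symm]
          · rw [Equiv.swap_apply_of_ne_of_ne hb hb2]
            simp only [ha2, Equiv.swap_apply_right, hne.symm, false_and, false_or, Fin.lt_def]
            have h1 : (v b).val ≠ x.val := fun h => hb (Fin.ext h)
            omega
      · rw [Equiv.swap_apply_of_ne_of_ne ha ha2]
        simp only [ha, false_and, false_or]
        have h1 : (v a).val ≠ x.val := fun h => ha (Fin.ext h)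
        have h2 : (v a).val ≠ y.val := fun h => ha2 (Fin.ext h)
        by_cases hb : v b = x
        · simp only [hb, Equiv.swap_apply_left, Fin.lt_def]
          omega
        · by_cases hb2 : v b = y
          · simp only [hb2, Equiv.swap_apply_right, Fin.lt_def]
            omega
          · rw [Equiv.swap_apply_of_ne_of_ne hb hb2]
  have hvv : ∀ z, v (v⁻¹ z) = z := fun z => by simp
  rw [key, Finset.card_insert_of_notMem]
  simp only [Finset.mem_filter, Finset.mem_univ, true_and, not_and, hvv,
    Fin.lt_def]
  omega

/-- Induction principle: every permutation is a product of adjacent transpositions. -/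
lemma perm_induction_swN {n : ℕ} {P : Equiv.Perm (Fin n) → Prop} (h1 : P 1)
    (hs : ∀ j, 1 ≤ j → j < n → ∀ g, P g → P (swN n j * g)) (g : Equiv.Perm (Fin n)) : P g := by
  cases n with
  | zero => rw [Subsingleton.elim g 1]; exact h1
  | succ m =>
    have hg : g ∈ Submonoid.closure
        (Set.range fun i : Fin m => Equiv.swap i.castSucc i.succ) := by
      rw [Equiv.Perm.mclosure_swap_castSucc_succ]; trivial
    induction hg using Submonoid.closure_induction_left with
    | one => exact h1
    | mul_left x hx y _ ih =>
      obtain ⟨i, rfl⟩ := hx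
      have := hs (i.val + 1) (by omega) (by omega) y ih
      rwa [swN_of (by omega) (by omega)] at this

/-- The elements `s_v` assemble into a homomorphism from the symmetric group. -/
lemma exists_perm_hom {n : ℕ} {A : Type*} [Monoid A] (s : ℕ → A)
    (hss : ∀ j, 1 ≤ j → j < n → s j * s j = 1) (hout : ∀ j, ¬ (1 ≤ j ∧ j < n) → s j = 1)
    (sw : Equiv.Perm (Fin n) → A) (hsw1 : sw 1 = 1)
    (hswmul : ∀ (v : Equiv.Perm (Fin n)) (j : ℕ), 1 ≤ j → j < n →
      invCount (swN n j * v) = invCount v + 1 → sw (swN n j * v) = sw v * s j) :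
    ∃ π : Equiv.Perm (Fin n) →* A, (∀ v, sw v = π v⁻¹) ∧ ∀ j, π (swN n j) = s j := by
  have step : ∀ (v : Equiv.Perm (Fin n)) (j : ℕ), 1 ≤ j → j < n →
      sw (swN n j * v) = sw v * s j := by
    intro v j h1 h2
    set x : Fin n := ⟨j - 1, by omega⟩ with hx
    set y : Fin n := ⟨j, h2⟩ with hy
    have hsw : swN n j = Equiv.swap x y := swN_of h1 h2
    have hxy : y.val = x.val + 1 := by simp [hx, hy]; omega
    have hne : x ≠ y := by intro h; rw [h] at hxy; omega
    rcases lt_trichotomy (v⁻¹ x) (v⁻¹ y) with h | h | h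
    · exact hswmul v j h1 h2 (by rw [hsw]; exact invCount_swap_mul v hxy h)
    · exact absurd (v⁻¹.injective h) hne
    · have := hswmul (swN n j * v) j h1 h2 (by
        rw [hsw]; apply invCount_swap_mul _ hxy
        simpa [mul_inv_rev] using h)
      rw [← mul_assoc, swN_mul_self, one_mul] at this
      rw [this, mul_assoc, hss j h1 h2, mul_one]
  have anti : ∀ g v : Equiv.Perm (Fin n), sw (g * v) = sw v * sw g := by
    intro g v
    induction g using perm_induction_swN generalizing v with
    | h1 => simp [hsw1]
    | hs j h1 h2 g ih => rw [mul_assoc, step _ j h1 h2, ih, step _ j h1 h2, mul_assoc]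
  refine ⟨⟨⟨fun v => sw v⁻¹, by simp [hsw1]⟩, fun g h => by
    simp only [mul_inv_rev]; exact anti _ _⟩, fun v => by simp, fun j => ?_⟩
  show sw (swN n j)⁻¹ = s j
  by_cases h : 1 ≤ j ∧ j < n
  · rw [inv_eq_of_mul_eq_one_left (swN_mul_self n j)]
    simpa [hsw1] using step 1 j h.1 h.2
  · simp [swN, h, hsw1, hout j h]

/-- A subgroup containing the adjacent transpositions of an interval contains every permutation
supported in that interval. -/
lemma mem_of_support_interval {n : ℕ} (H : Subgroup (Equiv.Perm (Fin n))) (a b : ℕ)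
    (hH : ∀ j, a < j → j < b → swN n j ∈ H) (g : Equiv.Perm (Fin n))
    (hg : ∀ x : Fin n, g x ≠ x → a ≤ x.val ∧ x.val < b) : g ∈ H := by
  have hswap : ∀ d : ℕ, ∀ x y : Fin n, a ≤ x.val → y.val < b → y.val = x.val + d →
      Equiv.swap x y ∈ H := by
    intro d
    induction d with
    | zero =>
      intro x y _ _ h
      rw [show y = x from Fin.ext h, Equiv.swap_self]; exact H.one_mem
    | succ d ih =>
      intro x y hx hy h
      have hz : x.val + d < n := by omega
      have h1 := ih x ⟨x.val + d, hz⟩ hx (by simp; omega) rfl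
      have h2 := hH (x.val + d + 1) (by omega) (by omega)
      rw [swN_of (by omega) (by omega)] at h2
      have e1 : (⟨x.val + d + 1 - 1, by omega⟩ : Fin n) = ⟨x.val + d, hz⟩ := Fin.ext (by simp)
      have e2 : (⟨x.val + d + 1, by omega⟩ : Fin n) = y := Fin.ext (by simp; omega)
      rw [e1, e2] at h2
      rcases Nat.eq_zero_or_pos d with rfl | hd
      · exact h2
      · have hzx : x ≠ ⟨x.val + d, hz⟩ := by
          intro hh; have := congrArg Fin.val hh; simp at this; omega
        have hxy : x ≠ y := by intro hh; rw [hh] at h; omega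
        have := H.mul_mem (H.mul_mem h2 h1) h2
        rwa [Equiv.swap_mul_swap_mul_swap hzx hxy, Equiv.swap_comm] at this
  have hswap' : ∀ x y : Fin n, a ≤ x.val → x.val < b → a ≤ y.val → y.val < b →
      Equiv.swap x y ∈ H := by
    intro x y h1 h2 h3 h4
    rcases le_total x.val y.val with h | h
    · exact hswap (y.val - x.val) x y h1 h4 (by omega)
    · rw [Equiv.swap_comm]; exact hswap (x.val - y.val) y x h3 h2 (by omega)
  induction hk : g.support.card using Nat.strong_induction_on generalizing g with
  | _ k ih =>
    by_cases h1 : g = 1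
    · rw [h1]; exact H.one_mem
    · obtain ⟨x, hx⟩ : ∃ x, g x ≠ x := by
        by_contra! hh; exact h1 (Equiv.ext hh)
      have hgx : g (g x) ≠ g x := fun h => hx (g.injective h)
      have hlt := Equiv.Perm.card_support_swap_mul hx
      have hs := hswap' x (g x) (hg x hx).1 (hg x hx).2 (hg _ hgx).1 (hg _ hgx).2
      have := ih _ (hk ▸ hlt) (Equiv.swap x (g x) * g) (by
        intro y hy
        by_contra hy'
        have hgy : g y = y := by by_contra h; exact hy' (hg y h)
        have hyx : y ≠ x := by rintro rfl; exact hx hgy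
        have hygx : y ≠ g x := by
          intro h; apply hyx; apply g.injective; rw [hgy, ← h]
        apply hy
        rw [Equiv.Perm.mul_apply, hgy, Equiv.swap_apply_of_ne_of_ne hyx hygx]) rfl
      have h2 := H.mul_mem hs this
      rwa [← mul_assoc, Equiv.swap_mul_self, one_mul] at h2

/-! ### Relations in the Brauer algebra -/

section Relations
variable {R : Type} [CommRing R] {δ : R} {n : ℕ}

lemma brS_out {j : ℕ} (h : ¬ (1 ≤ j ∧ j < n)) : brS R δ n j = 1 := dif_neg h

lemma brS_mul_self (j : ℕ) : brS R δ n j * brS R δ n j = 1 := by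
  by_cases h : 1 ≤ j ∧ j < n
  · have := RingQuot.mkAlgHom_rel R (BrRel.inv (R := R) (δ := δ) (n := n) ⟨j, h⟩)
    simpa [brS, h] using this
  · simp [brS, h]

lemma brE_mul_self {j : ℕ} (h : 1 ≤ j ∧ j < n) : brE R δ n j * brE R δ n j = δ • brE R δ n j := by
  have := RingQuot.mkAlgHom_rel R (BrRel.idem (R := R) (δ := δ) (n := n) ⟨j, h⟩)
  rw [map_mul, map_mul, AlgHom.commutes, ← Algebra.smul_def] at this
  simpa [brE, h] using this

lemma brS_mul_brE_comm {i j : ℕ} (hi : 1 ≤ i ∧ i < n) (hj : 1 ≤ j ∧ j < n)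
    (h : i + 1 < j ∨ j + 1 < i) : brS R δ n i * brE R δ n j = brE R δ n j * brS R δ n i := by
  have := RingQuot.mkAlgHom_rel R (BrRel.seComm (R := R) (δ := δ) (n := n) ⟨i, hi⟩ ⟨j, hj⟩ h)
  simpa [brS, brE, hi, hj] using this

lemma brE_mul_brE_comm {i j : ℕ} (hi : 1 ≤ i ∧ i < n) (hj : 1 ≤ j ∧ j < n)
    (h : i + 1 < j ∨ j + 1 < i) : brE R δ n i * brE R δ n j = brE R δ n j * brE R δ n i := by
  have := RingQuot.mkAlgHom_rel R (BrRel.eeComm (R := R) (δ := δ) (n := n) ⟨i, hi⟩ ⟨j, hj⟩ h)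
  simpa [brS, brE, hi, hj] using this

lemma brE_mul_brE_mul_brE {i j : ℕ} (hi : 1 ≤ i ∧ i < n) (hj : 1 ≤ j ∧ j < n)
    (h : j = i + 1 ∨ i = j + 1) : brE R δ n i * brE R δ n j * brE R δ n i = brE R δ n i := by
  have := RingQuot.mkAlgHom_rel R (BrRel.tangle1 (R := R) (δ := δ) (n := n) ⟨i, hi⟩ ⟨j, hj⟩ h)
  simpa [brS, brE, hi, hj] using this

lemma brS_mul_brS_mul_brE {i j : ℕ} (hi : 1 ≤ i ∧ i < n) (hj : 1 ≤ j ∧ j < n)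
    (h : j = i + 1 ∨ i = j + 1) :
    brS R δ n i * brS R δ n j * brE R δ n i = brE R δ n j * brE R δ n i := by
  have := RingQuot.mkAlgHom_rel R (BrRel.tangle2 (R := R) (δ := δ) (n := n) ⟨i, hi⟩ ⟨j, hj⟩ h)
  simpa [brS, brE, hi, hj] using this

lemma brE_mul_brS_mul_brS {i j : ℕ} (hi : 1 ≤ i ∧ i < n) (hj : 1 ≤ j ∧ j < n)
    (h : j = i + 1 ∨ i = j + 1) :
    brE R δ n i * brS R δ n j * brS R δ n i = brE R δ n i * brE R δ n j := by
  have := RingQuot.mkAlgHom_rel R (BrRel.tangle3 (R := R) (δ := δ) (n := n) ⟨i, hi⟩ ⟨j, hj⟩ h)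
  simpa [brS, brE, hi, hj] using this

lemma brS_mul_brE {i : ℕ} (hi : 1 ≤ i ∧ i < n) : brS R δ n i * brE R δ n i = brE R δ n i := by
  have := RingQuot.mkAlgHom_rel R (BrRel.untwistR (R := R) (δ := δ) (n := n) ⟨i, hi⟩)
  simpa [brS, brE, hi] using this

lemma brE_mul_brS {i : ℕ} (hi : 1 ≤ i ∧ i < n) : brE R δ n i * brS R δ n i = brE R δ n i := by
  have := RingQuot.mkAlgHom_rel R (BrRel.untwistL (R := R) (δ := δ) (n := n) ⟨i, hi⟩)
  simpa [brS, brE, hi] using this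

/-- A submodule containing `1` and closed under right multiplication by the generators is
everything. -/
lemma brauer_mul_induction {M : Submodule R (Brauer R δ n)}
    (hS : ∀ j, 1 ≤ j → j < n → ∀ x ∈ M, x * brS R δ n j ∈ M)
    (hE : ∀ j, 1 ≤ j → j < n → ∀ x ∈ M, x * brE R δ n j ∈ M) (b : Brauer R δ n) :
    ∀ x ∈ M, x * b ∈ M := by
  obtain ⟨f, rfl⟩ := RingQuot.mkAlgHom_surjective R (BrRel R δ n) b
  induction f using FreeAlgebra.induction with
  | grade0 r =>
    intro x hx
    rw [AlgHom.commutes, ← Algebra.commutes, ← Algebra.smul_def]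
    exact M.smul_mem r hx
  | grade1 g =>
    intro x hx
    cases g with
    | S i => have := hS i.1 i.2.1 i.2.2 x hx; simpa [brS, i.2.1, i.2.2] using this
    | E i => have := hE i.1 i.2.1 i.2.2 x hx; simpa [brE, i.2.1, i.2.2] using this
  | mul a b iha ihb =>
    intro x hx
    rw [map_mul, ← mul_assoc]; exact ihb _ (iha _ hx)
  | add a b iha ihb =>
    intro x hx
    rw [map_add, mul_add]; exact M.add_mem (iha _ hx) (ihb _ hx)

end Relations

/-! ### Arc elements -/

/-- A homomorphism `π` from the symmetric group together with elements `E p q` satisfying the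
relations of the Brauer diagrams with one horizontal arc `{p, q}` on each side. -/
structure ArcSystem {R : Type} [CommRing R] {A : Type} [Ring A] [Algebra R A] (δ : R) {n : ℕ}
    (π : Equiv.Perm (Fin n) →* A) (E : Fin n → Fin n → A) : Prop where
  conj : ∀ g p q, π g * E p q = E (g p) (g q) * π g
  symm : ∀ p q, E p q = E q p
  absorb : ∀ p q, E p q * π (Equiv.swap p q) = E p q
  sq : ∀ p q, E p q * E p q = δ • E p q
  chain : ∀ p q r, p ≠ q → q ≠ r → p ≠ r → E p q * E q r = E p q * π (Equiv.swap p r)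
  comm : ∀ p q r s, p ≠ r → p ≠ s → q ≠ r → q ≠ s → E p q * E r s = E r s * E p q

section Exists
variable {R : Type} [CommRing R] {δ : R} {n : ℕ}

lemma brauer_commute_of_fix (π : Equiv.Perm (Fin n) →* Brauer R δ n)
    (hπ : ∀ j, π (swN n j) = brS R δ n j) (hn : 2 ≤ n) (h : Equiv.Perm (Fin n))
    (h0 : h ⟨0, by omega⟩ = ⟨0, by omega⟩) (h1 : h ⟨1, by omega⟩ = ⟨1, by omega⟩) :
    π h * brE R δ n 1 = brE R δ n 1 * π h := by
  let H : Subgroup (Equiv.Perm (Fin n)) :=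
    { carrier := {g | Commute (π g) (brE R δ n 1)}
      mul_mem' := fun {a b} ha hb => by
        show Commute (π (a * b)) _
        rw [map_mul]; exact Commute.mul_left ha hb
      one_mem' := by show Commute (π 1) _; rw [map_one]; exact Commute.one_left _
      inv_mem' := fun {a} ha => by
        show Commute (π a⁻¹) _
        have ha' : Commute (π a) (brE R δ n 1) := ha
        have e1 : π a⁻¹ * π a = 1 := by rw [← map_mul]; simp
        have e2 : π a * π a⁻¹ = 1 := by rw [← map_mul]; simp
        calc π a⁻¹ * brE R δ n 1 = π a⁻¹ * (brE R δ n 1 * π a) * π a⁻¹ := by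
              rw [mul_assoc, mul_assoc, e2, mul_one]
          _ = π a⁻¹ * (π a * brE R δ n 1) * π a⁻¹ := by rw [ha'.eq]
          _ = _ := by rw [← mul_assoc, e1, one_mul] }
  refine mem_of_support_interval H 2 n (fun j hj hjn => ?_) h (fun x hx => ⟨?_, x.2⟩)
  · show Commute _ _
    rw [hπ]
    exact brS_mul_brE_comm ⟨by omega, hjn⟩ ⟨le_rfl, by omega⟩ (Or.inr (by omega))
  · by_contra hlt
    have : x.val = 0 ∨ x.val = 1 := by omega
    rcases this with hh | hh
    · exact hx (by rw [show x = ⟨0, by omega⟩ from Fin.ext hh]; exact h0)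
    · exact hx (by rw [show x = ⟨1, by omega⟩ from Fin.ext hh]; exact h1)

lemma exists_perm_apply_two {α : Type*} [DecidableEq α] {a b p q : α} (hab : a ≠ b) (hpq : p ≠ q) :
    ∃ σ : Equiv.Perm α, σ a = p ∧ σ b = q := by
  refine ⟨Equiv.swap (Equiv.swap a p b) q * Equiv.swap a p, ?_, ?_⟩
  · rw [Equiv.Perm.mul_apply, Equiv.swap_apply_left]
    apply Equiv.swap_apply_of_ne_of_ne _ hpq
    intro h
    apply hab
    apply (Equiv.swap a p).injective
    rw [← h, Equiv.swap_apply_left]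
  · simp

lemma exists_arcSystem (π : Equiv.Perm (Fin n) →* Brauer R δ n)
    (hπ : ∀ j, π (swN n j) = brS R δ n j) :
    ∃ E : Fin n → Fin n → Brauer R δ n, ArcSystem δ π E ∧
      ∀ j (h1 : 1 ≤ j) (h2 : j < n), brE R δ n j = E ⟨j - 1, by omega⟩ ⟨j, h2⟩ := by
  by_cases hn : n < 2
  · refine ⟨fun _ _ => 0, ⟨?_, ?_, ?_, ?_, ?_, ?_⟩, fun j h1 h2 => by omega⟩ <;> simp
  push Not at hn
  have hinv : ∀ g, π g⁻¹ * π g = 1 := fun g => by rw [← map_mul]; simp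
  have hinv' : ∀ g, π g * π g⁻¹ = 1 := fun g => by rw [← map_mul]; simp
  set p0 : Fin n := ⟨0, by omega⟩ with hp0
  set p1 : Fin n := ⟨1, by omega⟩ with hp1
  have h01 : p0 ≠ p1 := by simp [hp0, hp1]
  have hex : ∀ p q : Fin n, p ≠ q → ∃ σ : Equiv.Perm (Fin n), σ p0 = p ∧ σ p1 = q :=
    fun p q h => exists_perm_apply_two h01 h
  choose σ hσ0 hσ1 using hex
  set E : Fin n → Fin n → Brauer R δ n := fun p q =>
    if h : p ≠ q then π (σ p q h) * brE R δ n 1 * π (σ p q h)⁻¹ else 0 with hE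
  have Eeq : ∀ p q (τ : Equiv.Perm (Fin n)), τ p0 = p → τ p1 = q →
      E p q = π τ * brE R δ n 1 * π τ⁻¹ := by
    intro p q τ h0 h1
    have hpq : p ≠ q := by rw [← h0, ← h1]; exact fun h => h01 (τ.injective h)
    have hfix := brauer_commute_of_fix π hπ hn (τ⁻¹ * σ p q hpq)
      (by rw [Equiv.Perm.mul_apply]; change τ⁻¹ (σ p q hpq p0) = p0; rw [hσ0, ← h0]; simp)
      (by rw [Equiv.Perm.mul_apply]; change τ⁻¹ (σ p q hpq p1) = p1; rw [hσ1, ← h1]; simp)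
    simp only [hE, hpq, ne_eq, not_false_eq_true, dif_pos]
    have e : π (σ p q hpq) = π τ * π (τ⁻¹ * σ p q hpq) := by rw [← map_mul]; simp
    calc π (σ p q hpq) * brE R δ n 1 * π (σ p q hpq)⁻¹
        = π τ * (π (τ⁻¹ * σ p q hpq) * brE R δ n 1) * π (σ p q hpq)⁻¹ := by
          nth_rewrite 1 [e]; simp only [mul_assoc]
      _ = π τ * brE R δ n 1 * (π (τ⁻¹ * σ p q hpq) * π (σ p q hpq)⁻¹) := by
          rw [hfix]; simp only [mul_assoc]
      _ = _ := by rw [← map_mul]; simp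
  have E0 : ∀ p, E p p = 0 := fun p => by simp [hE]
  have E01 : E p0 p1 = brE R δ n 1 := by simpa using Eeq p0 p1 1 rfl rfl
  have conj : ∀ g p q, π g * E p q = E (g p) (g q) * π g := by
    intro g p q
    by_cases hpq : p = q
    · subst hpq; rw [E0, E0]; simp
    · rw [Eeq p q _ (hσ0 p q hpq) (hσ1 p q hpq), Eeq (g p) (g q) (g * σ p q hpq)
        (by simp [hσ0]) (by simp [hσ1])]
      simp only [mul_inv_rev, map_mul, mul_assoc, hinv, mul_one]
  have conj' : ∀ g p q, E (g p) (g q) = π g * E p q * π g⁻¹ := by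
    intro g p q; rw [conj, mul_assoc, hinv', mul_one]
  have hs1 : π (Equiv.swap p0 p1) = brS R δ n 1 := by
    rw [← hπ, swN_of le_rfl (by omega)]
  have symm : ∀ p q, E p q = E q p := by
    intro p q
    by_cases hpq : p = q
    · rw [hpq]
    · rw [Eeq q p (σ p q hpq * Equiv.swap p0 p1) (by simp [hσ1]) (by simp [hσ0]),
        Eeq p q _ (hσ0 p q hpq) (hσ1 p q hpq), mul_inv_rev, map_mul, map_mul, Equiv.swap_inv, hs1]
      have k : ∀ z, brS R δ n 1 * (brE R δ n 1 * (brS R δ n 1 * z)) = brE R δ n 1 * z := by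
        intro z
        rw [← mul_assoc (brE R δ n 1), brE_mul_brS ⟨le_rfl, by omega⟩, ← mul_assoc,
          brS_mul_brE ⟨le_rfl, by omega⟩]
      simp only [mul_assoc, k]
  have absorb0 : E p0 p1 * π (Equiv.swap p0 p1) = E p0 p1 := by
    rw [E01, hs1, brE_mul_brS ⟨le_rfl, by omega⟩]
  -- identification with the generators
  have hgen : ∀ j (h1 : 1 ≤ j) (h2 : j < n), brE R δ n j = E ⟨j - 1, by omega⟩ ⟨j, h2⟩ := by
    intro j h1
    induction j, h1 using Nat.le_induction with
    | base => intro h2; exact E01.symm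
    | succ j hj ih =>
      intro h2
      have hjn : j < n := by omega
      have e2 : brE R δ n (j + 1) = brS R δ n j * brS R δ n (j + 1) * brE R δ n j *
          (brS R δ n (j + 1) * brS R δ n j) := by
        rw [brS_mul_brS_mul_brE ⟨hj, hjn⟩ ⟨by omega, h2⟩ (Or.inl rfl), mul_assoc,
          ← mul_assoc (brE R δ n j), brE_mul_brS_mul_brS ⟨hj, hjn⟩ ⟨by omega, h2⟩ (Or.inl rfl),
          ← mul_assoc, brE_mul_brE_mul_brE ⟨by omega, h2⟩ ⟨hj, hjn⟩ (Or.inr rfl)]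
      have e3 := conj' (swN n j * swN n (j + 1)) ⟨j - 1, by omega⟩ ⟨j, hjn⟩
      have i1 : (swN n j)⁻¹ = swN n j := inv_eq_of_mul_eq_one_left (swN_mul_self n j)
      have i2 : (swN n (j + 1))⁻¹ = swN n (j + 1) := inv_eq_of_mul_eq_one_left (swN_mul_self n _)
      rw [mul_inv_rev, i1, i2, map_mul, map_mul, hπ, hπ, ← ih hjn, ← e2] at e3
      rw [← e3]
      have f1 : (swN n j * swN n (j + 1)) ⟨j - 1, by omega⟩ = ⟨j, hjn⟩ := by
        rw [Equiv.Perm.mul_apply, swN_of hj hjn, swN_of (by omega) h2,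
          Equiv.swap_apply_of_ne_of_ne (x := (⟨j - 1, by omega⟩ : Fin n))
            (a := ⟨j + 1 - 1, by omega⟩) (by simp [Fin.ext_iff]; omega) (by simp [Fin.ext_iff]),
          Equiv.swap_apply_left]
      have f2 : (swN n j * swN n (j + 1)) ⟨j, hjn⟩ = ⟨j + 1, h2⟩ := by
        rw [Equiv.Perm.mul_apply, swN_of hj hjn, swN_of (by omega) h2,
          show (⟨j, hjn⟩ : Fin n) = ⟨j + 1 - 1, by omega⟩ from Fin.ext (by simp),
          Equiv.swap_apply_left, Equiv.swap_apply_of_ne_of_ne]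
        · simp [Fin.ext_iff]; omega
        · simp [Fin.ext_iff]
      rw [f1, f2]
      congr 1
  have hcancel : ∀ {g : Equiv.Perm (Fin n)} {x y : Brauer R δ n}, x = y →
      π g * x * π g⁻¹ = π g * y * π g⁻¹ := fun h => by rw [h]
  have hmulc : ∀ (g : Equiv.Perm (Fin n)) (x y : Brauer R δ n),
      π g * x * π g⁻¹ * (π g * y * π g⁻¹) = π g * (x * y) * π g⁻¹ := by
    intro g x y
    simp only [mul_assoc]
    rw [← mul_assoc (π g⁻¹) (π g), hinv, one_mul]
  have hswapc : ∀ (g : Equiv.Perm (Fin n)) p q, π (Equiv.swap (g p) (g q)) =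
      π g * π (Equiv.swap p q) * π g⁻¹ := by
    intro g p q
    rw [Equiv.swap_apply_apply, map_mul, map_mul]
  refine ⟨E, ⟨conj, symm, ?_, ?_, ?_, ?_⟩, hgen⟩
  · intro p q
    by_cases hpq : p = q
    · subst hpq; rw [E0, zero_mul]
    · obtain ⟨g, rfl, rfl⟩ := exists_perm_apply_two h01 hpq
      rw [hswapc, conj', hmulc, absorb0]
  · intro p q
    by_cases hpq : p = q
    · subst hpq; simp [E0]
    · obtain ⟨g, rfl, rfl⟩ := exists_perm_apply_two h01 hpq
      rw [conj', hmulc, E01, brE_mul_self ⟨le_rfl, by omega⟩, mul_smul_comm, smul_mul_assoc]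
  · intro p q r hpq hqr hpr
    obtain ⟨g, rfl, rfl⟩ := exists_perm_apply_two h01 hpq
    obtain ⟨r, rfl⟩ := g.surjective r
    replace hqr : p1 ≠ r := fun h => hqr (by rw [h])
    replace hpr : p0 ≠ r := fun h => hpr (by rw [h])
    rw [hswapc, conj', conj', hmulc, hmulc]
    apply hcancel
    have hr : 2 ≤ r.val := by
      have h1 : r.val ≠ 0 := fun h => hpr (Fin.ext h.symm)
      have h2 : r.val ≠ 1 := fun h => hqr (Fin.ext h.symm)
      omega
    have h2n : 2 < n := lt_of_le_of_lt hr r.2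
    set p2 : Fin n := ⟨2, h2n⟩ with hp2
    have h02 : p0 ≠ p2 := by simp [hp0, hp2]
    have h12 : p1 ≠ p2 := by simp [hp1, hp2]
    have g0 : Equiv.swap p2 r p0 = p0 := Equiv.swap_apply_of_ne_of_ne h02 hpr
    have g1 : Equiv.swap p2 r p1 = p1 := Equiv.swap_apply_of_ne_of_ne h12 hqr
    have c1 := conj' (Equiv.swap p2 r) p0 p1
    have c2 := conj' (Equiv.swap p2 r) p1 p2
    have c3 := hswapc (Equiv.swap p2 r) p0 p2
    rw [g0, g1] at c1
    rw [g1, Equiv.swap_apply_left] at c2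
    rw [g0, Equiv.swap_apply_left] at c3
    rw [c2, c3, c1, hmulc, hmulc]
    apply hcancel
    have hE2 : E p1 p2 = brE R δ n 2 := (hgen 2 (by omega) h2n).symm
    have hs2 : π (Equiv.swap p1 p2) = brS R δ n 2 := by
      rw [← hπ, swN_of (by omega) h2n]
    have h3 : Equiv.swap p0 p2 = Equiv.swap p0 p1 * (Equiv.swap p1 p2 * Equiv.swap p0 p1) := by
      rw [← mul_assoc, Equiv.swap_comm p0 p1, Equiv.swap_comm p1 p2,
        Equiv.swap_mul_swap_mul_swap h12.symm h02.symm, Equiv.swap_comm]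
    rw [E01, hE2, h3, map_mul, map_mul, hs1, hs2, ← mul_assoc, brE_mul_brS ⟨le_rfl, by omega⟩,
      ← mul_assoc, brE_mul_brS_mul_brS ⟨le_rfl, by omega⟩ ⟨by omega, h2n⟩ (Or.inl rfl)]
  · intro p q r s hpr hps hqr hqs
    by_cases hpq : p = q
    · subst hpq; simp [E0]
    by_cases hrs : r = s
    · subst hrs; simp [E0]
    obtain ⟨g, rfl, rfl⟩ := exists_perm_apply_two h01 hpq
    obtain ⟨r, rfl⟩ := g.surjective r
    obtain ⟨s, rfl⟩ := g.surjective s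
    rw [conj', conj' g r s, hmulc, hmulc]
    apply hcancel
    have hr0 : r.val ≠ 0 := fun h => hpr (by rw [show r = p0 from Fin.ext h])
    have hr1 : r.val ≠ 1 := fun h => hqr (by rw [show r = p1 from Fin.ext h])
    have hs0 : s.val ≠ 0 := fun h => hps (by rw [show s = p0 from Fin.ext h])
    have hs1 : s.val ≠ 1 := fun h => hqs (by rw [show s = p1 from Fin.ext h])
    have hrs' : r.val ≠ s.val := fun h => hrs (by rw [Fin.ext h])
    have h3n : 3 < n := by have := r.2; have := s.2; omega
    set p2 : Fin n := ⟨2, by omega⟩ with hp2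
    set p3 : Fin n := ⟨3, by omega⟩ with hp3
    have h23 : p2 ≠ p3 := by simp [hp2, hp3]
    obtain ⟨t, ht0, ht1, rfl, rfl⟩ : ∃ t : Equiv.Perm (Fin n), t p0 = p0 ∧ t p1 = p1 ∧
        t p2 = r ∧ t p3 = s := by
      set t1 := Equiv.swap p2 r
      have a0 : t1 p0 = p0 := Equiv.swap_apply_of_ne_of_ne (by simp [hp0, hp2])
        (fun h => hr0 (by rw [← h]))
      have a1 : t1 p1 = p1 := Equiv.swap_apply_of_ne_of_ne (by simp [hp1, hp2])
        (fun h => hr1 (by rw [← h]))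
      have a2 : t1 p2 = r := Equiv.swap_apply_left _ _
      have n0 : p0 ≠ t1 p3 := by
        rw [← a0]; intro h; have := t1.injective h; simp [hp0, hp3] at this
      have n1 : p1 ≠ t1 p3 := by
        rw [← a1]; intro h; have := t1.injective h; simp [hp1, hp3] at this
      have n2 : r ≠ t1 p3 := by
        rw [← a2]; intro h; exact h23 (t1.injective h)
      refine ⟨Equiv.swap (t1 p3) s * t1, ?_, ?_, ?_, by simp⟩
      · rw [Equiv.Perm.mul_apply, a0, Equiv.swap_apply_of_ne_of_ne n0 (fun h => hs0 (by rw [← h]))]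
      · rw [Equiv.Perm.mul_apply, a1, Equiv.swap_apply_of_ne_of_ne n1 (fun h => hs1 (by rw [← h]))]
      · rw [Equiv.Perm.mul_apply, a2, Equiv.swap_apply_of_ne_of_ne n2 (fun h => hrs (by rw [h]))]
    have c1 := conj' t p0 p1
    rw [ht0, ht1] at c1
    rw [c1, conj' t p2 p3, hmulc, hmulc]
    apply hcancel
    have hE3 : E p2 p3 = brE R δ n 3 := (hgen 3 (by omega) h3n).symm
    rw [E01, hE3]
    exact brE_mul_brE_comm ⟨le_rfl, by omega⟩ ⟨by omega, h3n⟩ (Or.inl (by omega))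

end Exists

namespace ArcSystem
variable {R : Type} [CommRing R] {A : Type} [Ring A] [Algebra R A] {δ : R} {n : ℕ}
  {π : Equiv.Perm (Fin n) →* A} {E : Fin n → Fin n → A}

lemma conj' (h : ArcSystem δ π E) (g : Equiv.Perm (Fin n)) (p q : Fin n) :
    E (g p) (g q) = π g * E p q * π g⁻¹ := by
  rw [h.conj, mul_assoc, ← map_mul]; simp

lemma mul_perm (h : ArcSystem δ π E) (g : Equiv.Perm (Fin n)) (p q : Fin n) :
    E p q * π g = π g * E (g⁻¹ p) (g⁻¹ q) := by
  rw [h.conj]; simp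

/-- Two disjoint arcs absorb the permutation exchanging them. -/
lemma block_swap (h : ArcSystem δ π E) {p q r s : Fin n} (hpq : p ≠ q) (hpr : p ≠ r) (hps : p ≠ s)
    (hqr : q ≠ r) (hqs : q ≠ s) (hrs : r ≠ s) :
    E p q * E r s * π (Equiv.swap p r * Equiv.swap q s) = E p q * E r s := by
  have e1 : E r s * π (Equiv.swap p r) = π (Equiv.swap p r) * E p s := by
    rw [h.mul_perm, Equiv.swap_inv, Equiv.swap_apply_right,
      Equiv.swap_apply_of_ne_of_ne hps.symm hrs.symm]
  have e2 : E p q * E p s = E p q * π (Equiv.swap q s) := by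
    rw [h.symm p q]; exact h.chain q p s hpq.symm hps hqs
  have e3 : π (Equiv.swap q s) * E q r = E r s * π (Equiv.swap q s) := by
    rw [h.conj, Equiv.swap_apply_left, Equiv.swap_apply_of_ne_of_ne hqr.symm hrs, h.symm]
  have key : E p q * E r s * π (Equiv.swap p r) = E p q * E r s * π (Equiv.swap q s) := by
    calc E p q * E r s * π (Equiv.swap p r) = E p q * (π (Equiv.swap p r) * E p s) := by
          rw [mul_assoc, e1]
      _ = E p q * E q r * E p s := by rw [← mul_assoc, h.chain p q r hpq hqr hpr]
      _ = E p q * (E p s * E q r) := by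
          rw [mul_assoc, h.comm q r p s hpq.symm hqs hpr.symm hrs]
      _ = E p q * (π (Equiv.swap q s) * E q r) := by rw [← mul_assoc, e2, mul_assoc]
      _ = _ := by rw [e3, mul_assoc]
  rw [map_mul, ← mul_assoc, key, mul_assoc, ← map_mul, Equiv.swap_mul_self, map_one, mul_one]

end ArcSystem

/-! ### Staircase elements -/

section Staircase
variable {R : Type} [CommRing R] {δ : R} {n : ℕ}

lemma commute_brS_brE {i j : ℕ} (h : i + 1 < j ∨ j + 1 < i) :
    Commute (brS R δ n i) (brE R δ n j) := by
  by_cases hi : 1 ≤ i ∧ i < n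
  · by_cases hj : 1 ≤ j ∧ j < n
    · exact brS_mul_brE_comm hi hj h
    · simp [brE, hj]
  · simp [brS, hi]

lemma commute_brE_brE {i j : ℕ} (h : i + 1 < j ∨ j + 1 < i) :
    Commute (brE R δ n i) (brE R δ n j) := by
  by_cases hi : 1 ≤ i ∧ i < n
  · by_cases hj : 1 ≤ j ∧ j < n
    · exact brE_mul_brE_comm hi hj h
    · simp [brE, hj]
  · simp [brE, hi]

lemma commute_brS_brS {i j : ℕ} (h : i + 1 < j ∨ j + 1 < i) :
    Commute (brS R δ n i) (brS R δ n j) := by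
  by_cases hi : 1 ≤ i ∧ i < n
  · by_cases hj : 1 ≤ j ∧ j < n
    · have := RingQuot.mkAlgHom_rel R (BrRel.braidComm (R := R) (δ := δ) (n := n) ⟨i, hi⟩ ⟨j, hj⟩ h)
      show _ * _ = _ * _
      simpa [brS, brE, hi, hj] using this
    · simp [brS, hj]
  · simp [brS, hi]

lemma commute_list_prod_map {A : Type*} [Monoid A] {f : ℕ → A} {m : ℕ} {x : A}
    (h : ∀ k < m, Commute x (f k)) : Commute x ((List.range m).map f).prod := by
  apply Commute.list_prod_right
  intro y hy
  obtain ⟨k, hk, rfl⟩ := List.mem_map.mp hy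
  exact h k (List.mem_range.mp hk)

lemma commute_sAsc {a b : ℕ} {x : Brauer R δ n} (h : ∀ j, a ≤ j → j < b → Commute x (brS R δ n j)) :
    Commute x (sAsc R δ n a b) :=
  commute_list_prod_map fun k hk => h _ (by omega) (by omega)

lemma commute_sDesc {a b : ℕ} {x : Brauer R δ n}
    (h : ∀ j, a ≤ j → j < b → Commute x (brS R δ n j)) :
    Commute x (sDesc R δ n b a) :=
  commute_list_prod_map fun k hk => h _ (by omega) (by omega)

lemma commute_eStairBr {k l : ℕ} {x : Brauer R δ n}
    (h : ∀ j, k - 2 * l + 1 ≤ j → j < k - 2 * l + 2 * l → Commute x (brE R δ n j)) :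
    Commute x (eStairBr R δ n k l) :=
  commute_list_prod_map fun t ht => h _ (by omega) (by omega)

lemma sAsc_succ {a b : ℕ} (h : a ≤ b) :
    sAsc R δ n a (b + 1) = sAsc R δ n a b * brS R δ n b := by
  unfold sAsc
  rw [show b + 1 - a = (b - a) + 1 by omega, List.range_succ, List.map_append, List.prod_append]
  simp [show a + (b - a) = b by omega]

lemma sAsc_mul_sAsc {a b c : ℕ} (h : a ≤ b) (h' : b ≤ c) :
    sAsc R δ n a b * sAsc R δ n b c = sAsc R δ n a c := by
  induction c, h' using Nat.le_induction with
  | base => simp [sAsc]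
  | succ c hc ih => rw [sAsc_succ hc, ← mul_assoc, ih, sAsc_succ (h.trans hc)]

lemma sDesc_succ_left {a b : ℕ} (h : a ≤ b) :
    sDesc R δ n (b + 1) a = brS R δ n b * sDesc R δ n b a := by
  unfold sDesc
  rw [show b + 1 - a = (b - a) + 1 by omega, List.range_succ_eq_map, List.map_cons, List.prod_cons,
    List.map_map]
  congr 1
  apply congrArg
  apply List.map_congr_left
  intro k hk
  rw [List.mem_range] at hk
  show brS R δ n (b + 1 - 1 - (k + 1)) = _
  congr 1
  omega

lemma sDesc_mul_sDesc {a b c : ℕ} (h : a ≤ b) (h' : b ≤ c) :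
    sDesc R δ n c b * sDesc R δ n b a = sDesc R δ n c a := by
  induction c, h' using Nat.le_induction with
  | base => simp [sDesc]
  | succ c hc ih => rw [sDesc_succ_left hc, mul_assoc, ih, sDesc_succ_left (h.trans hc)]

lemma eStairBr_zero (k : ℕ) : eStairBr R δ n k 0 = 1 := by simp [eStairBr]

lemma eStairBr_succ {k l : ℕ} (h : 2 * (l + 1) ≤ k) :
    eStairBr R δ n k (l + 1) = eStairBr R δ n (k - 2) l * brE R δ n (k - 1) := by
  unfold eStairBr
  rw [List.range_succ, List.map_append, List.prod_append,
    show k - 2 * (l + 1) = k - 2 - 2 * l by omega]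
  simp [show k - 2 - 2 * l + 1 + 2 * l = k - 1 by omega]

lemma eStairBr_succ_left {k l : ℕ} (h : 2 * (l + 1) ≤ k) :
    eStairBr R δ n k (l + 1) = brE R δ n (k - 2 * l - 1) * eStairBr R δ n k l := by
  unfold eStairBr
  rw [List.range_succ_eq_map, List.map_cons, List.prod_cons, List.map_map,
    show k - 2 * (l + 1) + 1 + 2 * 0 = k - 2 * l - 1 by omega]
  congr 2
  apply List.map_congr_left
  intro t ht
  show brE R δ n _ = _
  congr 1
  simp only [Nat.succ_eq_add_one]
  omega

lemma eStairBr_mul_eStairBr {k l : ℕ} (hl : 2 * l + 1 ≤ k) (hk : k ≤ n) :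
    eStairBr R δ n k l * eStairBr R δ n (k - 1) l =
      eStairBr R δ n k l * sAsc R δ n (k - 2 * l) k := by
  induction l generalizing k with
  | zero => simp [eStairBr, sAsc]
  | succ l ih =>
    have c1 : Commute (brE R δ n (k - 1)) (eStairBr R δ n (k - 1 - 2) l) :=
      commute_eStairBr fun j h1 h2 => commute_brE_brE (by omega)
    have c2 : Commute (brE R δ n (k - 1)) (sAsc R δ n (k - 2 * (l + 1)) (k - 2)) :=
      commute_sAsc fun j h1 h2 => (commute_brS_brE (by omega)).symm
    have ih' := ih (k := k - 2) (by omega) (by omega)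
    have t3 : brE R δ n (k - 1) * brE R δ n (k - 2) =
        brE R δ n (k - 1) * (brS R δ n (k - 2) * brS R δ n (k - 1)) := by
      rw [← mul_assoc, brE_mul_brS_mul_brS ⟨by omega, by omega⟩ ⟨by omega, by omega⟩
        (Or.inr (by omega))]
    have a1 : sAsc R δ n (k - 2 * (l + 1)) k =
        sAsc R δ n (k - 2 * (l + 1)) (k - 2) * (brS R δ n (k - 2) * brS R δ n (k - 1)) := by
      conv_lhs => rw [show k = (k - 2) + 1 + 1 by omega]
      rw [show (k - 2) + 1 + 1 - 2 * (l + 1) = k - 2 * (l + 1) by omega,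
        sAsc_succ (by omega), sAsc_succ (by omega), mul_assoc, show k - 2 + 1 = k - 1 by omega]
    rw [eStairBr_succ (by omega), eStairBr_succ (k := k - 1) (by omega), a1]
    rw [show k - 1 - 1 = k - 2 by omega]
    calc eStairBr R δ n (k - 2) l * brE R δ n (k - 1) *
          (eStairBr R δ n (k - 1 - 2) l * brE R δ n (k - 2))
        = eStairBr R δ n (k - 2) l * eStairBr R δ n (k - 2 - 1) l *
            (brE R δ n (k - 1) * brE R δ n (k - 2)) := by
          rw [mul_assoc, ← mul_assoc (brE R δ n (k - 1)), c1.eq,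
            show k - 1 - 2 = k - 2 - 1 by omega]
          simp only [mul_assoc]
      _ = eStairBr R δ n (k - 2) l * (sAsc R δ n (k - 2 * (l + 1)) (k - 2) * brE R δ n (k - 1)) *
            (brS R δ n (k - 2) * brS R δ n (k - 1)) := by
          rw [ih', t3, show k - 2 - 2 * l = k - 2 * (l + 1) by omega]
          simp only [mul_assoc]
      _ = _ := by
          rw [← c2.eq]
          simp only [mul_assoc]

lemma eStairBr_mul_eStairBr_pred {k l : ℕ} (hl : 2 * (l + 1) ≤ k) (hk : k ≤ n) :
    eStairBr R δ n k (l + 1) * eStairBr R δ n (k - 1) l =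
      eStairBr R δ n k (l + 1) * sAsc R δ n (k - 2 * l) k := by
  rw [eStairBr_succ_left hl, mul_assoc, eStairBr_mul_eStairBr (by omega) hk, mul_assoc]

/-- Absorption of a branching coefficient of node-adding type into the staircase. -/
lemma eStairBr_mul_dBar {k l a : ℕ} (hl : 2 * l + 1 ≤ k) (hk : k ≤ n) (ha : a ≤ k - 2 * l) :
    eStairBr R δ n k l * (sAsc R δ n a (k - 2 * l) * eStairBr R δ n (k - 1) l) =
      eStairBr R δ n k l * sAsc R δ n a k := by
  have c : Commute (sAsc R δ n a (k - 2 * l)) (eStairBr R δ n k l) :=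
    commute_eStairBr fun j h1 h2 =>
      (commute_sAsc fun i h3 h4 => (commute_brS_brE (by omega)).symm).symm
  rw [← mul_assoc, ← c.eq, mul_assoc, eStairBr_mul_eStairBr hl hk, ← mul_assoc, c.eq, mul_assoc,
    sAsc_mul_sAsc ha (by omega)]

/-- Absorption of a branching coefficient of node-removing type into the staircase. -/
lemma eStairBr_mul_uBar {k l a r : ℕ} (hl : 2 * (l + 1) ≤ k) (hk : k ≤ n) (ha : a ≤ k - 2 * l - 1) :
    eStairBr R δ n k (l + 1) * (sDesc R δ n (k - 2 * l - 1) a *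
      ∑ r ∈ Finset.range r, sDesc R δ n a (a - r)) * eStairBr R δ n (k - 1) l =
      eStairBr R δ n k (l + 1) * ∑ r ∈ Finset.range r,
        sDesc R δ n (k - 2 * l - 1) (a - r) * sAsc R δ n (k - 2 * l) k := by
  rw [Finset.mul_sum, Finset.mul_sum, Finset.mul_sum, Finset.sum_mul]
  apply Finset.sum_congr rfl
  intro r _
  rw [sDesc_mul_sDesc (by omega) ha]
  have c1 : Commute (sDesc R δ n (k - 2 * l - 1) (a - r)) (eStairBr R δ n (k - 1) l) :=
    commute_eStairBr fun j h1 h2 =>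
      (commute_sDesc fun i h3 h4 => (commute_brS_brE (by omega)).symm).symm
  have c2 : Commute (sDesc R δ n (k - 2 * l - 1) (a - r)) (sAsc R δ n (k - 2 * l) k) :=
    commute_sAsc fun j h1 h2 =>
      (commute_sDesc fun i h3 h4 => (commute_brS_brS (by omega)).symm).symm
  rw [mul_assoc, c1.eq, ← mul_assoc, eStairBr_mul_eStairBr_pred hl hk, mul_assoc, ← c2.eq]

end Staircase

/-! ### Row lengths of Young diagrams -/

namespace YoungDiagram

lemma le_iff_rowLen_le {l m : YoungDiagram} : l ≤ m ↔ ∀ i, l.rowLen i ≤ m.rowLen i := by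
  constructor
  · intro h i
    by_contra! hlt
    have := h (show (i, m.rowLen i) ∈ l from mem_iff_lt_rowLen.mpr hlt)
    exact lt_irrefl _ (mem_iff_lt_rowLen.mp this)
  · rintro h ⟨i, j⟩ hij
    exact mem_iff_lt_rowLen.mpr ((mem_iff_lt_rowLen.mp hij).trans_le (h i))

lemma ext_rowLen {l m : YoungDiagram} (h : ∀ i, l.rowLen i = m.rowLen i) : l = m :=
  le_antisymm (le_iff_rowLen_le.mpr fun i => (h i).le) (le_iff_rowLen_le.mpr fun i => (h i).ge)

lemma sum_rowLen_le (μ : YoungDiagram) (s : Finset ℕ) : ∑ i ∈ s, μ.rowLen i ≤ μ.card := by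
  have : ∑ i ∈ s, μ.rowLen i = (s.biUnion μ.row).card := by
    rw [Finset.card_biUnion]
    · exact Finset.sum_congr rfl fun i _ => μ.rowLen_eq_card
    · intro i _ j _ hij
      rw [Function.onFun, Finset.disjoint_left]
      intro x hx hx'
      rw [mem_row_iff] at hx hx'
      exact hij (hx.2.symm.trans hx'.2)
  rw [this]
  apply Finset.card_le_card
  intro x hx
  obtain ⟨i, _, hi⟩ := Finset.mem_biUnion.mp hx
  exact (mem_row_iff.mp hi).1

lemma rowLen_eq_zero_of_card_le (μ : YoungDiagram) {i : ℕ} (h : μ.card ≤ i) : μ.rowLen i = 0 := by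
  by_contra hne
  have h1 : ∑ j ∈ Finset.range (i + 1), 1 ≤ ∑ j ∈ Finset.range (i + 1), μ.rowLen j := by
    apply Finset.sum_le_sum
    intro j hj
    have := μ.rowLen_anti j i (by rw [Finset.mem_range] at hj; omega)
    omega
  have := (h1.trans (μ.sum_rowLen_le _))
  simp at this
  omega

lemma card_eq_sum_rowLen (μ : YoungDiagram) {N : ℕ} (h : ∀ i, N ≤ i → μ.rowLen i = 0) :
    μ.card = ∑ i ∈ Finset.range N, μ.rowLen i := by
  apply le_antisymm _ (μ.sum_rowLen_le _)
  have : ∑ i ∈ Finset.range N, μ.rowLen i = ((Finset.range N).biUnion μ.row).card := by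
    rw [Finset.card_biUnion]
    · exact Finset.sum_congr rfl fun i _ => μ.rowLen_eq_card
    · intro i _ j _ hij
      rw [Function.onFun, Finset.disjoint_left]
      intro x hx hx'
      rw [mem_row_iff] at hx hx'
      exact hij (hx.2.symm.trans hx'.2)
  rw [this]
  apply Finset.card_le_card
  intro x hx
  refine Finset.mem_biUnion.mpr ⟨x.1, ?_, mem_row_iff.mpr ⟨hx, rfl⟩⟩
  rw [Finset.mem_range]
  by_contra! hN
  have h0 := h _ hN
  have := mem_iff_lt_rowLen.mp (show (x.1, x.2) ∈ μ from hx)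
  omega

lemma sum_rowLen_of_le (μ : YoungDiagram) {N : ℕ} (h : μ.card ≤ N) :
    ∑ i ∈ Finset.range N, μ.rowLen i = μ.card :=
  (μ.card_eq_sum_rowLen fun _ hi => μ.rowLen_eq_zero_of_card_le (h.trans hi)).symm

lemma exists_rowLen_eq {α : ℕ → ℕ} (ha : ∀ i, α (i + 1) ≤ α i) {N : ℕ} (hN : α N = 0) :
    ∃ μ : YoungDiagram, ∀ i, μ.rowLen i = α i := by
  have anti : Antitone α := antitone_nat_of_succ_le ha
  let μ : YoungDiagram :=
    ⟨((Finset.range N) ×ˢ (Finset.range (α 0))).filter fun x => x.2 < α x.1, by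
      rintro ⟨i, j⟩ ⟨i', j'⟩ h hm
      have h1 : i' ≤ i := h.1
      have h2 : j' ≤ j := h.2
      have h3 := anti h1
      simp only [Finset.coe_filter, Finset.mem_product, Finset.mem_range, Set.mem_ofPred_eq] at hm ⊢
      omega⟩
  refine ⟨μ, fun i => ?_⟩
  have key : ∀ j, j < μ.rowLen i ↔ j < α i := fun j => by
    rw [← mem_iff_lt_rowLen, ← mem_cells]
    show (i, j) ∈ ((Finset.range N) ×ˢ (Finset.range (α 0))).filter (fun x => x.2 < α x.1) ↔ _
    simp only [Finset.mem_filter, Finset.mem_product, Finset.mem_range]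
    refine ⟨fun h => h.2, fun h => ⟨⟨?_, h.trans_le (anti (Nat.zero_le i))⟩, h⟩⟩
    by_contra! hNi
    have := anti hNi
    omega
  exact le_antisymm (by by_contra! h; exact lt_irrefl _ ((key _).mp h))
    (by by_contra! h; exact lt_irrefl _ ((key _).mpr h))

/-- `m` is obtained from `l` by adding a node in row `j`. -/
def AddNode (l m : YoungDiagram) (j : ℕ) : Prop :=
  ∀ i, m.rowLen i = l.rowLen i + if i = j then 1 else 0

lemma AddNode.le {l m : YoungDiagram} {j : ℕ} (h : AddNode l m j) : l ≤ m :=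
  le_iff_rowLen_le.mpr fun i => by rw [h i]; omega

lemma AddNode.card {l m : YoungDiagram} {j : ℕ} (h : AddNode l m j) : m.card = l.card + 1 := by
  obtain ⟨N, hN1, hN2, hN3⟩ : ∃ N, l.card ≤ N ∧ m.card ≤ N ∧ j < N :=
    ⟨l.card + m.card + j + 1, by omega, by omega, by omega⟩
  have h1 := l.sum_rowLen_of_le hN1
  have h2 := m.sum_rowLen_of_le hN2
  rw [← h1, ← h2, Finset.sum_congr rfl fun i _ => h i, Finset.sum_add_distrib,
    Finset.sum_ite_eq', if_pos (Finset.mem_range.mpr hN3)]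

lemma exists_addNode {l m : YoungDiagram} (h : l ≤ m) (hc : m.card = l.card + 1) :
    ∃ j, AddNode l m j := by
  have hle := le_iff_rowLen_le.mp h
  have h1 := l.sum_rowLen_of_le (N := m.card) (by omega)
  have h2 := m.sum_rowLen_of_le (N := m.card) le_rfl
  obtain ⟨j, hj⟩ : ∃ j, l.rowLen j < m.rowLen j := by
    by_contra! hcon
    have := ext_rowLen fun i => le_antisymm (hle i) (hcon i)
    rw [this] at hc; omega
  have hjm : j < m.card := by
    by_contra! hh; have := m.rowLen_eq_zero_of_card_le hh; omega
  have h3 := Finset.add_sum_erase (Finset.range m.card) l.rowLen (Finset.mem_range.mpr hjm)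
  have h4 := Finset.add_sum_erase (Finset.range m.card) m.rowLen (Finset.mem_range.mpr hjm)
  have h5 : ∑ i ∈ (Finset.range m.card).erase j, l.rowLen i ≤
      ∑ i ∈ (Finset.range m.card).erase j, m.rowLen i := Finset.sum_le_sum fun i _ => hle i
  refine ⟨j, fun i => ?_⟩
  by_cases hij : i = j
  · subst hij; rw [if_pos rfl]; omega
  · rw [if_neg hij, add_zero]
    by_cases him : i < m.card
    · by_contra hne
      have : ∑ i ∈ (Finset.range m.card).erase j, l.rowLen i <
          ∑ i ∈ (Finset.range m.card).erase j, m.rowLen i :=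
        Finset.sum_lt_sum (fun i _ => hle i) ⟨i, by simp [hij, him], by have := hle i; omega⟩
      omega
    · rw [m.rowLen_eq_zero_of_card_le (by omega), l.rowLen_eq_zero_of_card_le (by omega)]

lemma AddNode.lt_card {l m : YoungDiagram} {j : ℕ} (h : AddNode l m j) : j < m.card := by
  by_contra! hh
  have h1 := m.rowLen_eq_zero_of_card_le hh
  have h2 := h j
  simp at h2
  omega

lemma AddNode.addedRow_eq {l m : YoungDiagram} {j : ℕ} (h : AddNode l m j) : addedRow l m = j := by
  unfold addedRow
  rw [Finset.sum_eq_single j]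
  · have := h j; simp at this; simp [this]
  · intro i _ hij
    have := h i
    simp [hij] at this
    simp [this]
  · intro hj
    have := h.lt_card
    simp at hj; omega

end YoungDiagram

/-! ### Labelled configurations -/

/-- The state of a point: unused, carrying a row label, or joined to another point by an arc. -/
inductive Slot (n : ℕ) : Type
  | absent : Slot n
  | row (j : ℕ) : Slot n
  | arc (q : Fin n) : Slot n

noncomputable instance (n : ℕ) : DecidableEq (Slot n) := Classical.decEq _

/-- A configuration assigns a state to each point. -/
abbrev Cfg (n : ℕ) : Type := Fin n → Slot n

namespace Cfg

section Basic
variable {n : ℕ}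

/-- The points labelled by the row `j`. -/
def rowSet (c : Cfg n) (j : ℕ) : Finset (Fin n) := Finset.univ.filter fun p => c p = Slot.row j

/-- The number of points labelled by the row `j`. -/
def wt (c : Cfg n) (j : ℕ) : ℕ := (rowSet c j).card

/-- Change the label of the points of `S` to `j`. -/
def relabel (c : Cfg n) (S : Finset (Fin n)) (j : ℕ) : Cfg n :=
  fun p => if p ∈ S then Slot.row j else c p

/-- Join the points `m` and `p` by an arc. -/
def arcAt (c : Cfg n) (m p : Fin n) : Cfg n :=
  Function.update (Function.update c p (Slot.arc m)) m (Slot.arc p)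

/-- The configuration uses exactly the first `k` points, and its arcs form a partial matching. -/
structure IsValid (k : ℕ) (c : Cfg n) : Prop where
  absent_iff : ∀ p, c p = Slot.absent ↔ k ≤ p.val
  arc_symm : ∀ p q, c p = Slot.arc q → c q = Slot.arc p ∧ q ≠ p

lemma mem_rowSet {c : Cfg n} {j : ℕ} {p : Fin n} : p ∈ rowSet c j ↔ c p = Slot.row j := by
  simp [rowSet]

lemma rowSet_update_row {c : Cfg n} {m : Fin n} (hm : c m = Slot.absent) (j i : ℕ) :
    rowSet (Function.update c m (Slot.row j)) i =
      if i = j then insert m (rowSet c i) else rowSet c i := by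
  ext p
  by_cases hp : p = m
  · subst hp
    by_cases hij : i = j
    · simp [mem_rowSet, hij]
    · simp [mem_rowSet, hij, hm, Ne.symm hij]
  · by_cases hij : i = j <;> simp [mem_rowSet, hij, hp]

lemma wt_update_row {c : Cfg n} {m : Fin n} (hm : c m = Slot.absent) (j i : ℕ) :
    wt (Function.update c m (Slot.row j)) i = wt c i + if i = j then 1 else 0 := by
  unfold wt
  rw [rowSet_update_row hm]
  split_ifs with h
  · rw [Finset.card_insert_of_notMem (by simp [mem_rowSet, hm])]
  · rfl

lemma rowSet_arcAt {c : Cfg n} {m p : Fin n} (hm : c m = Slot.absent) (i : ℕ) :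
    rowSet (arcAt c m p) i = (rowSet c i).erase p := by
  ext q
  by_cases hq : q = m
  · subst hq; simp [mem_rowSet, arcAt, hm]
  · by_cases hqp : q = p
    · subst hqp; simp [mem_rowSet, arcAt, hq]
    · simp [mem_rowSet, arcAt, hq, hqp]

lemma wt_arcAt {c : Cfg n} {m p : Fin n} {j : ℕ} (hm : c m = Slot.absent) (hp : c p = Slot.row j)
    (i : ℕ) : wt (arcAt c m p) i + (if i = j then 1 else 0) = wt c i := by
  unfold wt
  rw [rowSet_arcAt hm]
  split_ifs with h
  · subst h
    exact Finset.card_erase_add_one (mem_rowSet.mpr hp)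
  · rw [Finset.erase_eq_of_notMem, add_zero]
    rw [mem_rowSet, hp]
    simpa using Ne.symm h

lemma rowSet_relabel {c : Cfg n} {S : Finset (Fin n)} {j j' : ℕ} (hS : S ⊆ rowSet c j)
    (hj : j ≠ j') (i : ℕ) : rowSet (relabel c S j') i =
      if i = j then rowSet c i \ S else if i = j' then rowSet c i ∪ S else rowSet c i := by
  ext p
  by_cases hp : p ∈ S
  · have hc := mem_rowSet.mp (hS hp)
    by_cases h1 : i = j
    · subst h1; simp [mem_rowSet, relabel, hp, Ne.symm hj]
    · by_cases h2 : i = j'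
      · subst h2; simp [mem_rowSet, relabel, hp, Ne.symm hj]
      · simp [mem_rowSet, relabel, hp, h1, h2, hc, Ne.symm h1, Ne.symm h2]
  · by_cases h1 : i = j
    · simp [mem_rowSet, relabel, hp, h1]
    · by_cases h2 : i = j'
      · subst h2; simp [mem_rowSet, relabel, hp, Ne.symm hj]
      · simp [mem_rowSet, relabel, hp, h1, h2]

lemma wt_relabel {c : Cfg n} {S : Finset (Fin n)} {j j' : ℕ} (hS : S ⊆ rowSet c j)
    (hj : j ≠ j') (i : ℕ) : wt (relabel c S j') i + (if i = j then S.card else 0) =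
      wt c i + if i = j' then S.card else 0 := by
  unfold wt
  rw [rowSet_relabel hS hj]
  by_cases h1 : i = j
  · subst h1
    simp only [hj, if_true, if_false, add_zero]
    exact Finset.card_sdiff_add_card_eq_card hS
  · by_cases h2 : i = j'
    · subst h2
      simp only [h1, if_true, if_false, add_zero]
      rw [Finset.card_union_of_disjoint]
      rw [Finset.disjoint_left]
      intro p hp hp'
      have a1 := mem_rowSet.mp hp
      have a2 := mem_rowSet.mp (hS hp')
      rw [a1] at a2
      exact hj (Slot.row.inj a2).symm
    · simp [h1, h2]

lemma IsValid.update_row {k : ℕ} {c : Cfg n} (hc : IsValid k c) {m : Fin n} (hm : m.val = k)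
    (j : ℕ) : IsValid (k + 1) (Function.update c m (Slot.row j)) := by
  have ha : c m = Slot.absent := (hc.absent_iff m).mpr hm.ge
  refine ⟨fun p => ?_, fun p q h => ?_⟩
  · by_cases hp : p = m
    · subst hp; simp [hm]
    · have : p.val ≠ k := fun h => hp (Fin.ext (h.trans hm.symm))
      rw [Function.update_of_ne hp, hc.absent_iff]; omega
  · by_cases hp : p = m
    · subst hp; simp at h
    · rw [Function.update_of_ne hp] at h
      have := hc.arc_symm p q h
      have hq : q ≠ m := by
        rintro rfl; rw [ha] at this; simp at this
      rwa [Function.update_of_ne hq]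

lemma IsValid.arcAt {k : ℕ} {c : Cfg n} (hc : IsValid k c) {m p : Fin n} (hm : m.val = k)
    {j : ℕ} (hp : c p = Slot.row j) : IsValid (k + 1) (arcAt c m p) := by
  have ha : c m = Slot.absent := (hc.absent_iff m).mpr hm.ge
  have hpm : p ≠ m := by rintro rfl; rw [ha] at hp; simp at hp
  refine ⟨fun q => ?_, fun q r h => ?_⟩
  · by_cases hq : q = m
    · subst hq; simp [Cfg.arcAt, hm]
    · have : q.val ≠ k := fun h => hq (Fin.ext (h.trans hm.symm))
      by_cases hqp : q = p
      · subst hqp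
        have h2 : ¬ k ≤ q.val := by rw [← hc.absent_iff, hp]; simp
        simp [Cfg.arcAt, hq]; omega
      · simp only [Cfg.arcAt, Function.update_of_ne hq, Function.update_of_ne hqp]
        rw [hc.absent_iff]; omega
  · by_cases hq : q = m
    · subst hq
      simp only [Cfg.arcAt, Function.update_self] at h
      rw [Slot.arc.injEq] at h
      subst h
      exact ⟨by simp [Cfg.arcAt, hpm], hpm⟩
    · by_cases hqp : q = p
      · subst hqp
        simp only [Cfg.arcAt, Function.update_of_ne hq, Function.update_self] at h
        rw [Slot.arc.injEq] at h
        subst h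
        exact ⟨by simp [Cfg.arcAt], fun h => hq h.symm⟩
      · simp only [Cfg.arcAt, Function.update_of_ne hq, Function.update_of_ne hqp] at h
        have h2 := hc.arc_symm q r h
        have hr : r ≠ m := by rintro rfl; rw [ha] at h2; simp at h2
        have hrp : r ≠ p := by rintro rfl; rw [hp] at h2; simp at h2
        simp only [Cfg.arcAt, Function.update_of_ne hr, Function.update_of_ne hrp]
        exact h2

lemma IsValid.relabel {k : ℕ} {c : Cfg n} (hc : IsValid k c) {S : Finset (Fin n)} {i : ℕ}
    (hS : S ⊆ rowSet c i) (j : ℕ) : IsValid k (relabel c S j) := by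
  have hS' : ∀ p ∈ S, c p = Slot.row i := fun p hp => mem_rowSet.mp (hS hp)
  refine ⟨fun p => ?_, fun p q h => ?_⟩
  · by_cases hp : p ∈ S
    · have h2 : ¬ k ≤ p.val := by rw [← hc.absent_iff, hS' p hp]; simp
      simp [Cfg.relabel, hp]; omega
    · simp [Cfg.relabel, hp, hc.absent_iff]
  · by_cases hp : p ∈ S
    · simp [Cfg.relabel, hp] at h
    · simp only [Cfg.relabel, hp, if_false] at h ⊢
      have h2 := hc.arc_symm p q h
      have hq : q ∉ S := fun hq => by rw [hS' q hq] at h2; simp at h2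
      simp [hq, h2]

end Basic

section Ops
variable (R : Type) [CommRing R] {n : ℕ}

/-- Label the point `m` by the row `i`. -/
def addOp (i : ℕ) (m : Fin n) : (Cfg n →₀ R) →ₗ[R] (Cfg n →₀ R) :=
  Finsupp.linearCombination R fun c => Finsupp.single (Function.update c m (Slot.row i)) 1

/-- Join `m` to a point of the row `i`, in all possible ways. -/
def remOp (i : ℕ) (m : Fin n) : (Cfg n →₀ R) →ₗ[R] (Cfg n →₀ R) :=
  Finsupp.linearCombination R fun c => ∑ p ∈ rowSet c i, Finsupp.single (arcAt c m p) 1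

/-- Move `p` labels from the row `j` to the row `j + 1`, in all possible ways. -/
def lowerOp (j p : ℕ) : (Cfg n →₀ R) →ₗ[R] (Cfg n →₀ R) :=
  Finsupp.linearCombination R fun c =>
    ∑ S ∈ (rowSet c j).powersetCard p, Finsupp.single (relabel c S (j + 1)) 1

variable {R}

lemma addOp_single (i : ℕ) (m : Fin n) (c : Cfg n) : addOp R i m (Finsupp.single c 1) =
    Finsupp.single (Function.update c m (Slot.row i)) 1 := by
  simp [addOp]

lemma remOp_single (i : ℕ) (m : Fin n) (c : Cfg n) : remOp R i m (Finsupp.single c 1) =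
    ∑ p ∈ rowSet c i, Finsupp.single (arcAt c m p) 1 := by
  simp [remOp]

lemma lowerOp_single (j p : ℕ) (c : Cfg n) : lowerOp R j p (Finsupp.single c 1) =
    ∑ S ∈ (rowSet c j).powersetCard p, Finsupp.single (relabel c S (j + 1)) 1 := by
  simp [lowerOp]

lemma lowerOp_zero (j : ℕ) (c : Cfg n) :
    lowerOp R j 0 (Finsupp.single c 1) = Finsupp.single c 1 := by
  rw [lowerOp_single, Finset.powersetCard_zero, Finset.sum_singleton]
  congr 1

lemma update_relabel {c : Cfg n} {m : Fin n} {S : Finset (Fin n)} (hS : m ∉ S) (i j : ℕ) :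
    relabel (Function.update c m (Slot.row i)) S j =
      Function.update (relabel c S j) m (Slot.row i) := by
  ext p
  by_cases hp : p = m
  · subst hp; simp [relabel, hS]
  · simp [relabel, hp]

lemma lowerOp_addOp_of_ne {i j : ℕ} (hij : i ≠ j) (p : ℕ) {m : Fin n} {c : Cfg n}
    (hm : c m = Slot.absent) : lowerOp R j p (addOp R i m (Finsupp.single c 1)) =
      addOp R i m (lowerOp R j p (Finsupp.single c 1)) := by
  rw [addOp_single, lowerOp_single, lowerOp_single, map_sum, rowSet_update_row hm, if_neg hij.symm]
  apply Finset.sum_congr rfl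
  intro S hS
  have : m ∉ S := fun h => by
    have := mem_rowSet.mp ((Finset.mem_powersetCard.mp hS).1 h)
    rw [hm] at this; simp at this
  rw [addOp_single, update_relabel this]

lemma lowerOp_addOp_self (j p : ℕ) {m : Fin n} {c : Cfg n} (hm : c m = Slot.absent) :
    lowerOp R j (p + 1) (addOp R j m (Finsupp.single c 1)) =
      addOp R j m (lowerOp R j (p + 1) (Finsupp.single c 1)) +
      addOp R (j + 1) m (lowerOp R j p (Finsupp.single c 1)) := by
  have hmJ : m ∉ rowSet c j := by simp [mem_rowSet, hm]
  have hmS : ∀ q, ∀ S ∈ (rowSet c j).powersetCard q, m ∉ S := fun q S hS h =>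
    hmJ ((Finset.mem_powersetCard.mp hS).1 h)
  rw [addOp_single, lowerOp_single, lowerOp_single, lowerOp_single, map_sum, map_sum,
    rowSet_update_row hm, if_pos rfl, Finset.powersetCard_succ_insert hmJ, Finset.sum_union,
    Finset.sum_image]
  · congr 1
    · apply Finset.sum_congr rfl
      intro S hS
      rw [addOp_single, update_relabel (hmS _ S hS)]
    · apply Finset.sum_congr rfl
      intro S hS
      rw [addOp_single]
      congr 1
      ext q
      by_cases hq : q = m
      · subst hq; simp [relabel]
      · simp [relabel, hq]
  · intro S hS T hT h
    rw [← Finset.erase_insert (hmS _ S hS), ← Finset.erase_insert (hmS _ T hT)]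
    exact congrArg (fun U => Finset.erase U m) h
  · rw [Finset.disjoint_left]
    intro S hS hS'
    obtain ⟨T, _, rfl⟩ := Finset.mem_image.mp hS'
    exact hmS _ _ hS (Finset.mem_insert_self _ _)

lemma arcAt_relabel {c : Cfg n} {m x : Fin n} {S : Finset (Fin n)} (hm : m ∉ S) (hx : x ∉ S)
    (j : ℕ) : arcAt (relabel c S j) m x = relabel (arcAt c m x) S j := by
  ext p
  by_cases hp : p = m
  · subst hp; simp [relabel, arcAt, hm]
  · by_cases hpx : p = x
    · subst hpx; simp [relabel, arcAt, hx, hp]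
    · simp [relabel, arcAt, hp, hpx]

lemma notMem_of_absent {c : Cfg n} {m : Fin n} (hm : c m = Slot.absent) {S : Finset (Fin n)} {j : ℕ}
    (hS : S ⊆ rowSet c j) : m ∉ S := fun h => by
  have := mem_rowSet.mp (hS h)
  rw [hm] at this; simp at this

lemma remOp_lowerOp_of_ne {i j : ℕ} (hij : i ≠ j + 1) (p : ℕ) {m : Fin n} {c : Cfg n}
    (hm : c m = Slot.absent) : remOp R i m (lowerOp R j p (Finsupp.single c 1)) =
      lowerOp R j p (remOp R i m (Finsupp.single c 1)) := by
  rw [lowerOp_single, remOp_single, map_sum, map_sum]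
  simp only [remOp_single, lowerOp_single]
  rw [Finset.sum_comm' (s' := fun x => (rowSet (arcAt c m x) j).powersetCard p)
    (t' := rowSet c i)]
  · apply Finset.sum_congr rfl
    intro x hx
    apply Finset.sum_congr rfl
    intro S hS
    rw [Finset.mem_powersetCard, rowSet_arcAt hm] at hS
    rw [arcAt_relabel (notMem_of_absent hm (hS.1.trans (Finset.erase_subset _ _)))
      (fun h => Finset.notMem_erase _ _ (hS.1 h))]
  · intro S x
    rw [rowSet_arcAt hm]
    simp only [Finset.mem_powersetCard, Finset.subset_erase]
    constructor
    · rintro ⟨⟨h1, h2⟩, h3⟩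
      rw [rowSet_relabel h1 (by omega)] at h3
      by_cases h : i = j
      · subst h
        simp only [if_true, Finset.mem_sdiff] at h3
        exact ⟨⟨⟨h1, h3.2⟩, h2⟩, h3.1⟩
      · rw [if_neg h, if_neg hij] at h3
        refine ⟨⟨⟨h1, fun hxS => ?_⟩, h2⟩, h3⟩
        have := mem_rowSet.mp (h1 hxS)
        rw [mem_rowSet.mp h3] at this
        exact h (Slot.row.inj this)
    · rintro ⟨⟨⟨h1, h4⟩, h2⟩, h3⟩
      refine ⟨⟨h1, h2⟩, ?_⟩
      rw [rowSet_relabel h1 (by omega)]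
      split_ifs with h
      · exact Finset.mem_sdiff.mpr ⟨h3, h4⟩
      · exact h3

lemma remOp_lowerOp_succ (j p : ℕ) {m : Fin n} {c : Cfg n}
    (hm : c m = Slot.absent) :
    remOp R (j + 1) m (lowerOp R j (p + 1) (Finsupp.single c 1)) =
      lowerOp R j (p + 1) (remOp R (j + 1) m (Finsupp.single c 1)) +
      lowerOp R j p (remOp R j m (Finsupp.single c 1)) := by
  rw [lowerOp_single, remOp_single, remOp_single, map_sum, map_sum, map_sum]
  simp only [remOp_single, lowerOp_single]
  have hd : ∀ S, S ⊆ rowSet c j → Disjoint (rowSet c (j + 1)) S := by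
    intro S hS
    rw [Finset.disjoint_left]
    intro q hq hq'
    have a1 := mem_rowSet.mp hq
    rw [mem_rowSet.mp (hS hq')] at a1
    have := Slot.row.inj a1
    omega
  have split : ∑ S ∈ (rowSet c j).powersetCard (p + 1), ∑ x ∈ rowSet (relabel c S (j + 1)) (j + 1),
      Finsupp.single (arcAt (relabel c S (j + 1)) m x) (1 : R) =
      ∑ S ∈ (rowSet c j).powersetCard (p + 1), ∑ x ∈ rowSet c (j + 1),
        Finsupp.single (arcAt (relabel c S (j + 1)) m x) (1 : R) +
      ∑ S ∈ (rowSet c j).powersetCard (p + 1), ∑ x ∈ S,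
        Finsupp.single (arcAt (relabel c S (j + 1)) m x) (1 : R) := by
    rw [← Finset.sum_add_distrib]
    apply Finset.sum_congr rfl
    intro S hS
    have hS1 := (Finset.mem_powersetCard.mp hS).1
    rw [rowSet_relabel hS1 (by omega), if_neg (by omega), if_pos rfl, Finset.sum_union (hd S hS1)]
  rw [split]
  congr 1
  · rw [Finset.sum_comm]
    apply Finset.sum_congr rfl
    intro x hx
    rw [rowSet_arcAt hm, Finset.erase_eq_of_notMem]
    · apply Finset.sum_congr rfl
      intro S hS
      have hS1 := (Finset.mem_powersetCard.mp hS).1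
      rw [arcAt_relabel (notMem_of_absent hm hS1)
        (fun h => Finset.disjoint_left.mp (hd S hS1) hx h)]
    · intro h
      exact Finset.disjoint_left.mp (hd _ subset_rfl) hx h
  · rw [Finset.sum_sigma', Finset.sum_sigma']
    refine Finset.sum_bij' (fun a _ => ⟨a.2, a.1.erase a.2⟩) (fun b _ => ⟨insert b.1 b.2, b.1⟩)
      ?_ ?_ ?_ ?_ ?_
    · rintro ⟨S, x⟩ h
      simp only [Finset.mem_sigma, Finset.mem_powersetCard] at h ⊢
      rw [rowSet_arcAt hm]
      exact ⟨h.1.1 h.2, Finset.erase_subset_erase _ h.1.1, by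
        rw [Finset.card_erase_of_mem h.2]; omega⟩
    · rintro ⟨x, S⟩ h
      simp only [Finset.mem_sigma, Finset.mem_powersetCard] at h ⊢
      rw [rowSet_arcAt hm, Finset.subset_erase] at h
      refine ⟨⟨Finset.insert_subset h.1 h.2.1.1, ?_⟩, Finset.mem_insert_self _ _⟩
      rw [Finset.card_insert_of_notMem h.2.1.2, h.2.2]
    · rintro ⟨S, x⟩ h
      simp only [Finset.mem_sigma] at h
      simp [Finset.insert_erase h.2]
    · rintro ⟨x, S⟩ h
      simp only [Finset.mem_sigma, Finset.mem_powersetCard] at h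
      rw [rowSet_arcAt hm, Finset.subset_erase] at h
      simp [Finset.erase_insert h.2.1.2]
    · rintro ⟨S, x⟩ h
      simp only [Finset.mem_sigma, Finset.mem_powersetCard] at h
      congr 1
      have hmS := notMem_of_absent hm h.1.1
      have hmx : x ≠ m := fun hh => hmS (hh ▸ h.2)
      rw [← arcAt_relabel (fun hh => hmS (Finset.mem_of_mem_erase hh)) (Finset.notMem_erase _ _)]
      ext q
      by_cases hq : q = m
      · subst hq; simp [arcAt]
      · by_cases hqx : q = x
        · subst hqx; simp [arcAt, hq]
        · simp [arcAt, relabel, hq, hqx]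

end Ops

end Cfg

namespace Cfg

section Straighten
variable (R : Type) [CommRing R] {n : ℕ}

/-- The span of the images of the operators `lowerOp` in weight `α`. -/
def lowSpan (k : ℕ) (α : ℕ → ℕ) : Submodule R (Cfg n →₀ R) :=
  Submodule.span R {v | ∃ (j p : ℕ) (c : Cfg n), IsValid k c ∧
    (∀ i, wt c i + (if i = j + 1 then p + 1 else 0) = α i + if i = j then p + 1 else 0) ∧
    v = lowerOp R j (p + 1) (Finsupp.single c 1)}

variable {R}

lemma lowerOp_relabel {c : Cfg n} {j : ℕ} {Y : Finset (Fin n)} (hY : Y ⊆ rowSet c (j + 1)) :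
    lowerOp R j Y.card (Finsupp.single (relabel c Y j) 1) =
      ∑ T ∈ (rowSet c j ∪ Y).powersetCard (rowSet c j).card,
        Finsupp.single (relabel (relabel c (rowSet c j ∪ rowSet c (j + 1)) (j + 1)) T j) 1 := by
  have hd : Disjoint (rowSet c j) Y := by
    rw [Finset.disjoint_left]
    intro q hq hq'
    have a1 := mem_rowSet.mp hq
    rw [mem_rowSet.mp (hY hq')] at a1
    have := Slot.row.inj a1
    omega
  rw [lowerOp_single, rowSet_relabel hY (by omega), if_neg (by omega), if_pos rfl]
  have hcard : (rowSet c j ∪ Y).card = (rowSet c j).card + Y.card :=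
    Finset.card_union_of_disjoint hd
  refine Finset.sum_bij' (fun S _ => (rowSet c j ∪ Y) \ S) (fun T _ => (rowSet c j ∪ Y) \ T)
    ?_ ?_ ?_ ?_ ?_
  · intro S hS
    rw [Finset.mem_powersetCard] at hS ⊢
    exact ⟨Finset.sdiff_subset, by rw [Finset.card_sdiff_of_subset hS.1]; omega⟩
  · intro S hS
    rw [Finset.mem_powersetCard] at hS ⊢
    exact ⟨Finset.sdiff_subset, by rw [Finset.card_sdiff_of_subset hS.1]; omega⟩
  · intro S hS
    exact Finset.sdiff_sdiff_eq_self (Finset.mem_powersetCard.mp hS).1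
  · intro S hS
    exact Finset.sdiff_sdiff_eq_self (Finset.mem_powersetCard.mp hS).1
  · intro S hS
    have hS1 := (Finset.mem_powersetCard.mp hS).1
    congr 1
    ext q
    by_cases hqS : q ∈ S
    · have := hS1 hqS
      have h2 : q ∈ rowSet c j ∪ rowSet c (j + 1) := Finset.union_subset_union_right hY this
      simp [relabel, hqS, Finset.mem_union.mp h2]
    · by_cases hqY : q ∈ rowSet c j ∪ Y
      · simp only [relabel, hqS, if_false, Finset.mem_sdiff, hqY, not_false_eq_true, and_self,
          if_true]
        rcases Finset.mem_union.mp hqY with h | h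
        · rw [mem_rowSet.mp h]; simp
        · simp [h]
      · have hqY' := hqY
        rw [Finset.mem_union, not_or] at hqY'
        simp only [relabel, hqS, if_false, Finset.mem_sdiff, hqY, false_and, hqY'.2]
        split_ifs with h
        · rcases Finset.mem_union.mp h with h | h
          · exact absurd h hqY'.1
          · exact mem_rowSet.mp h
        · rfl

lemma sum_neg_one_pow_powerset_filter {α : Type*} [DecidableEq α] (B : Finset α)
    (P : Finset α → Prop) [DecidablePred P] {b : α} (hb : b ∈ B)
    (hP : ∀ Y, b ∉ Y → (P (insert b Y) ↔ P Y)) :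
    ∑ Y ∈ B.powerset with P Y, (-1 : R) ^ Y.card = 0 := by
  refine Finset.sum_involution (fun Y _ => if b ∈ Y then Y.erase b else insert b Y) ?_ ?_ ?_ ?_
  · intro Y _
    by_cases h : b ∈ Y
    · rw [if_pos h, ← Finset.card_erase_add_one h, pow_succ]; ring
    · rw [if_neg h, Finset.card_insert_of_notMem h, pow_succ]; ring
  · intro Y _ _ h
    by_cases hb : b ∈ Y
    · rw [if_pos hb] at h; exact Finset.notMem_erase b Y (h.symm ▸ hb)
    · rw [if_neg hb] at h; exact hb (h ▸ Finset.mem_insert_self b Y)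
  · intro Y hY
    rw [Finset.mem_filter, Finset.mem_powerset] at hY ⊢
    by_cases h : b ∈ Y
    · rw [if_pos h]
      refine ⟨(Finset.erase_subset _ _).trans hY.1, ?_⟩
      rw [← hP _ (Finset.notMem_erase b Y), Finset.insert_erase h]
      exact hY.2
    · rw [if_neg h]
      exact ⟨Finset.insert_subset hb hY.1, (hP Y h).mpr hY.2⟩
  · intro Y _
    by_cases h : b ∈ Y
    · simp [h, Finset.insert_erase]
    · simp [h]

/-- Configurations of non-dominant weight are combinations of images of lowering operators. -/
lemma single_mem_lowSpan {k : ℕ} {c : Cfg n} (hc : IsValid k c) {j : ℕ}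
    (hj : wt c j < wt c (j + 1)) : Finsupp.single c 1 ∈ lowSpan R k (wt c) := by
  set A := rowSet c j with hA
  set B := rowSet c (j + 1) with hB
  set cT : Finset (Fin n) → Cfg n := fun T => relabel (relabel c (A ∪ B) (j + 1)) T j with hcT
  have hzero : ∑ Y ∈ B.powerset,
      (-1 : R) ^ Y.card • lowerOp R j Y.card (Finsupp.single (relabel c Y j) 1) = 0 := by
    have e1 : ∀ Y ∈ B.powerset,
        (-1 : R) ^ Y.card • lowerOp R j Y.card (Finsupp.single (relabel c Y j) 1) =
        ∑ T ∈ (A ∪ Y).powersetCard A.card, (-1 : R) ^ Y.card • Finsupp.single (cT T) 1 := by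
      intro Y hY
      rw [lowerOp_relabel (Finset.mem_powerset.mp hY), Finset.smul_sum]
    rw [Finset.sum_congr rfl e1, Finset.sum_comm' (t' := (A ∪ B).powersetCard A.card)
      (s' := fun T => B.powerset.filter fun Y => T ⊆ A ∪ Y)]
    · apply Finset.sum_eq_zero
      intro T hT
      rw [Finset.mem_powersetCard] at hT
      rw [← Finset.sum_smul]
      obtain ⟨b, hb, hbT⟩ : ∃ b ∈ B, b ∉ T := by
        by_contra! h
        have := Finset.card_le_card (show B ⊆ T from h)
        rw [hT.2] at this
        exact absurd hj (not_lt.mpr this)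
      rw [sum_neg_one_pow_powerset_filter B _ hb, zero_smul]
      intro Y hbY
      constructor
      · intro h x hx
        have := h hx
        rw [Finset.mem_union, Finset.mem_insert] at this
        rcases this with h | rfl | h
        · exact Finset.mem_union_left _ h
        · exact absurd hx hbT
        · exact Finset.mem_union_right _ h
      · intro h
        exact h.trans (Finset.union_subset_union_right (Finset.subset_insert _ _))
    · intro Y T
      simp only [Finset.mem_powerset, Finset.mem_powersetCard, Finset.mem_filter]
      constructor
      · rintro ⟨h1, h2, h3⟩
        exact ⟨⟨h1, h2⟩, h2.trans (Finset.union_subset_union_right h1), h3⟩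
      · rintro ⟨⟨h1, h2⟩, _, h3⟩
        exact ⟨h1, h2, h3⟩
  rw [← Finset.add_sum_erase _ _ (Finset.empty_mem_powerset B)] at hzero
  have e0 : relabel c ∅ j = c := by ext q; simp [relabel]
  rw [Finset.card_empty, lowerOp_zero, e0, pow_zero, one_smul] at hzero
  rw [eq_neg_of_add_eq_zero_left hzero]
  apply Submodule.neg_mem
  apply Submodule.sum_mem
  intro Y hY
  rw [Finset.mem_erase, Finset.mem_powerset] at hY
  apply Submodule.smul_mem
  obtain ⟨p, hp⟩ : ∃ p, Y.card = p + 1 :=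
    Nat.exists_eq_succ_of_ne_zero (by
      rw [Finset.card_ne_zero]; exact Finset.nonempty_iff_ne_empty.mpr hY.1)
  apply Submodule.subset_span
  refine ⟨j, p, relabel c Y j, hc.relabel hY.2 j, fun i => ?_, by rw [hp]⟩
  rw [← hp]
  exact wt_relabel hY.2 (by omega) i

/-- The operator attached to an edge of the branching diagram. -/
def stepOp (a b : YoungDiagram × ℕ) (m : Fin n) : (Cfg n →₀ R) →ₗ[R] (Cfg n →₀ R) :=
  if b.2 = a.2 then addOp R (addedRow a.1 b.1) m else remOp R (addedRow b.1 a.1) m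

variable (R) in
/-- The vector attached to the first `k` steps of a path. -/
def vPath (n : ℕ) (pp : ℕ → YoungDiagram × ℕ) : ℕ → (Cfg n →₀ R)
  | 0 => Finsupp.single (fun _ => Slot.absent) 1
  | k + 1 => if h : k < n then stepOp (pp k) (pp (k + 1)) ⟨k, h⟩ (vPath n pp k) else 0

/-- A path of length `k` in the branching diagram. -/
def IsChain (pp : ℕ → YoungDiagram × ℕ) (k : ℕ) : Prop :=
  pp 0 = (⊥, 0) ∧ ∀ i < k, WEdge (pp i) (pp (i + 1))

lemma vPath_congr {pp qq : ℕ → YoungDiagram × ℕ} {k : ℕ} (h : ∀ i ≤ k, pp i = qq i) :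
    vPath R n pp k = vPath R n qq k := by
  induction k with
  | zero => rfl
  | succ k ih =>
    rw [vPath, vPath, ih fun i hi => h i (by omega), h k (by omega), h (k + 1) le_rfl]

variable (R) in
/-- The span of the path vectors of weight `α`. -/
def pathSpan (n k : ℕ) (α : ℕ → ℕ) : Submodule R (Cfg n →₀ R) :=
  Submodule.span R {v | ∃ pp : ℕ → YoungDiagram × ℕ, IsChain pp k ∧
    (∀ i, (pp k).1.rowLen i = α i) ∧ v = vPath R n pp k}

lemma stepOp_vPath_mem {k : ℕ} (hk : k < n) {pp : ℕ → YoungDiagram × ℕ} (hpp : IsChain pp k)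
    {b : YoungDiagram × ℕ} (hb : WEdge (pp k) b) {α : ℕ → ℕ} (hα : ∀ i, b.1.rowLen i = α i) :
    stepOp (pp k) b ⟨k, hk⟩ (vPath R n pp k) ∈ pathSpan R n (k + 1) α := by
  apply Submodule.subset_span
  have hu : ∀ i ≤ k, Function.update pp (k + 1) b i = pp i := fun i hi =>
    Function.update_of_ne (by omega) _ _
  have hu' : Function.update pp (k + 1) b (k + 1) = b := Function.update_self _ _ _
  refine ⟨Function.update pp (k + 1) b, ⟨?_, fun i hi => ?_⟩, ?_, ?_⟩
  · rw [hu 0 (by omega)]; exact hpp.1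
  · by_cases hik : i = k
    · subst hik; rw [hu i le_rfl, hu']; exact hb
    · rw [hu i (by omega), hu (i + 1) (by omega)]; exact hpp.2 i (by omega)
  · rw [hu']; exact hα
  · rw [vPath, dif_pos hk, hu k le_rfl, hu', vPath_congr hu]

lemma remOp_pathSpan {k : ℕ} (hk : k < n) {α β : ℕ → ℕ} {j : ℕ}
    (hαβ : ∀ i, β i = α i + if i = j then 1 else 0) {μ : YoungDiagram}
    (hμ : ∀ i, μ.rowLen i = α i) {v : Cfg n →₀ R} (hv : v ∈ pathSpan R n k β) :
    remOp R j ⟨k, hk⟩ v ∈ pathSpan R n (k + 1) α := by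
  induction hv using Submodule.span_induction with
  | zero => simp
  | add x y _ _ hx hy => rw [map_add]; exact Submodule.add_mem _ hx hy
  | smul a x _ hx => rw [map_smul]; exact Submodule.smul_mem _ _ hx
  | mem x hx =>
    obtain ⟨pp, hpp, hw, rfl⟩ := hx
    have hnode : YoungDiagram.AddNode μ (pp k).1 j := fun i => by rw [hw, hαβ, hμ]
    have := stepOp_vPath_mem (R := R) hk hpp (b := (μ, (pp k).2 + 1))
      (Or.inr ⟨rfl, hnode.le, hnode.card⟩) hμ
    simpa [stepOp, hnode.addedRow_eq] using this

lemma addOp_pathSpan {k : ℕ} (hk : k < n) {α β : ℕ → ℕ} {j : ℕ}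
    (hαβ : ∀ i, α i = β i + if i = j then 1 else 0) {μ : YoungDiagram}
    (hμ : ∀ i, μ.rowLen i = α i) {v : Cfg n →₀ R} (hv : v ∈ pathSpan R n k β) :
    addOp R j ⟨k, hk⟩ v ∈ pathSpan R n (k + 1) α := by
  induction hv using Submodule.span_induction with
  | zero => simp
  | add x y _ _ hx hy => rw [map_add]; exact Submodule.add_mem _ hx hy
  | smul a x _ hx => rw [map_smul]; exact Submodule.smul_mem _ _ hx
  | mem x hx =>
    obtain ⟨pp, hpp, hw, rfl⟩ := hx
    have hnode : YoungDiagram.AddNode (pp k).1 μ j := fun i => by rw [hw, ← hαβ, hμ]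
    have := stepOp_vPath_mem (R := R) hk hpp (b := (μ, (pp k).2))
      (Or.inl ⟨rfl, hnode.le, hnode.card⟩) hμ
    simpa [stepOp, hnode.addedRow_eq] using this

lemma lowerOp_mem_lowSpan {k : ℕ} {c : Cfg n} (hc : IsValid k c) {j p : ℕ} {α : ℕ → ℕ}
    (h : ∀ i, wt c i + (if i = j + 1 then p + 1 else 0) = α i + if i = j then p + 1 else 0) :
    lowerOp R j (p + 1) (Finsupp.single c 1) ∈ lowSpan R k α :=
  Submodule.subset_span ⟨j, p, c, hc, h, rfl⟩

lemma remOp_single_mem {k : ℕ} (hk : k < n) {μ : YoungDiagram} {α : ℕ → ℕ}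
    (hμ : ∀ i, μ.rowLen i = α i)
    (ih : ∀ c : Cfg n, IsValid k c → Finsupp.single c (1 : R) ∈
      pathSpan R n k (wt c) ⊔ lowSpan R k (wt c)) (j : ℕ) :
    ∀ c : Cfg n, IsValid k c → (∀ i, wt c i = α i + if i = j then 1 else 0) →
      remOp R j ⟨k, hk⟩ (Finsupp.single c 1) ∈ pathSpan R n (k + 1) α ⊔ lowSpan R (k + 1) α := by
  induction j using Nat.strong_induction_on with
  | _ j ihj =>
  intro c hc hw
  obtain ⟨x, hx, y, hy, hxy⟩ := Submodule.mem_sup.mp (ih c hc)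
  rw [← hxy, map_add]
  apply Submodule.add_mem
  · exact Submodule.mem_sup_left (remOp_pathSpan hk hw hμ hx)
  · clear hxy hx
    induction hy using Submodule.span_induction with
    | zero => simp
    | add x y _ _ hx hy => rw [map_add]; exact Submodule.add_mem _ hx hy
    | smul a x _ hx => rw [map_smul]; exact Submodule.smul_mem _ _ hx
    | mem v hv =>
      obtain ⟨i, p, c', hc', hw', rfl⟩ := hv
      have ha : c' ⟨k, hk⟩ = Slot.absent := (hc'.absent_iff _).mpr le_rfl
      -- the part where the operators commute
      have main : lowerOp R i (p + 1) (remOp R j ⟨k, hk⟩ (Finsupp.single c' 1)) ∈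
          lowSpan R (k + 1) α := by
        rw [remOp_single, map_sum]
        apply Submodule.sum_mem
        intro q hq
        have hq' := mem_rowSet.mp hq
        apply lowerOp_mem_lowSpan (hc'.arcAt rfl hq')
        intro r
        have h1 := wt_arcAt ha hq' r
        have h2 := hw' r
        rw [hw] at h2
        omega
      by_cases hij : j = i + 1
      · subst hij
        rw [remOp_lowerOp_succ i p ha]
        apply Submodule.add_mem _ (Submodule.mem_sup_right main)
        cases p with
        | zero =>
          have : lowerOp R i 0 (remOp R i ⟨k, hk⟩ (Finsupp.single c' 1)) =
              remOp R i ⟨k, hk⟩ (Finsupp.single c' 1) := by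
            rw [remOp_single, map_sum]
            exact Finset.sum_congr rfl fun q _ => lowerOp_zero _ _
          rw [this]
          apply ihj i (by omega) c' hc'
          intro r
          have h2 := hw' r
          rw [hw] at h2
          split_ifs at h2 ⊢ <;> omega
        | succ p =>
          apply Submodule.mem_sup_right
          rw [remOp_single, map_sum]
          apply Submodule.sum_mem
          intro q hq
          have hq' := mem_rowSet.mp hq
          apply lowerOp_mem_lowSpan (hc'.arcAt rfl hq')
          intro r
          have h1 := wt_arcAt ha hq' r
          have h2 := hw' r
          rw [hw] at h2
          split_ifs at h1 h2 ⊢ <;> omega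
      · rw [remOp_lowerOp_of_ne hij _ ha]
        exact Submodule.mem_sup_right main

lemma addOp_single_mem {k : ℕ} (hk : k < n) {μ : YoungDiagram} {α : ℕ → ℕ}
    (hμ : ∀ i, μ.rowLen i = α i)
    (ih : ∀ c : Cfg n, IsValid k c → Finsupp.single c (1 : R) ∈
      pathSpan R n k (wt c) ⊔ lowSpan R k (wt c)) (d : ℕ) :
    ∀ (j : ℕ) (c : Cfg n), μ.card ≤ j + d → IsValid k c →
      (∀ i, α i = wt c i + if i = j then 1 else 0) →
      addOp R j ⟨k, hk⟩ (Finsupp.single c 1) ∈ pathSpan R n (k + 1) α ⊔ lowSpan R (k + 1) α := by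
  induction d with
  | zero =>
    intro j c hj hc hw
    have h1 := μ.rowLen_eq_zero_of_card_le (i := j) (by omega)
    have h2 := hw j
    rw [← hμ, h1, if_pos rfl] at h2
    omega
  | succ d ihd =>
  intro j c hj hc hw
  obtain ⟨x, hx, y, hy, hxy⟩ := Submodule.mem_sup.mp (ih c hc)
  rw [← hxy, map_add]
  apply Submodule.add_mem
  · exact Submodule.mem_sup_left (addOp_pathSpan hk hw hμ hx)
  · clear hxy hx
    induction hy using Submodule.span_induction with
    | zero => simp
    | add x y _ _ hx hy => rw [map_add]; exact Submodule.add_mem _ hx hy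
    | smul a x _ hx => rw [map_smul]; exact Submodule.smul_mem _ _ hx
    | mem v hv =>
      obtain ⟨i, p, c', hc', hw', rfl⟩ := hv
      have ha : c' ⟨k, hk⟩ = Slot.absent := (hc'.absent_iff _).mpr le_rfl
      have main : lowerOp R i (p + 1) (addOp R j ⟨k, hk⟩ (Finsupp.single c' 1)) ∈
          lowSpan R (k + 1) α := by
        rw [addOp_single]
        apply lowerOp_mem_lowSpan (hc'.update_row rfl j)
        intro r
        have h1 := wt_update_row ha j r
        have h2 := hw' r
        have h3 := hw r
        omega
      by_cases hij : j = i
      · subst hij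
        rw [eq_sub_of_add_eq (G := Cfg n →₀ R) (lowerOp_addOp_self (R := R) j p ha).symm]
        apply Submodule.sub_mem _ (Submodule.mem_sup_right main)
        rw [lowerOp_single, map_sum]
        apply Submodule.sum_mem
        intro S hS
        rw [Finset.mem_powersetCard] at hS
        apply ihd (j + 1) _ (by omega) (hc'.relabel hS.1 _)
        intro r
        have h1 := wt_relabel hS.1 (show j ≠ j + 1 by omega) r
        have h2 := hw' r
        have h3 := hw r
        rw [hS.2] at h1
        split_ifs at h1 h2 h3 ⊢ <;> omega
      · rw [← lowerOp_addOp_of_ne hij _ ha]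
        exact Submodule.mem_sup_right main

/-- Every valid configuration is a combination of path vectors and images of lowering operators. -/
theorem single_mem_sup (k : ℕ) (hk : k ≤ n) (c : Cfg n) (hc : IsValid k c) :
    Finsupp.single c (1 : R) ∈ pathSpan R n k (wt c) ⊔ lowSpan R k (wt c) := by
  induction k generalizing c with
  | zero =>
    have h0 : c = fun _ => Slot.absent := funext fun p => (hc.absent_iff p).mpr (Nat.zero_le _)
    apply Submodule.mem_sup_left
    apply Submodule.subset_span
    refine ⟨fun _ => (⊥, 0), ⟨rfl, fun i hi => by omega⟩, fun i => ?_, by rw [vPath, h0]⟩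
    have : wt c i = 0 := by
      rw [wt, Finset.card_eq_zero, Finset.eq_empty_iff_forall_notMem]
      intro p hp
      rw [mem_rowSet, h0] at hp
      simp at hp
    rw [this]
    exact YoungDiagram.rowLen_eq_zero_of_card_le _ (by simp [YoungDiagram.card])
  | succ k ih =>
    have hkn : k < n := by omega
    by_cases hdom : ∀ j, wt c (j + 1) ≤ wt c j
    swap
    · push Not at hdom
      obtain ⟨j, hj⟩ := hdom
      exact Submodule.mem_sup_right (single_mem_lowSpan hc hj)
    obtain ⟨N, hN⟩ : ∃ N, ∀ j, N ≤ j → wt c j = 0 := by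
      have : ∀ p : Fin n, ∃ N, ∀ j, N ≤ j → c p ≠ Slot.row j := by
        intro p
        cases hcp : c p with
        | absent => exact ⟨0, fun j _ => by simp⟩
        | arc q => exact ⟨0, fun j _ => by simp⟩
        | row i => exact ⟨i + 1, fun j hj h => by have := Slot.row.inj h; omega⟩
      choose f hf using this
      refine ⟨Finset.univ.sup f, fun j hj => ?_⟩
      rw [wt, Finset.card_eq_zero, Finset.eq_empty_iff_forall_notMem]
      intro p hp
      exact hf p j ((Finset.le_sup (Finset.mem_univ p)).trans hj) (mem_rowSet.mp hp)
    obtain ⟨μ, hμ⟩ := YoungDiagram.exists_rowLen_eq hdom (hN N le_rfl)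
    set m : Fin n := ⟨k, hkn⟩ with hm
    have ih' := fun c hc => ih (by omega) c hc
    cases hcm : c m with
    | absent =>
      have := (hc.absent_iff m).mp hcm
      simp [hm] at this
    | row j =>
      set c0 := Function.update c m Slot.absent with hc0
      have hv : IsValid k c0 := by
        refine ⟨fun p => ?_, fun p q h => ?_⟩
        · by_cases hp : p = m
          · subst hp; simp [hc0]; simp [hm]
          · have : p.val ≠ k := fun h => hp (Fin.ext h)
            rw [hc0, Function.update_of_ne hp, hc.absent_iff]; omega
        · have hp : p ≠ m := by rintro rfl; simp [hc0] at h
          rw [hc0, Function.update_of_ne hp] at h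
          have h2 := hc.arc_symm p q h
          have hq : q ≠ m := by rintro rfl; rw [hcm] at h2; simp at h2
          rw [hc0, Function.update_of_ne hq]
          exact h2
      have he : Function.update c0 m (Slot.row j) = c := by
        rw [hc0, Function.update_idem, ← hcm, Function.update_eq_self]
      have h0m : c0 m = Slot.absent := by simp [hc0]
      have := addOp_single_mem (R := R) hkn hμ ih' μ.card j c0 (by omega) hv (fun i => by
        rw [← wt_update_row h0m, he])
      rwa [addOp_single, he] at this
    | arc q =>
      obtain ⟨hq1, hq2⟩ := hc.arc_symm m q hcm
      set c0 := Function.update (Function.update c q (Slot.row N)) m Slot.absent with hc0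
      have h0m : c0 m = Slot.absent := by simp [hc0]
      have h0q : c0 q = Slot.row N := by simp [hc0, hq2]
      have h0 : ∀ p, p ≠ m → p ≠ q → c0 p = c p := fun p h1 h2 => by simp [hc0, h1, h2]
      have hqk : q.val < k := by
        have h1 : ¬ k + 1 ≤ q.val := by rw [← hc.absent_iff, hq1]; simp
        have h2 : q.val ≠ k := fun h => hq2 (Fin.ext h)
        omega
      have hv : IsValid k c0 := by
        refine ⟨fun p => ?_, fun p r h => ?_⟩
        · by_cases hp : p = m
          · subst hp; simp [h0m]; simp [hm]
          · by_cases hpq : p = q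
            · subst hpq; simp [h0q, hqk]
            · have : p.val ≠ k := fun h => hp (Fin.ext h)
              rw [h0 p hp hpq, hc.absent_iff]; omega
        · have hp : p ≠ m := by rintro rfl; simp [h0m] at h
          have hpq : p ≠ q := by rintro rfl; simp [h0q] at h
          rw [h0 p hp hpq] at h
          have h2 := hc.arc_symm p r h
          have hr : r ≠ m := by
            rintro rfl; rw [hcm] at h2; exact hpq (Slot.arc.inj h2.1).symm
          have hrq : r ≠ q := by
            rintro rfl; rw [hq1] at h2; exact hp (Slot.arc.inj h2.1).symm
          rw [h0 r hr hrq]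
          exact h2
      have he : arcAt c0 m q = c := by
        ext p
        by_cases hp : p = m
        · subst hp; simp [arcAt, hcm]
        · by_cases hpq : p = q
          · subst hpq; simp [arcAt, hp, hq1]
          · simp [arcAt, hp, hpq, h0]
      have hrow : rowSet c0 N = {q} := by
        ext p
        rw [mem_rowSet, Finset.mem_singleton]
        constructor
        · intro hp
          by_contra hpq
          have hpm : p ≠ m := by rintro rfl; simp [h0m] at hp
          rw [h0 p hpm hpq] at hp
          have := hN N le_rfl
          rw [wt, Finset.card_eq_zero] at this
          exact Finset.notMem_empty p (this ▸ mem_rowSet.mpr hp)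
        · rintro rfl; exact h0q
      have := remOp_single_mem (R := R) hkn hμ ih' N c0 hv (fun i => by
        rw [← wt_arcAt h0m h0q i, he])
      rwa [remOp_single, hrow, Finset.sum_singleton, he] at this

end Straighten

end Cfg

/-- Transport a slot along a permutation of the points. -/
def Slot.map {n : ℕ} (g : Equiv.Perm (Fin n)) : Slot n → Slot n
  | absent => absent
  | row j => row j
  | arc q => arc (g q)

namespace Cfg

section Action
variable {n : ℕ}

/-- The right action of permutations on configurations. -/
def act (c : Cfg n) (g : Equiv.Perm (Fin n)) : Cfg n := fun p => (c (g p)).map g⁻¹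

lemma act_of_row {c : Cfg n} {g : Equiv.Perm (Fin n)} {p : Fin n} {j : ℕ}
    (h : c (g p) = Slot.row j) : act c g p = Slot.row j := by
  rw [act, h, Slot.map]

lemma act_of_absent {c : Cfg n} {g : Equiv.Perm (Fin n)} {p : Fin n}
    (h : c (g p) = Slot.absent) : act c g p = Slot.absent := by
  rw [act, h, Slot.map]

lemma act_of_arc {c : Cfg n} {g : Equiv.Perm (Fin n)} {p q : Fin n}
    (h : c (g p) = Slot.arc (g q)) : act c g p = Slot.arc q := by
  rw [act, h, Slot.map]
  simp

lemma act_one (c : Cfg n) : act c 1 = c := by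
  ext p
  rw [act, Equiv.Perm.one_apply, inv_one]
  cases c p <;> rfl

lemma act_mul (c : Cfg n) (g h : Equiv.Perm (Fin n)) : act c (g * h) = act (act c g) h := by
  ext p
  simp only [act, Equiv.Perm.mul_apply, mul_inv_rev]
  cases c (g (h p)) <;> rfl

lemma act_eq_row_iff {c : Cfg n} {g : Equiv.Perm (Fin n)} {p : Fin n} {j : ℕ} :
    act c g p = Slot.row j ↔ c (g p) = Slot.row j := by
  rw [act]
  cases c (g p) <;> simp [Slot.map]

lemma act_eq_arc_iff {c : Cfg n} {g : Equiv.Perm (Fin n)} {p q : Fin n} :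
    act c g p = Slot.arc q ↔ c (g p) = Slot.arc (g q) := by
  rw [act]
  cases c (g p) <;> simp [Slot.map, Equiv.symm_apply_eq]

lemma map_rowSet_act (c : Cfg n) (g : Equiv.Perm (Fin n)) (j : ℕ) :
    (rowSet (act c g) j).map g.toEmbedding = rowSet c j := by
  ext p
  rw [Finset.mem_map_equiv, mem_rowSet, mem_rowSet, act_eq_row_iff, Equiv.apply_symm_apply]

lemma wt_act (c : Cfg n) (g : Equiv.Perm (Fin n)) (j : ℕ) : wt (act c g) j = wt c j := by
  rw [wt, wt, ← map_rowSet_act c g, Finset.card_map]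

lemma IsValid.act {c : Cfg n} (hc : IsValid n c) (g : Equiv.Perm (Fin n)) :
    IsValid n (act c g) := by
  refine ⟨fun p => ?_, fun p q h => ?_⟩
  · have h1 : c (g p) ≠ Slot.absent := by rw [Ne, hc.absent_iff]; omega
    constructor
    · rw [Cfg.act]
      cases h : c (g p) <;> simp_all [Slot.map]
    · intro h; omega
  · rw [act_eq_arc_iff] at h ⊢
    have := hc.arc_symm _ _ h
    exact ⟨this.1, fun e => this.2 (by rw [e])⟩

lemma act_update {c : Cfg n} {g : Equiv.Perm (Fin n)} {m : Fin n} (hm : g m = m) (j : ℕ) :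
    Function.update (act c g) m (Slot.row j) = act (Function.update c m (Slot.row j)) g := by
  ext p
  by_cases hp : p = m
  · subst hp
    rw [Function.update_self, act_of_row (j := j)]
    rw [hm, Function.update_self]
  · have : g p ≠ m := fun h => hp (g.injective (h.trans hm.symm))
    rw [Function.update_of_ne hp, act, act, Function.update_of_ne this]

lemma act_arcAt {c : Cfg n} {g : Equiv.Perm (Fin n)} {m : Fin n} (hm : g m = m) (p : Fin n) :
    arcAt (act c g) m p = act (arcAt c m (g p)) g := by
  ext q
  by_cases hq : q = m
  · subst hq
    rw [act_of_arc (q := p)]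
    · simp [arcAt]
    · simp [arcAt, hm]
  · have h1 : g q ≠ m := fun h => hq (g.injective (h.trans hm.symm))
    by_cases hqp : q = p
    · subst hqp
      rw [act_of_arc (q := m)]
      · simp [arcAt, hq]
      · simp [arcAt, hm, h1]
    · have h2 : g q ≠ g p := fun h => hqp (g.injective h)
      simp [arcAt, hq, hqp, act, h1, h2]

lemma act_relabel (c : Cfg n) (g : Equiv.Perm (Fin n)) (S : Finset (Fin n)) (j : ℕ) :
    relabel (act c g) S j = act (relabel c (S.map g.toEmbedding) j) g := by
  ext p
  by_cases hp : p ∈ S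
  · rw [act_of_row (j := j)]
    · simp [relabel, hp]
    · simp [relabel, hp]
  · simp [relabel, hp, act]

variable {R : Type} [CommRing R]

/-- A linear map to an algebra is equivariant for the permutations fixing the points from `k` on. -/
def Equivariant {B : Type*} [Ring B] [Algebra R B] (π : Equiv.Perm (Fin n) →* B) (k : ℕ)
    (L : (Cfg n →₀ R) →ₗ[R] B) : Prop :=
  ∀ (c : Cfg n) (g : Equiv.Perm (Fin n)), (∀ p : Fin n, k ≤ p.val → g p = p) →
    L (Finsupp.single (act c g) 1) = L (Finsupp.single c 1) * π g

variable {B : Type*} [Ring B] [Algebra R B] {π : Equiv.Perm (Fin n) →* B}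
  {L : (Cfg n →₀ R) →ₗ[R] B}

lemma Equivariant.comp_stepOp {k : ℕ} (hk : k < n) (hL : Equivariant π (k + 1) L)
    (a b : YoungDiagram × ℕ) : Equivariant π k (L ∘ₗ stepOp a b ⟨k, hk⟩) := by
  intro c g hg
  have hm : g ⟨k, hk⟩ = ⟨k, hk⟩ := hg _ le_rfl
  have hg' : ∀ p : Fin n, k + 1 ≤ p.val → g p = p := fun p hp => hg p (by omega)
  rw [LinearMap.comp_apply, LinearMap.comp_apply, stepOp]
  split_ifs
  · rw [addOp_single, addOp_single, act_update hm, hL _ _ hg']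
  · rw [remOp_single, remOp_single, map_sum, map_sum, Finset.sum_mul, ← map_rowSet_act c g,
      Finset.sum_map]
    refine Finset.sum_congr rfl fun p _ => ?_
    rw [act_arcAt hm, hL _ _ hg']
    rfl

lemma Equivariant.lowerOp_act (hL : Equivariant π n L) (j p : ℕ) (c : Cfg n)
    (g : Equiv.Perm (Fin n)) : L (lowerOp R j p (Finsupp.single (act c g) 1)) =
      L (lowerOp R j p (Finsupp.single c 1)) * π g := by
  rw [lowerOp_single, lowerOp_single, map_sum, map_sum, Finset.sum_mul, ← map_rowSet_act c g,
    Finset.powersetCard_map, Finset.sum_map]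
  refine Finset.sum_congr rfl fun S _ => ?_
  rw [act_relabel, hL _ _ fun p hp => by omega]
  rfl

end Action

end Cfg

/-! ### The superstandard tableau -/

section RowOfNum

/-- The number of nodes in the first `j` rows. -/
def rowSum (μ : YoungDiagram) (j : ℕ) : ℕ := ∑ i ∈ Finset.range j, μ.rowLen i

lemma rowSum_succ (μ : YoungDiagram) (j : ℕ) : rowSum μ (j + 1) = rowSum μ j + μ.rowLen j :=
  Finset.sum_range_succ _ _

lemma rowSum_mono (μ : YoungDiagram) : Monotone (rowSum μ) :=
  monotone_nat_of_le_succ fun j => by rw [rowSum_succ]; omega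

lemma rowSum_le_card (μ : YoungDiagram) (j : ℕ) : rowSum μ j ≤ μ.card :=
  YoungDiagram.sum_rowLen_le μ _

lemma rowOfNum_eq {μ : YoungDiagram} {j k : ℕ} (h1 : rowSum μ j < k) (h2 : k ≤ rowSum μ (j + 1)) :
    rowOfNum μ k = j := by
  have hj : j ≤ rowSum μ j := by
    have hpos : 0 < μ.rowLen j := by rw [rowSum_succ] at h2; omega
    calc j = ∑ i ∈ Finset.range j, 1 := by simp
      _ ≤ rowSum μ j := Finset.sum_le_sum fun i hi =>
        hpos.trans_le (μ.rowLen_anti i j (Finset.mem_range.mp hi).le)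
  have : (Finset.range k).filter (fun r => (∑ i ∈ Finset.range (r + 1), μ.rowLen i) < k) =
      Finset.range j := by
    ext r
    rw [Finset.mem_filter, Finset.mem_range, Finset.mem_range]
    change r < k ∧ rowSum μ (r + 1) < k ↔ r < j
    constructor
    · rintro ⟨_, h⟩
      by_contra hr
      have := rowSum_mono μ (show j + 1 ≤ r + 1 by omega)
      omega
    · intro hr
      have := rowSum_mono μ (show r + 1 ≤ j by omega)
      omega
  rw [rowOfNum, this, Finset.card_range]

lemma exists_rowOfNum {μ : YoungDiagram} {k : ℕ} (h1 : 1 ≤ k) (h2 : k ≤ μ.card) :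
    ∃ j, rowOfNum μ k = j ∧ rowSum μ j < k ∧ k ≤ rowSum μ (j + 1) := by
  have hex : ∃ j, k ≤ rowSum μ (j + 1) :=
    ⟨μ.card, h2.trans (le_of_eq (YoungDiagram.sum_rowLen_of_le μ (by omega)).symm)⟩
  classical
  have hj := Nat.find_spec hex
  have hlt : rowSum μ (Nat.find hex) < k := by
    rcases Nat.eq_zero_or_pos (Nat.find hex) with h | h
    · rw [h, rowSum, Finset.sum_range_zero]; omega
    · have := Nat.find_min hex (m := Nat.find hex - 1) (by omega)
      rw [Nat.sub_add_cancel h] at this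
      omega
  exact ⟨_, rowOfNum_eq hlt hj, hlt, hj⟩

lemma rowOfNum_eq_iff {μ : YoungDiagram} {j k : ℕ} (h1 : 1 ≤ k) (h2 : k ≤ μ.card) :
    rowOfNum μ k = j ↔ rowSum μ j < k ∧ k ≤ rowSum μ (j + 1) := by
  constructor
  · rintro rfl
    obtain ⟨j, rfl, h⟩ := exists_rowOfNum h1 h2
    exact h
  · exact fun h => rowOfNum_eq h.1 h.2

lemma rowOfNum_of_card_lt {μ : YoungDiagram} {k : ℕ} (h : μ.card < k) : rowOfNum μ k = k := by
  rw [rowOfNum, Finset.filter_true_of_mem, Finset.card_range]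
  exact fun r _ => (rowSum_le_card μ (r + 1)).trans_lt h

variable {small big : YoungDiagram} {j : ℕ}

lemma YoungDiagram.AddNode.rowSum (h : YoungDiagram.AddNode small big j) (i : ℕ) :
    rowSum big i = rowSum small i + if j < i then 1 else 0 := by
  induction i with
  | zero => simp [_root_.rowSum]
  | succ i ih =>
    rw [rowSum_succ, rowSum_succ, ih, h i]
    split_ifs <;> omega

lemma YoungDiagram.AddNode.aVal_eq (h : YoungDiagram.AddNode small big j) :
    aVal small big = _root_.rowSum big (j + 1) := by
  rw [aVal, h.addedRow_eq, _root_.rowSum]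

lemma YoungDiagram.AddNode.rowOfNum_lt (h : YoungDiagram.AddNode small big j) {q : ℕ}
    (h1 : 1 ≤ q) (h2 : q < _root_.rowSum big (j + 1)) : rowOfNum small q = rowOfNum big q := by
  have hs := rowSum_le_card small (j + 1)
  have hj := h.rowSum (j + 1)
  rw [if_pos (by omega)] at hj
  obtain ⟨i, hi, h3, h4⟩ := exists_rowOfNum (μ := small) h1 (by omega)
  rw [hi, eq_comm]
  have hij : i ≤ j := by
    by_contra hc
    have := rowSum_mono small (show j + 1 ≤ i by omega)
    omega
  apply rowOfNum_eq
  · rw [h.rowSum, if_neg (by omega)]; omega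
  · rw [h.rowSum]; omega

lemma YoungDiagram.AddNode.rowOfNum_ge (h : YoungDiagram.AddNode small big j) {q : ℕ}
    (h1 : _root_.rowSum big (j + 1) ≤ q) (h2 : q ≤ small.card) :
    rowOfNum big (q + 1) = rowOfNum small q := by
  have hj := h.rowSum (j + 1)
  rw [if_pos (by omega)] at hj
  obtain ⟨i, hi, h3, h4⟩ := exists_rowOfNum (μ := small) (by omega) h2
  rw [hi]
  have hij : j < i := by
    by_contra hc
    have := rowSum_mono small (show i + 1 ≤ j + 1 by omega)
    omega
  apply rowOfNum_eq
  · rw [h.rowSum, if_pos hij]; omega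
  · rw [h.rowSum, if_pos (by omega)]; omega

end RowOfNum

/-! ### Cycles of consecutive points -/

section Cycles

/-- The permutation underlying `sAsc`. -/
def ascPerm (n a b : ℕ) : Equiv.Perm (Fin n) :=
  ((List.range (b - a)).map fun k => swN n (a + k)).prod

/-- The permutation underlying `sDesc`. -/
def descPerm (n b a : ℕ) : Equiv.Perm (Fin n) :=
  ((List.range (b - a)).map fun k => swN n (b - 1 - k)).prod

lemma ascPerm_succ {n a b : ℕ} (h : a ≤ b) : ascPerm n a (b + 1) = ascPerm n a b * swN n b := by
  rw [ascPerm, ascPerm, Nat.succ_sub h, List.range_succ, List.map_append, List.prod_append]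
  simp [Nat.add_sub_cancel' h]

lemma descPerm_mul_ascPerm (n : ℕ) {a b : ℕ} (h : a ≤ b) :
    ascPerm n a b * descPerm n b a = 1 := by
  induction b, h using Nat.le_induction with
  | base => simp [ascPerm, descPerm]
  | succ b h ih =>
    have : descPerm n (b + 1) a = swN n b * descPerm n b a := by
      rw [descPerm, descPerm, Nat.succ_sub h, List.range_succ_eq_map, List.map_cons, List.prod_cons,
        List.map_map]
      congr 3
      ext k
      simp [Nat.sub_sub, Nat.add_comm]
    rw [ascPerm_succ h, this, mul_assoc, ← mul_assoc (swN n b), swN_mul_self, one_mul, ih]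

lemma descPerm_eq_inv {n a b : ℕ} (h : a ≤ b) : descPerm n b a = (ascPerm n a b)⁻¹ :=
  eq_inv_of_mul_eq_one_right (descPerm_mul_ascPerm n h)

lemma ascPerm_val {n a b : ℕ} (ha : 1 ≤ a) (hab : a ≤ b) (hb : b ≤ n) (p : Fin n) :
    (ascPerm n a b p).val = if p.val + 1 = b then a - 1 else
      if a ≤ p.val + 1 ∧ p.val + 1 < b then p.val + 1 else p.val := by
  induction b, hab using Nat.le_induction generalizing p with
  | base => simp [ascPerm]; split_ifs <;> omega
  | succ b h ih =>
    rw [ascPerm_succ h, Equiv.Perm.mul_apply, ih (by omega), swN_of (by omega) (by omega),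
      Equiv.swap_apply_def]
    simp only [Fin.ext_iff]
    split_ifs <;> simp_all <;> omega

lemma descPerm_val {n a b : ℕ} (ha : 1 ≤ a) (hab : a ≤ b) (hb : b ≤ n) (p : Fin n) :
    (descPerm n b a p).val = if p.val + 1 = a then b - 1 else
      if a < p.val + 1 ∧ p.val + 1 ≤ b then p.val - 1 else p.val := by
  obtain ⟨q, rfl⟩ := (ascPerm n a b).surjective p
  rw [descPerm_eq_inv hab, Equiv.Perm.inv_def, Equiv.symm_apply_apply, ascPerm_val ha hab hb]
  split_ifs <;> omega

variable {R : Type} [CommRing R] {δ : R} {n : ℕ} {π : Equiv.Perm (Fin n) →* Brauer R δ n}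

lemma map_ascPerm (hπ : ∀ j, π (swN n j) = brS R δ n j) (a b : ℕ) :
    π (ascPerm n a b) = sAsc R δ n a b := by
  rw [ascPerm, sAsc, map_list_prod, List.map_map]
  congr 2
  ext k
  exact hπ _

lemma map_descPerm (hπ : ∀ j, π (swN n j) = brS R δ n j) (b a : ℕ) :
    π (descPerm n b a) = sDesc R δ n b a := by
  rw [descPerm, sDesc, map_list_prod, List.map_map]
  congr 2
  ext k
  exact hπ _

end Cycles

namespace Cfg

section Std
variable {n : ℕ}

/-- The configuration with the first `m` points labelled according to the superstandard tableau
of shape `μ`, and the next points, up to `k`, joined consecutively. -/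
def std (n : ℕ) (μ : YoungDiagram) (m k : ℕ) : Cfg n := fun p =>
  if p.val < m then Slot.row (rowOfNum μ (p.val + 1)) else
  if k ≤ p.val then Slot.absent else
  if (p.val - m) % 2 = 0 then
    if h : p.val + 1 < n then Slot.arc ⟨p.val + 1, h⟩ else Slot.absent
  else Slot.arc ⟨p.val - 1, by omega⟩

lemma std_row {μ : YoungDiagram} {m k : ℕ} {p : Fin n} (h : p.val < m) :
    std n μ m k p = Slot.row (rowOfNum μ (p.val + 1)) := if_pos h

lemma std_absent {μ : YoungDiagram} {m k : ℕ} {p : Fin n} (hm : m ≤ k) (h : k ≤ p.val) :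
    std n μ m k p = Slot.absent := by
  rw [std, if_neg (by omega), if_pos h]

lemma std_arc {μ : YoungDiagram} {m k t : ℕ} {p q : Fin n} (hp : p.val = m + 2 * t)
    (hq : q.val = m + 2 * t + 1) (hk : m + 2 * t + 1 < k) :
    std n μ m k p = Slot.arc q ∧ std n μ m k q = Slot.arc p := by
  constructor
  · rw [std, if_neg (by omega), if_neg (by omega), if_pos (by omega), dif_pos (by omega)]
    congr 1
    ext
    simp [hp, hq]
  · rw [std, if_neg (by omega), if_neg (by omega), if_neg (by omega)]
    congr 1
    ext
    simp [hp, hq]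

lemma cases_std {m k l : ℕ} (hk : k = m + 2 * l) (p : ℕ) :
    p < m ∨ k ≤ p ∨ ∃ t < l, p = m + 2 * t ∨ p = m + 2 * t + 1 := by
  by_cases h1 : p < m
  · exact Or.inl h1
  · by_cases h2 : k ≤ p
    · exact Or.inr (Or.inl h2)
    · exact Or.inr (Or.inr ⟨(p - m) / 2, by omega, by omega⟩)

lemma std_isValid {μ : YoungDiagram} {m k l : ℕ} (hk : k = m + 2 * l) (hkn : k ≤ n) :
    IsValid k (std n μ m k) := by
  refine ⟨fun p => ?_, fun p q h => ?_⟩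
  · rcases cases_std hk p.val with h | h | ⟨t, ht, h | h⟩
    · rw [std_row h]; simp; omega
    · simp [std_absent (by omega : m ≤ k) h, h]
    · have := (std_arc (μ := μ) (k := k) (q := ⟨m + 2 * t + 1, by omega⟩) h rfl (by omega)).1
      rw [this]; simp; omega
    · have := (std_arc (μ := μ) (k := k) (p := ⟨m + 2 * t, by omega⟩) rfl h (by omega)).2
      rw [this]; simp; omega
  · rcases cases_std hk p.val with h' | h' | ⟨t, ht, h' | h'⟩
    · simp [std_row h'] at h
    · simp [std_absent (by omega : m ≤ k) h'] at h
    · have := std_arc (μ := μ) (k := k) (q := ⟨m + 2 * t + 1, by omega⟩) h' rfl (by omega)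
      rw [this.1, Slot.arc.injEq] at h
      subst h
      exact ⟨this.2, fun e => by rw [Fin.ext_iff] at e; simp at e; omega⟩
    · have := std_arc (μ := μ) (k := k) (p := ⟨m + 2 * t, by omega⟩) rfl h' (by omega)
      rw [this.2, Slot.arc.injEq] at h
      subst h
      exact ⟨this.1, fun e => by rw [Fin.ext_iff] at e; simp at e; omega⟩

lemma wt_std {μ : YoungDiagram} {k : ℕ} (hk : μ.card ≤ k) (hkn : k ≤ n) (j : ℕ) :
    wt (std n μ μ.card k) j = μ.rowLen j := by
  have h1 : (rowSet (std n μ μ.card k) j).map Fin.valEmbedding =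
      Finset.Ico (rowSum μ j) (rowSum μ (j + 1)) := by
    ext q
    rw [Finset.mem_map, Finset.mem_Ico]
    have hle := rowSum_le_card μ (j + 1)
    constructor
    · rintro ⟨p, hp, rfl⟩
      rw [mem_rowSet] at hp
      by_cases h : p.val < μ.card
      · rw [std_row h, Slot.row.injEq, rowOfNum_eq_iff (by omega) (by omega)] at hp
        simp only [Fin.valEmbedding_apply]; omega
      · rw [std, if_neg h] at hp
        split_ifs at hp
    · rintro ⟨h2, h3⟩
      refine ⟨⟨q, by omega⟩, ?_, rfl⟩
      rw [mem_rowSet, std_row (show q < μ.card by omega), Slot.row.injEq]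
      exact rowOfNum_eq (by simpa using Nat.lt_succ_of_le h2) h3
  rw [wt, ← Finset.card_map, h1, Nat.card_Ico, rowSum_succ]
  omega

lemma act_std_ascPerm {small big : YoungDiagram} {j : ℕ}
    (h : YoungDiagram.AddNode small big j) {k l : ℕ} (hk : k = small.card + 2 * l) (hkn : k < n) :
    act (std n big big.card (k + 1)) (ascPerm n (rowSum big (j + 1)) (k + 1)) =
      Function.update (std n small small.card k) ⟨k, hkn⟩ (Slot.row j) := by
  have hc := h.card
  have hle := rowSum_le_card big (j + 1)
  have hpos : rowSum big j < rowSum big (j + 1) := by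
    have := h.rowSum (j + 1)
    have := h.rowSum j
    have := rowSum_mono small (show j ≤ j + 1 by omega)
    split_ifs at * <;> omega
  have hv := fun p : Fin n => ascPerm_val (n := n) (a := rowSum big (j + 1)) (b := k + 1)
    (by omega) (by omega) (by omega) p
  set a := rowSum big (j + 1) with ha
  set σ := ascPerm n a (k + 1) with hσ
  ext p
  by_cases hpk : p.val = k
  · have : p = ⟨k, hkn⟩ := Fin.ext hpk
    have h2 := hv p
    rw [if_pos (by omega)] at h2
    rw [this, Function.update_self, ← this]
    apply act_of_row
    rw [std_row (by omega), h2, Slot.row.injEq]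
    exact rowOfNum_eq (by omega) (by omega)
  have hne : p ≠ ⟨k, hkn⟩ := fun e => hpk (by rw [e])
  rw [Function.update_of_ne hne]
  have h2 := hv p
  rw [if_neg (by omega)] at h2
  rcases cases_std hk p.val with h3 | h3 | ⟨t, ht, h3⟩
  · rw [std_row h3]
    apply act_of_row
    split_ifs at h2 with h4
    · rw [std_row (by omega), h2, Slot.row.injEq]
      exact h.rowOfNum_ge h4.1 (by omega)
    · rw [std_row (by omega), h2, Slot.row.injEq]
      exact (h.rowOfNum_lt (by omega) (by omega)).symm
  · rw [std_absent (by omega) h3]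
    apply act_of_absent
    rw [if_neg (by omega)] at h2
    exact std_absent (by omega) (by omega)
  · have key : ∀ p q : Fin n, p.val = small.card + 2 * t → q.val = small.card + 2 * t + 1 →
        act (std n big big.card (k + 1)) σ p = std n small small.card k p ∧
        act (std n big big.card (k + 1)) σ q = std n small small.card k q := by
      intro p q hp hq
      have hp2 := hv p
      have hq2 := hv q
      rw [if_neg (by omega), if_pos (by omega)] at hp2 hq2
      have e1 := std_arc (μ := small) (k := k) hp hq (by omega)
      have e2 := std_arc (μ := big) (m := big.card) (k := k + 1) (t := t) (p := σ p) (q := σ q)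
        (by omega) (by omega) (by omega)
      rw [e1.1, e1.2]
      exact ⟨act_of_arc e2.1, act_of_arc e2.2⟩
    rcases h3 with h3 | h3
    · exact (key p ⟨small.card + 2 * t + 1, by omega⟩ h3 rfl).1
    · exact (key ⟨small.card + 2 * t, by omega⟩ p rfl h3).2

lemma act_std_descPerm_mul_ascPerm {small big : YoungDiagram} {j : ℕ}
    (h : YoungDiagram.AddNode small big j) {k l : ℕ} (hk : k = big.card + 2 * l) (hkn : k < n)
    {b : ℕ} (hb1 : rowSum big j < b) (hb2 : b ≤ rowSum big (j + 1)) :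
    act (std n small small.card (k + 1))
        (descPerm n big.card b * ascPerm n (big.card + 1) (k + 1)) =
      arcAt (std n big big.card k) ⟨k, hkn⟩ ⟨b - 1, by
        have := rowSum_le_card big (j + 1); omega⟩ := by
  have hc := h.card
  have hle := rowSum_le_card big (j + 1)
  have hj0 := h.rowSum j
  have hj1 := h.rowSum (j + 1)
  rw [if_neg (by omega)] at hj0
  rw [if_pos (by omega)] at hj1
  have hv : ∀ p : Fin n, _ := fun p => ascPerm_val (n := n) (a := big.card + 1) (b := k + 1)
    (by omega) (by omega) (by omega) p
  have hw : ∀ p : Fin n, _ := fun p => descPerm_val (n := n) (a := b) (b := big.card)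
    (by omega) (by omega) (by omega) p
  set σ := ascPerm n (big.card + 1) (k + 1) with hσ
  set ρ := descPerm n big.card b with hρ
  have hx : ∀ p : Fin n, ((ρ * σ) p).val = (ρ (σ p)).val := fun _ => rfl
  set q0 : Fin n := ⟨b - 1, by omega⟩ with hq0
  set k0 : Fin n := ⟨k, hkn⟩ with hk0
  have vk : ((ρ * σ) k0).val = big.card := by
    have h1 := hv k0
    have h2 := hw (σ k0)
    rw [if_pos (by simp [hk0])] at h1
    rw [hx, h2, if_neg (by omega), if_neg (by omega)]
    omega
  have vq : ((ρ * σ) q0).val = small.card := by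
    have h1 := hv q0
    have h2 := hw (σ q0)
    have h3 : q0.val = b - 1 := rfl
    rw [if_neg (by omega), if_neg (by omega)] at h1
    rw [hx, h2, if_pos (by omega)]
    omega
  have hqk := std_arc (μ := small) (m := small.card) (k := k + 1) (t := 0) (p := (ρ * σ) q0)
    (q := (ρ * σ) k0) (by omega) (by omega) (by omega)
  ext p
  by_cases hpk : p = k0
  · rw [hpk, arcAt, Function.update_self]
    exact act_of_arc hqk.2
  by_cases hpq : p = q0
  · rw [hpq, arcAt, Function.update_of_ne (fun e => hpk (hpq.trans e)), Function.update_self]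
    exact act_of_arc hqk.1
  have hpk' : p.val ≠ k := fun e => hpk (Fin.ext e)
  have hpq' : p.val ≠ b - 1 := fun e => hpq (Fin.ext e)
  rw [arcAt, Function.update_of_ne hpk, Function.update_of_ne hpq]
  have h1 := hv p
  have h2 := hw (σ p)
  rw [if_neg (by omega)] at h1
  rcases cases_std hk p.val with h3 | h3 | ⟨t, ht, h3⟩
  · rw [std_row h3]
    apply act_of_row
    rw [if_neg (by omega)] at h1
    rw [if_neg (by omega)] at h2
    split_ifs at h2 with h4
    · rw [std_row (by rw [hx]; omega), hx, h2, Slot.row.injEq]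
      have e1 : (σ p).val - 1 + 1 = p.val := by omega
      rw [e1]
      by_cases h5 : p.val + 1 ≤ rowSum big (j + 1)
      · rw [h.rowOfNum_lt (by omega) (by omega), rowOfNum_eq (j := j) (by omega) (by omega),
          rowOfNum_eq (j := j) (by omega) (by omega)]
      · exact (h.rowOfNum_ge (by omega) (by omega)).symm
    · rw [std_row (by rw [hx]; omega), hx, h2, Slot.row.injEq, h1]
      exact h.rowOfNum_lt (by omega) (by omega)
  · rw [std_absent (by omega) h3]
    apply act_of_absent
    rw [if_neg (by omega)] at h1
    rw [if_neg (by omega), if_neg (by omega)] at h2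
    exact std_absent (by omega) (by rw [hx]; omega)
  · have key : ∀ p q : Fin n, p.val = big.card + 2 * t → q.val = big.card + 2 * t + 1 →
        act (std n small small.card (k + 1)) (ρ * σ) p = std n big big.card k p ∧
        act (std n small small.card (k + 1)) (ρ * σ) q = std n big big.card k q := by
      intro p q hp hq
      have hp1 := hv p
      have hq1 := hv q
      rw [if_neg (by omega), if_pos (by omega)] at hp1 hq1
      have hp2 := hw (σ p)
      have hq2 := hw (σ q)
      rw [if_neg (by omega), if_neg (by omega)] at hp2 hq2
      have e1 := std_arc (μ := big) (k := k) hp hq (by omega)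
      have e2 := std_arc (μ := small) (m := small.card) (k := k + 1) (t := t + 1)
        (p := (ρ * σ) p) (q := (ρ * σ) q) (by rw [hx]; omega) (by rw [hx]; omega) (by omega)
      rw [e1.1, e1.2]
      exact ⟨act_of_arc e2.1, act_of_arc e2.2⟩
    rcases h3 with h3 | h3
    · exact (key p ⟨big.card + 2 * t + 1, by omega⟩ h3 rfl).1
    · exact (key ⟨big.card + 2 * t, by omega⟩ p rfl h3).2

end Std

end Cfg

namespace Cfg

lemma IsChain.card_eq {pp : ℕ → YoungDiagram × ℕ} {n : ℕ} (h : IsChain pp n) {k : ℕ}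
    (hk : k ≤ n) : k = (pp k).1.card + 2 * (pp k).2 := by
  induction k with
  | zero => rw [h.1]; simp [YoungDiagram.card]
  | succ k ih =>
    have := ih (by omega)
    rcases h.2 k hk with ⟨h1, _, h2⟩ | ⟨h1, _, h2⟩ <;> omega

section PathVector
variable {R : Type} [CommRing R] {δ : R} {n : ℕ} {π : Equiv.Perm (Fin n) →* Brauer R δ n}

lemma sum_rowSet_std {M : Type*} [AddCommMonoid M] {big : YoungDiagram} {j k : ℕ}
    (hk : big.card ≤ k) (hkn : k ≤ n) {f : ℕ → M} {N : ℕ} (hN : big.rowLen j = N) :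
    ∑ p ∈ rowSet (std n big big.card k) j, f (p.val + 1) =
      ∑ r ∈ Finset.range N, f (rowSum big (j + 1) - r) := by
  subst hN
  have hle := rowSum_le_card big (j + 1)
  have hs := rowSum_succ big j
  symm
  refine Finset.sum_bij (fun r hr => ⟨rowSum big (j + 1) - r - 1, by
    rw [Finset.mem_range] at hr; omega⟩) ?_ ?_ ?_ ?_
  · intro r hr
    rw [Finset.mem_range] at hr
    rw [mem_rowSet, std_row (by simp only; omega), Slot.row.injEq]
    exact rowOfNum_eq (by simp only; omega) (by simp only; omega)
  · intro r hr r' hr' h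
    rw [Finset.mem_range] at hr hr'
    rw [Fin.mk.injEq] at h
    omega
  · intro p hp
    rw [mem_rowSet] at hp
    by_cases h : p.val < big.card
    · rw [std_row h, Slot.row.injEq, rowOfNum_eq_iff (by omega) (by omega)] at hp
      exact ⟨rowSum big (j + 1) - p.val - 1, by rw [Finset.mem_range]; omega,
        Fin.ext (by simp only; omega)⟩
    · rw [std, if_neg h] at hp
      split_ifs at hp
  · intro r hr
    rw [Finset.mem_range] at hr
    congr 1
    simp only
    omega

/-- One step of the comparison of path elements with path vectors. -/
lemma Equivariant.map_std_mul_dStepBr (hπ : ∀ j, π (swN n j) = brS R δ n j) {k : ℕ} (hkn : k < n)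
    {L : (Cfg n →₀ R) →ₗ[R] Brauer R δ n} (hL : Equivariant π (k + 1) L)
    {a b : YoungDiagram × ℕ} (hab : WEdge a b) (ha : k = a.1.card + 2 * a.2)
    {y : Brauer R δ n} (hy : L (Finsupp.single (std n b.1 b.1.card (k + 1)) 1) =
      y * eStairBr R δ n (k + 1) b.2) :
    L (Finsupp.single (std n b.1 b.1.card (k + 1)) 1) * dStepBr R δ n k a b =
      L (stepOp a b ⟨k, hkn⟩ (Finsupp.single (std n a.1 a.1.card k) 1)) := by
  obtain ⟨am, al⟩ := a
  obtain ⟨bm, bl⟩ := b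
  simp only at ha hy
  rcases hab with ⟨h1, h2, h3⟩ | ⟨h1, h2, h3⟩
  · simp only at h1 h2 h3
    subst h1
    obtain ⟨j, hj⟩ := YoungDiagram.exists_addNode h2 h3
    have hle := rowSum_le_card bm (j + 1)
    simp only [dStepBr, stepOp, if_true, dBarBr]
    have e1 := eStairBr_mul_dBar (R := R) (δ := δ) (n := n) (l := bl) (k := k + 1)
      (a := rowSum bm (j + 1)) (by omega) hkn (by omega)
    have e2 : k + 1 - 2 * bl = k - 2 * bl + 1 := by omega
    rw [e2, Nat.add_sub_cancel] at e1
    rw [hj.aVal_eq, hj.addedRow_eq, addOp_single, hy, mul_assoc, e1, ← mul_assoc, ← hy,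
      ← act_std_ascPerm hj ha hkn, ← map_ascPerm hπ, hL _ _ fun p hp => ?_]
    have hpos : rowSum bm j < rowSum bm (j + 1) := by
      rw [rowSum_succ, hj j]; simp
    ext
    rw [ascPerm_val (by omega) (by omega) (by omega), if_neg (by omega), if_neg (by omega)]
  · simp only at h1 h2 h3
    subst h1
    obtain ⟨j, hj⟩ := YoungDiagram.exists_addNode h2 h3
    have hle := rowSum_le_card am (j + 1)
    have hs := rowSum_succ am j
    have hlen : am.rowLen j = bm.rowLen j + 1 := by rw [hj j]; simp
    simp only [dStepBr, stepOp, uBarBr]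
    rw [if_neg (by omega), if_neg (by omega)]
    have e1 := eStairBr_mul_uBar (R := R) (δ := δ) (n := n) (l := al) (k := k + 1)
      (a := rowSum am (j + 1)) (r := bm.rowLen j + 1) (by omega) hkn (by omega)
    have e2 : k + 1 - 2 * al - 1 = k - 2 * al := by omega
    rw [e2, Nat.add_sub_cancel] at e1
    have e3 : k + 1 - 2 * al = am.card + 1 := by omega
    have e4 : k - 2 * al = am.card := by omega
    rw [hj.aVal_eq, hj.addedRow_eq, hy, mul_assoc,
      ← mul_assoc (eStairBr R δ n (k + 1) (al + 1)), e1,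
      ← mul_assoc, ← hy, remOp_single, map_sum, e3, e4, Finset.mul_sum, ← sum_rowSet_std
        (f := fun b => L (Finsupp.single (std n bm bm.card (k + 1)) 1) *
          (sDesc R δ n am.card b * sAsc R δ n (am.card + 1) (k + 1)))
        (show am.card ≤ k by omega) hkn.le hlen]
    refine Finset.sum_congr rfl fun p hp => ?_
    have hp' : p.val < am.card := by
      by_contra h
      rw [mem_rowSet, std, if_neg h] at hp
      split_ifs at hp
    rw [mem_rowSet, std_row hp', Slot.row.injEq, rowOfNum_eq_iff (by omega) (by omega)] at hp
    have e5 := act_std_descPerm_mul_ascPerm hj ha hkn hp.1 hp.2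
    simp only [Nat.add_sub_cancel] at e5
    rw [← map_ascPerm hπ, ← map_descPerm hπ, ← map_mul, ← hL, e5]
    intro q hq
    ext
    have v1 := ascPerm_val (n := n) (a := am.card + 1) (b := k + 1) (by omega) (by omega)
      (by omega) q
    have v2 := descPerm_val (n := n) (a := p.val + 1) (b := am.card) (by omega) (by omega)
      (by omega) (ascPerm n (am.card + 1) (k + 1) q)
    rw [if_neg (by omega), if_neg (by omega)] at v1
    rw [if_neg (by omega), if_neg (by omega)] at v2
    rw [Equiv.Perm.mul_apply, v2, v1]

/-- The product of the branching coefficients of the first `k` steps of a path. -/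
def pathProd (R : Type) [CommRing R] (δ : R) (n : ℕ) (pp : ℕ → YoungDiagram × ℕ) :
    ℕ → Brauer R δ n
  | 0 => 1
  | k + 1 => dStepBr R δ n k (pp k) (pp (k + 1)) * pathProd R δ n pp k

theorem Equivariant.map_vPath (hπ : ∀ j, π (swN n j) = brS R δ n j)
    {L : (Cfg n →₀ R) →ₗ[R] Brauer R δ n} (hL : Equivariant π n L)
    {pp : ℕ → YoungDiagram × ℕ} (hpp : IsChain pp n) {y : Brauer R δ n}
    (hy : L (Finsupp.single (std n (pp n).1 (pp n).1.card n) 1) =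
      y * eStairBr R δ n n (pp n).2) :
    L (vPath R n pp n) =
      L (Finsupp.single (std n (pp n).1 (pp n).1.card n) 1) * pathProd R δ n pp n := by
  have key : ∀ d ≤ n, ∃ L' : (Cfg n →₀ R) →ₗ[R] Brauer R δ n, Equivariant π (n - d) L' ∧
      L' (vPath R n pp (n - d)) = L (vPath R n pp n) ∧
      L' (Finsupp.single (std n (pp (n - d)).1 (pp (n - d)).1.card (n - d)) 1) *
        pathProd R δ n pp (n - d) =
        L (Finsupp.single (std n (pp n).1 (pp n).1.card n) 1) * pathProd R δ n pp n ∧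
      ∃ y, L' (Finsupp.single (std n (pp (n - d)).1 (pp (n - d)).1.card (n - d)) 1) =
        y * eStairBr R δ n (n - d) (pp (n - d)).2 := by
    intro d hd
    induction d with
    | zero => exact ⟨L, hL, rfl, rfl, y, hy⟩
    | succ d ih =>
      obtain ⟨L', h1, h2, h3, y', h4⟩ := ih (by omega)
      obtain ⟨k, hk⟩ : ∃ k, n - d = k + 1 := ⟨n - d - 1, by omega⟩
      have hk' : n - (d + 1) = k := by omega
      rw [hk] at h1 h2 h3 h4
      rw [hk']
      have hkn : k < n := by omega
      have hstep := h1.map_std_mul_dStepBr hπ hkn (hpp.2 k hkn) (hpp.card_eq hkn.le) h4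
      refine ⟨L' ∘ₗ stepOp (pp k) (pp (k + 1)) ⟨k, hkn⟩, h1.comp_stepOp hkn _ _, ?_, ?_, ?_⟩
      · rw [← h2, vPath, dif_pos hkn, LinearMap.comp_apply]
      · rw [← h3, pathProd, ← mul_assoc, hstep, LinearMap.comp_apply]
      · rw [LinearMap.comp_apply, ← hstep, dStepBr]
        split_ifs
        · exact ⟨_, (mul_assoc _ _ _).symm⟩
        · exact ⟨_, (mul_assoc _ _ _).symm⟩
  obtain ⟨L', _, h2, h3, _⟩ := key n le_rfl
  rw [Nat.sub_self] at h2 h3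
  rw [← h2, ← h3, pathProd, mul_one, vPath]
  congr 3
  ext p
  exact (std_absent (by rw [hpp.1]; simp [YoungDiagram.card]) (Nat.zero_le _)).symm

end PathVector

end Cfg

/-! ### The cell generators -/

section CellGenerator

lemma exists_list_prod_eq_mul {M : Type*} [Monoid M] {f : ℕ → M} {l t : ℕ}
    (hf : ∀ s < l, ∀ t < l, Commute (f s) (f t)) (ht : t < l) :
    ∃ y, ((List.range l).map f).prod = y * f t := by
  induction l with
  | zero => omega
  | succ l ih =>
    rw [List.range_succ, List.map_append, List.prod_append, List.map_singleton, List.prod_singleton]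
    by_cases h : t = l
    · subst h; exact ⟨_, rfl⟩
    · obtain ⟨y, hy⟩ := ih (fun s hs t ht => hf s (by omega) t (by omega)) (by omega)
      exact ⟨y * f l, by rw [hy, mul_assoc, (hf t (by omega) l (by omega)).eq, mul_assoc]⟩

lemma exists_list_prod_eq_mul_mul {M : Type*} [Monoid M] {f : ℕ → M} {l t u : ℕ}
    (hf : ∀ s < l, ∀ t < l, Commute (f s) (f t)) (ht : t < l) (hu : u < l) (htu : t ≠ u) :
    ∃ y, ((List.range l).map f).prod = y * (f t * f u) := by
  induction l with
  | zero => omega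
  | succ l ih =>
    have hf' : ∀ s < l, ∀ t < l, Commute (f s) (f t) := fun s hs t ht =>
      hf s (by omega) t (by omega)
    rw [List.range_succ, List.map_append, List.prod_append, List.map_singleton, List.prod_singleton]
    by_cases h : t = l
    · subst h
      obtain ⟨y, hy⟩ := exists_list_prod_eq_mul hf' (t := u) (by omega)
      exact ⟨y, by rw [hy, mul_assoc, (hf u (by omega) t (by omega)).eq]⟩
    · by_cases h' : u = l
      · subst h'
        obtain ⟨y, hy⟩ := exists_list_prod_eq_mul hf' (t := t) (by omega)
        exact ⟨y, by rw [hy, mul_assoc]⟩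
      · obtain ⟨y, hy⟩ := ih hf' (by omega) (by omega)
        refine ⟨y * f l, ?_⟩
        rw [hy, mul_assoc, ((hf t (by omega) l (by omega)).mul_left
          (hf u (by omega) l (by omega))).eq, mul_assoc]

/-- The permutation fixes all points from `m` on. -/
def FixesFrom {n : ℕ} (m : ℕ) (g : Equiv.Perm (Fin n)) : Prop := ∀ p : Fin n, m ≤ p.val → g p = p

lemma FixesFrom.mul {n m : ℕ} {g h : Equiv.Perm (Fin n)} (hg : FixesFrom m g)
    (hh : FixesFrom m h) : FixesFrom m (g * h) := fun p hp => by
  rw [Equiv.Perm.mul_apply, hh p hp, hg p hp]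

lemma FixesFrom.inv {n m : ℕ} {g : Equiv.Perm (Fin n)} (hg : FixesFrom m g) :
    FixesFrom m g⁻¹ := fun p hp => by
  rw [Equiv.Perm.inv_eq_iff_eq, hg p hp]

lemma FixesFrom.one {n m : ℕ} : FixesFrom m (1 : Equiv.Perm (Fin n)) := fun _ _ => rfl

lemma FixesFrom.lt {n m : ℕ} {g : Equiv.Perm (Fin n)} (hg : FixesFrom m g) {p : Fin n}
    (hp : p.val < m) : (g p).val < m := by
  by_contra h
  have := g.injective (hg (g p) (by omega))
  rw [this] at h
  omega

variable {R : Type} [CommRing R] {δ : R} {n : ℕ} {π : Equiv.Perm (Fin n) →* Brauer R δ n}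
  {E : Fin n → Fin n → Brauer R δ n}

/-- The arcs of the staircase element. -/
lemma brE_eq_of_val (hE : ∀ j (h1 : 1 ≤ j) (h2 : j < n), brE R δ n j = E ⟨j - 1, by omega⟩ ⟨j, h2⟩)
    {p q : Fin n} {j : ℕ} (hp : p.val + 1 = j) (hq : q.val = j) : brE R δ n j = E p q := by
  rw [hE j (by omega) (by omega)]
  congr 1 <;> ext <;> simp only <;> omega

lemma Cfg.exists_of_std_arc {μ : YoungDiagram} {l m : ℕ} (hn : n = m + 2 * l) {p q : Fin n}
    (h : Cfg.std n μ m n p = Slot.arc q) :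
    ∃ t < l, p.val = m + 2 * t ∧ q.val = m + 2 * t + 1 ∨
      q.val = m + 2 * t ∧ p.val = m + 2 * t + 1 := by
  rcases Cfg.cases_std hn p.val with h1 | h1 | ⟨t, ht, h1 | h1⟩
  · simp [Cfg.std_row h1] at h
  · omega
  · have := Cfg.std_arc (μ := μ) (k := n) (q := ⟨m + 2 * t + 1, by omega⟩) h1 rfl (by omega)
    rw [this.1, Slot.arc.injEq] at h
    exact ⟨t, ht, Or.inl ⟨h1, by rw [← h]⟩⟩
  · have := Cfg.std_arc (μ := μ) (k := n) (p := ⟨m + 2 * t, by omega⟩) rfl h1 (by omega)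
    rw [this.2, Slot.arc.injEq] at h
    exact ⟨t, ht, Or.inr ⟨by rw [← h], h1⟩⟩

lemma commute_eStairBr_of_arcs
    (hE : ∀ j (h1 : 1 ≤ j) (h2 : j < n), brE R δ n j = E ⟨j - 1, by omega⟩ ⟨j, h2⟩)
    {l m : ℕ} (hn : n = m + 2 * l) {x : Brauer R δ n}
    (h : ∀ p q : Fin n, m ≤ p.val → m ≤ q.val → Commute x (E p q)) :
    Commute x (eStairBr R δ n n l) := by
  apply commute_list_prod_map
  intro t ht
  rw [brE_eq_of_val hE (p := ⟨m + 2 * t, by omega⟩) (q := ⟨m + 2 * t + 1, by omega⟩)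
    (by simp only; omega) (by simp only; omega)]
  exact h _ _ (by simp only; omega) (by simp only; omega)

namespace ArcSystem

lemma commute_perm_eStairBr (A : ArcSystem δ π E)
    (hE : ∀ j (h1 : 1 ≤ j) (h2 : j < n), brE R δ n j = E ⟨j - 1, by omega⟩ ⟨j, h2⟩)
    {l m : ℕ} (hn : n = m + 2 * l) {g : Equiv.Perm (Fin n)}
    (hg : FixesFrom m g) : Commute (π g) (eStairBr R δ n n l) :=
  commute_eStairBr_of_arcs hE hn fun p q hp hq => by
    have := A.conj g p q
    rwa [hg p hp, hg q hq] at this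

lemma commute_brE_eStairBr_factors (A : ArcSystem δ π E)
    (hE : ∀ j (h1 : 1 ≤ j) (h2 : j < n), brE R δ n j = E ⟨j - 1, by omega⟩ ⟨j, h2⟩)
    {l : ℕ} (hn : 2 * l ≤ n) :
    ∀ s < l, ∀ t < l, Commute (brE R δ n (n - 2 * l + 1 + 2 * s))
      (brE R δ n (n - 2 * l + 1 + 2 * t)) := by
  intro s hs t ht
  by_cases hst : s = t
  · rw [hst]
  · rw [hE _ (by omega) (by omega), hE _ (by omega) (by omega)]
    apply A.comm <;> (rw [Ne, Fin.mk.injEq]; omega)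

lemma exists_eStairBr_eq_mul (A : ArcSystem δ π E)
    (hE : ∀ j (h1 : 1 ≤ j) (h2 : j < n), brE R δ n j = E ⟨j - 1, by omega⟩ ⟨j, h2⟩)
    {l m t : ℕ} (hn : n = m + 2 * l) (ht : t < l) {p q : Fin n}
    (hp : p.val = m + 2 * t) (hq : q.val = m + 2 * t + 1) :
    ∃ y, eStairBr R δ n n l = y * E p q := by
  obtain ⟨y, hy⟩ := exists_list_prod_eq_mul (A.commute_brE_eStairBr_factors hE (by omega)) ht
  exact ⟨y, by rw [eStairBr, hy, brE_eq_of_val hE (p := p) (q := q) (by omega) (by omega)]⟩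

lemma exists_eStairBr_eq_mul_mul (A : ArcSystem δ π E)
    (hE : ∀ j (h1 : 1 ≤ j) (h2 : j < n), brE R δ n j = E ⟨j - 1, by omega⟩ ⟨j, h2⟩)
    {l m t u : ℕ} (hn : n = m + 2 * l) (ht : t < l) (hu : u < l)
    (htu : t ≠ u) {p q r s : Fin n} (hp : p.val = m + 2 * t) (hq : q.val = m + 2 * t + 1)
    (hr : r.val = m + 2 * u) (hs : s.val = m + 2 * u + 1) :
    ∃ y, eStairBr R δ n n l = y * (E p q * E r s) := by
  obtain ⟨y, hy⟩ := exists_list_prod_eq_mul_mul (A.commute_brE_eStairBr_factors hE (by omega))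
    ht hu htu
  exact ⟨y, by rw [eStairBr, hy, brE_eq_of_val hE (p := p) (q := q) (by omega) (by omega),
    brE_eq_of_val hE (p := r) (q := s) (by omega) (by omega)]⟩

end ArcSystem

end CellGenerator

/-! ### The right ideal generated by a cell generator, as a permutation module -/

namespace Cfg

section Stabilizer

variable {n : ℕ}

lemma act_eq_self {c : Cfg n} (hc : IsValid n c) {g : Equiv.Perm (Fin n)}
    (h : ∀ r, g r ≠ r → ∃ r', c r = Slot.arc r' ∧ c (g r) = Slot.arc (g r')) : act c g = c := by
  ext r
  by_cases hr : g r = r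
  · rcases hcr : c r with _ | j | r'
    · exact act_of_absent (by rw [hr, hcr])
    · exact act_of_row (by rw [hr, hcr])
    · apply act_of_arc
      rw [hr]
      by_cases hr' : g r' = r'
      · rw [hr', hcr]
      · obtain ⟨r'', h1, h2⟩ := h r' hr'
        have h3 := (hc.arc_symm _ _ hcr).1
        rw [h1, Slot.arc.injEq] at h3
        rw [h3, hr] at h2
        exact (hc.arc_symm _ _ h2).1
  · obtain ⟨r', h1, h2⟩ := h r hr
    rw [h1]
    exact act_of_arc h2

lemma act_swap {c : Cfg n} (hc : IsValid n c) {p q : Fin n} (h : c p = Slot.arc q) :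
    act c (Equiv.swap p q) = c := by
  apply act_eq_self hc
  intro r hr
  have h' := (hc.arc_symm _ _ h).1
  by_cases h1 : r = p
  · subst h1; exact ⟨q, h, by rw [Equiv.swap_apply_left, Equiv.swap_apply_right, h']⟩
  by_cases h2 : r = q
  · subst h2; exact ⟨p, h', by rw [Equiv.swap_apply_left, Equiv.swap_apply_right, h]⟩
  · exact absurd (Equiv.swap_apply_of_ne_of_ne h1 h2) hr

lemma act_swap_mul_swap {c : Cfg n} (hc : IsValid n c) {p q r s : Fin n} (h : c p = Slot.arc q)
    (h' : c r = Slot.arc s) (hpr : p ≠ r) (hps : p ≠ s) (hqr : q ≠ r) (hqs : q ≠ s) :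
    act c (Equiv.swap p r * Equiv.swap q s) = c := by
  have hqp := (hc.arc_symm _ _ h).2
  have hsr := (hc.arc_symm _ _ h').2
  have h2 := (hc.arc_symm _ _ h).1
  have h2' := (hc.arc_symm _ _ h').1
  have e1 : (Equiv.swap p r * Equiv.swap q s) p = r := by
    rw [Equiv.Perm.mul_apply, Equiv.swap_apply_of_ne_of_ne hqp.symm hps, Equiv.swap_apply_left]
  have e2 : (Equiv.swap p r * Equiv.swap q s) q = s := by
    rw [Equiv.Perm.mul_apply, Equiv.swap_apply_left, Equiv.swap_apply_of_ne_of_ne hps.symm hsr]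
  have e3 : (Equiv.swap p r * Equiv.swap q s) r = p := by
    rw [Equiv.Perm.mul_apply, Equiv.swap_apply_of_ne_of_ne hqr.symm hsr.symm,
      Equiv.swap_apply_right]
  have e4 : (Equiv.swap p r * Equiv.swap q s) s = q := by
    rw [Equiv.Perm.mul_apply, Equiv.swap_apply_right, Equiv.swap_apply_of_ne_of_ne hqp hqr]
  apply act_eq_self hc
  intro x hx
  by_cases x1 : x = p
  · subst x1; exact ⟨q, h, by rw [e1, e2, h']⟩
  by_cases x2 : x = q
  · subst x2; exact ⟨p, h2, by rw [e1, e2, h2']⟩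
  by_cases x3 : x = r
  · subst x3; exact ⟨s, h', by rw [e3, e4, h]⟩
  by_cases x4 : x = s
  · subst x4; exact ⟨r, h2', by rw [e3, e4, h2]⟩
  · refine absurd ?_ hx
    rw [Equiv.Perm.mul_apply, Equiv.swap_apply_of_ne_of_ne x2 x4,
      Equiv.swap_apply_of_ne_of_ne x1 x3]

/-- From the point `m` on, the configuration consists of the standard arcs. -/
def StdFrom (m : ℕ) (c : Cfg n) : Prop :=
  ∀ t (p q : Fin n), p.val = m + 2 * t → q.val = m + 2 * t + 1 → c p = Slot.arc q

lemma StdFrom.std (μ : YoungDiagram) (m : ℕ) : StdFrom m (std n μ m n) :=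
  fun _ _ q hp hq => (std_arc hp hq (by omega)).1

lemma StdFrom.exists_arc {m l : ℕ} (hn : n = m + 2 * l) {c : Cfg n} (hc : IsValid n c)
    (h : StdFrom m c) {p : Fin n} (hp : m ≤ p.val) : ∃ q : Fin n, m ≤ q.val ∧ c p = Slot.arc q := by
  rcases cases_std hn p.val with h1 | h1 | ⟨t, ht, h1 | h1⟩
  · omega
  · omega
  · exact ⟨⟨m + 2 * t + 1, by omega⟩, by simp only; omega, h t _ _ h1 rfl⟩
  · exact ⟨⟨m + 2 * t, by omega⟩, by simp only; omega,
      (hc.arc_symm _ _ (h t ⟨m + 2 * t, by omega⟩ p rfl h1)).1⟩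

lemma StdFrom.act {m : ℕ} {c : Cfg n} (h : StdFrom m c) {g : Equiv.Perm (Fin n)}
    (hg : FixesFrom m g) : StdFrom m (act c g) := by
  intro t p q hp hq
  apply act_of_arc
  rw [hg p (by omega), hg q (by omega)]
  exact h t p q hp hq

lemma StdFrom.ext {m l : ℕ} (hn : n = m + 2 * l) {c d : Cfg n} (hc : IsValid n c)
    (hd : IsValid n d) (h : StdFrom m c) (h' : StdFrom m d)
    (hcd : ∀ p : Fin n, p.val < m → c p = d p) : c = d := by
  funext p
  rcases cases_std hn p.val with h1 | h1 | ⟨t, ht, h1 | h1⟩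
  · exact hcd p h1
  · omega
  · rw [h t p ⟨m + 2 * t + 1, by omega⟩ h1 rfl, h' t p ⟨m + 2 * t + 1, by omega⟩ h1 rfl]
  · rw [(hc.arc_symm _ _ (h t ⟨m + 2 * t, by omega⟩ p rfl h1)).1,
      (hd.arc_symm _ _ (h' t ⟨m + 2 * t, by omega⟩ p rfl h1)).1]

end Stabilizer

end Cfg

section RowStabilizer

variable {n : ℕ}

lemma rowOfNum_le (μ : YoungDiagram) (k : ℕ) : rowOfNum μ k ≤ k :=
  (Finset.card_filter_le _ _).trans (Finset.card_range k).le

lemma applyPerm_succ (v : Equiv.Perm (Fin n)) (k : Fin n) :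
    applyPerm n v (k.val + 1) = (v k).val + 1 := by
  rw [applyPerm, dif_pos (by omega)]
  simp

lemma mem_RowStab_iff {μ : YoungDiagram} {l : ℕ} (hn : n = μ.card + 2 * l)
    {v : Equiv.Perm (Fin n)} : v ∈ RowStab n μ ↔
      FixesFrom μ.card v ∧ Cfg.act (Cfg.std n μ μ.card n) v = Cfg.std n μ μ.card n := by
  simp only [RowStab, Finset.mem_filter, Finset.mem_univ, true_and, applyPerm_succ]
  constructor
  · intro h
    have hv : FixesFrom μ.card v := by
      intro p hp
      have h1 := h p
      rw [rowOfNum_of_card_lt (k := p.val + 1) (by omega)] at h1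
      have h2 := rowOfNum_le μ ((v p).val + 1)
      rw [rowOfNum_of_card_lt (by omega)] at h1
      ext; omega
    refine ⟨hv, ((Cfg.StdFrom.std μ μ.card).act hv).ext hn ((Cfg.std_isValid hn le_rfl).act v)
      (Cfg.std_isValid hn le_rfl) (Cfg.StdFrom.std μ μ.card) fun p hp => ?_⟩
    rw [Cfg.std_row hp, Cfg.act_eq_row_iff, Cfg.std_row (hv.lt hp), h p]
  · rintro ⟨hv, h⟩ k
    by_cases hk : k.val < μ.card
    · have := congrFun h k
      rw [Cfg.std_row hk, Cfg.act_eq_row_iff, Cfg.std_row (hv.lt hk), Slot.row.injEq] at this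
      exact this
    · rw [hv k (by omega)]

lemma RowStab_mul_mem {μ : YoungDiagram} {v w : Equiv.Perm (Fin n)} (hv : v ∈ RowStab n μ)
    (hw : w ∈ RowStab n μ) : v * w ∈ RowStab n μ := by
  simp only [RowStab, Finset.mem_filter, Finset.mem_univ, true_and, applyPerm_succ] at *
  intro k
  rw [Equiv.Perm.mul_apply, hv, hw]

lemma RowStab_inv_mem {μ : YoungDiagram} {v : Equiv.Perm (Fin n)} (hv : v ∈ RowStab n μ) :
    v⁻¹ ∈ RowStab n μ := by
  simp only [RowStab, Finset.mem_filter, Finset.mem_univ, true_and, applyPerm_succ] at *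
  intro k
  rw [← hv]
  simp

end RowStabilizer

section CellGen

variable {R : Type} [CommRing R] {δ : R} {n : ℕ} (π : Equiv.Perm (Fin n) →* Brauer R δ n)

/-- The cell generator, with the inverse parametrization of the permutations. -/
def cellGen (μ : YoungDiagram) (l : ℕ) : Brauer R δ n :=
  (∑ v ∈ RowStab n μ, π v) * eStairBr R δ n n l

lemma cBr_eq_cellGen {sw : Equiv.Perm (Fin n) → Brauer R δ n} (hsw : ∀ v, sw v = π v⁻¹)
    (μ : YoungDiagram) (l : ℕ) : cBr R δ n sw μ l = cellGen π μ l := by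
  rw [cBr, cellGen]
  congr 1
  exact Finset.sum_bij' (fun v _ => v⁻¹) (fun v _ => v⁻¹) (fun v hv => RowStab_inv_mem hv)
    (fun v hv => RowStab_inv_mem hv) (by simp) (by simp) (fun v _ => hsw v)

variable {π}

lemma sum_RowStab_mul {μ : YoungDiagram} {h : Equiv.Perm (Fin n)} (hh : h ∈ RowStab n μ) :
    (∑ v ∈ RowStab n μ, π v) * π h = ∑ v ∈ RowStab n μ, π v := by
  rw [Finset.sum_mul]
  exact Finset.sum_bij' (fun v _ => v * h) (fun v _ => v * h⁻¹)
    (fun v hv => RowStab_mul_mem hv hh) (fun v hv => RowStab_mul_mem hv (RowStab_inv_mem hh))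
    (by simp) (by simp) (fun v _ => (map_mul _ _ _).symm)

namespace ArcSystem

variable {E : Fin n → Fin n → Brauer R δ n}

lemma eStairBr_mul_swap (A : ArcSystem δ π E)
    (hE : ∀ j (h1 : 1 ≤ j) (h2 : j < n), brE R δ n j = E ⟨j - 1, by omega⟩ ⟨j, h2⟩)
    {μ : YoungDiagram} {l m : ℕ} (hn : n = m + 2 * l) {p q : Fin n}
    (h : Cfg.std n μ m n p = Slot.arc q) :
    eStairBr R δ n n l * π (Equiv.swap p q) = eStairBr R δ n n l := by
  obtain ⟨t, ht, ⟨h1, h2⟩ | ⟨h1, h2⟩⟩ := Cfg.exists_of_std_arc hn h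
  · obtain ⟨y, hy⟩ := A.exists_eStairBr_eq_mul hE hn ht h1 h2
    rw [hy, mul_assoc, A.absorb]
  · obtain ⟨y, hy⟩ := A.exists_eStairBr_eq_mul hE hn ht h1 h2
    rw [hy, mul_assoc, Equiv.swap_comm, A.absorb]

lemma eStairBr_mul_swap_mul_swap (A : ArcSystem δ π E)
    (hE : ∀ j (h1 : 1 ≤ j) (h2 : j < n), brE R δ n j = E ⟨j - 1, by omega⟩ ⟨j, h2⟩)
    {μ : YoungDiagram} {l m : ℕ} (hn : n = m + 2 * l)
    {p q r s : Fin n} (h : Cfg.std n μ m n p = Slot.arc q) (h' : Cfg.std n μ m n r = Slot.arc s)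
    (hpr : p ≠ r) (hps : p ≠ s) (hqr : q ≠ r) (hqs : q ≠ s) :
    eStairBr R δ n n l * π (Equiv.swap p r * Equiv.swap q s) = eStairBr R δ n n l := by
  have hv := Cfg.std_isValid (μ := μ) hn le_rfl
  have hpq := (hv.arc_symm _ _ h).2.symm
  have hrs := (hv.arc_symm _ _ h').2.symm
  obtain ⟨t, ht, h1⟩ := Cfg.exists_of_std_arc hn h
  obtain ⟨u, hu, h2⟩ := Cfg.exists_of_std_arc hn h'
  have htu : t ≠ u := by
    rintro rfl
    rcases h1 with ⟨h1, -⟩ | ⟨-, h1⟩ <;> rcases h2 with ⟨h2, h3⟩ | ⟨h3, h2⟩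
    · exact hpr (by ext; omega)
    · exact hps (by ext; omega)
    · exact hps (by ext; omega)
    · exact hpr (by ext; omega)
  have key : ∃ y, eStairBr R δ n n l = y * (E p q * E r s) := by
    rcases h1 with ⟨h1, h1'⟩ | ⟨h1, h1'⟩ <;> rcases h2 with ⟨h2, h2'⟩ | ⟨h2, h2'⟩
    · exact A.exists_eStairBr_eq_mul_mul hE hn ht hu htu h1 h1' h2 h2'
    · rw [A.symm r s]; exact A.exists_eStairBr_eq_mul_mul hE hn ht hu htu h1 h1' h2 h2'
    · rw [A.symm p q]; exact A.exists_eStairBr_eq_mul_mul hE hn ht hu htu h1 h1' h2 h2'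
    · rw [A.symm p q, A.symm r s]
      exact A.exists_eStairBr_eq_mul_mul hE hn ht hu htu h1 h1' h2 h2'
  obtain ⟨y, hy⟩ := key
  rw [hy, mul_assoc, A.block_swap hpq hpr hps hqr hqs hrs]

/-- The stabilizer of the standard configuration fixes the cell generator. -/
theorem cellGen_mul (A : ArcSystem δ π E)
    (hE : ∀ j (h1 : 1 ≤ j) (h2 : j < n), brE R δ n j = E ⟨j - 1, by omega⟩ ⟨j, h2⟩)
    {μ : YoungDiagram} {l : ℕ} (hn : n = μ.card + 2 * l)
    {h : Equiv.Perm (Fin n)}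
    (hh : Cfg.act (Cfg.std n μ μ.card n) h = Cfg.std n μ μ.card n) :
    cellGen π μ l * π h = cellGen π μ l := by
  have hv := Cfg.std_isValid (μ := μ) hn le_rfl
  have key : ∀ d ≤ l, ∀ h : Equiv.Perm (Fin n), FixesFrom (μ.card + 2 * d) h →
      Cfg.act (Cfg.std n μ μ.card n) h = Cfg.std n μ μ.card n →
      cellGen π μ l * π h = cellGen π μ l := by
    intro d hd
    induction d with
    | zero =>
      intro h hf hh
      rw [cellGen, mul_assoc, ← (A.commute_perm_eStairBr hE hn hf).eq, ← mul_assoc,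
        sum_RowStab_mul ((mem_RowStab_iff hn).mpr ⟨hf, hh⟩)]
    | succ d ih =>
      intro h hf hh
      obtain ⟨p, hp⟩ : ∃ p : Fin n, p.val = μ.card + 2 * d := ⟨⟨_, by omega⟩, rfl⟩
      obtain ⟨p', hp'⟩ : ∃ p : Fin n, p.val = μ.card + 2 * d + 1 := ⟨⟨_, by omega⟩, rfl⟩
      have hpp := (Cfg.std_arc (μ := μ) (k := n) hp hp' (by omega)).1
      have hqq : Cfg.std n μ μ.card n (h p) = Slot.arc (h p') := by
        rw [← Cfg.act_eq_arc_iff, hh, hpp]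
      suffices ∃ b : Equiv.Perm (Fin n), FixesFrom (μ.card + 2 * (d + 1)) b ∧ b (h p) = p ∧
          b (h p') = p' ∧ Cfg.act (Cfg.std n μ μ.card n) b = Cfg.std n μ μ.card n ∧
          eStairBr R δ n n l * π b = eStairBr R δ n n l by
        obtain ⟨b, b1, b2, b3, b4, b5⟩ := this
        have := ih (by omega) (b * h) (fun x hx => ?_) (by rw [Cfg.act_mul, b4, hh])
        · rwa [map_mul, ← mul_assoc, cellGen, mul_assoc (Finset.sum _ _), b5] at this
        · by_cases x1 : x = p
          · rw [x1, Equiv.Perm.mul_apply, b2]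
          by_cases x2 : x = p'
          · rw [x2, Equiv.Perm.mul_apply, b3]
          · refine b1.mul hf x ?_
            have : x.val ≠ p.val := fun h => x1 (Fin.ext h)
            have : x.val ≠ p'.val := fun h => x2 (Fin.ext h)
            omega
      have l1 := hf.lt (p := p) (by omega)
      have l2 := hf.lt (p := p') (by omega)
      by_cases c1 : h p = p
      · refine ⟨1, FixesFrom.one, c1, ?_, Cfg.act_one _, by rw [map_one, mul_one]⟩
        rw [c1, hpp, Slot.arc.injEq] at hqq
        exact hqq.symm
      by_cases c2 : h p = p'
      · have c3 : h p' = p := by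
          rw [c2, (hv.arc_symm _ _ hpp).1, Slot.arc.injEq] at hqq
          exact hqq.symm
        refine ⟨Equiv.swap p p', fun x hx => ?_, by simp [c2], by simp [c3], Cfg.act_swap hv hpp,
          A.eStairBr_mul_swap hE hn hpp⟩
        apply Equiv.swap_apply_of_ne_of_ne <;> (rintro rfl; omega)
      have c3 : h p' ≠ p := fun h' => c2 (by
        rw [h'] at hqq
        have := (hv.arc_symm _ _ hqq).1
        rw [hpp, Slot.arc.injEq] at this
        exact this.symm)
      have c4 : h p' ≠ p' := fun h' => c1 (by
        rw [h'] at hqq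
        have := (hv.arc_symm _ _ hqq).1
        rw [(hv.arc_symm _ _ hpp).1, Slot.arc.injEq] at this
        exact this.symm)
      have c5 : p ≠ p' := fun h => by rw [h] at hp; omega
      refine ⟨Equiv.swap (h p) p * Equiv.swap (h p') p', fun x hx => ?_, ?_, ?_,
        Cfg.act_swap_mul_swap hv hqq hpp c1 c2 c3 c4,
        A.eStairBr_mul_swap_mul_swap hE hn hqq hpp c1 c2 c3 c4⟩
      · rw [Equiv.Perm.mul_apply, Equiv.swap_apply_of_ne_of_ne (a := h p')
          (by rintro rfl; omega) (by rintro rfl; omega), Equiv.swap_apply_of_ne_of_ne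
          (by rintro rfl; omega) (by rintro rfl; omega)]
      · rw [Equiv.Perm.mul_apply, Equiv.swap_apply_of_ne_of_ne (a := h p')
          (fun h' => c5 (h.injective h')) c2, Equiv.swap_apply_left]
      · rw [Equiv.Perm.mul_apply, Equiv.swap_apply_left, Equiv.swap_apply_of_ne_of_ne
          (fun h' => c2 h'.symm) c5.symm]
  exact key l le_rfl h (fun p hp => by omega) hh

end ArcSystem

open scoped Classical in
/-- The homomorphism from configurations that sends the standard configuration to the cell
generator and kills all configurations of a different type. -/
def theta (π : Equiv.Perm (Fin n) →* Brauer R δ n) (μ : YoungDiagram) (l : ℕ) :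
    (Cfg n →₀ R) →ₗ[R] Brauer R δ n :=
  Finsupp.linearCombination R fun c =>
    if h : ∃ w, Cfg.act (Cfg.std n μ μ.card n) w = c then cellGen π μ l * π h.choose else 0

variable {E : Fin n → Fin n → Brauer R δ n}

lemma theta_act_std (A : ArcSystem δ π E)
    (hE : ∀ j (h1 : 1 ≤ j) (h2 : j < n), brE R δ n j = E ⟨j - 1, by omega⟩ ⟨j, h2⟩)
    {μ : YoungDiagram} {l : ℕ} (hn : n = μ.card + 2 * l)
    (w : Equiv.Perm (Fin n)) :
    theta π μ l (Finsupp.single (Cfg.act (Cfg.std n μ μ.card n) w) 1) = cellGen π μ l * π w := by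
  have h : ∃ w', Cfg.act (Cfg.std n μ μ.card n) w' = Cfg.act (Cfg.std n μ μ.card n) w := ⟨w, rfl⟩
  rw [theta, Finsupp.linearCombination_single, one_smul, dif_pos h]
  have h1 := A.cellGen_mul hE hn (h := h.choose * w⁻¹) (by
    rw [Cfg.act_mul, h.choose_spec, ← Cfg.act_mul, mul_inv_cancel, Cfg.act_one])
  calc _ = cellGen π μ l * π (h.choose * w⁻¹) * π w := by
        rw [mul_assoc, ← map_mul, inv_mul_cancel_right]
    _ = _ := by rw [h1]

lemma theta_std (A : ArcSystem δ π E)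
    (hE : ∀ j (h1 : 1 ≤ j) (h2 : j < n), brE R δ n j = E ⟨j - 1, by omega⟩ ⟨j, h2⟩)
    {μ : YoungDiagram} {l : ℕ} (hn : n = μ.card + 2 * l) :
    theta π μ l (Finsupp.single (Cfg.std n μ μ.card n) 1) = cellGen π μ l := by
  have := theta_act_std A hE hn 1
  rwa [Cfg.act_one, map_one, mul_one] at this

lemma theta_equivariant (A : ArcSystem δ π E)
    (hE : ∀ j (h1 : 1 ≤ j) (h2 : j < n), brE R δ n j = E ⟨j - 1, by omega⟩ ⟨j, h2⟩)
    {μ : YoungDiagram} {l : ℕ} (hn : n = μ.card + 2 * l) :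
    Cfg.Equivariant π n (theta π μ l) := by
  intro c g _
  by_cases h : ∃ w, Cfg.act (Cfg.std n μ μ.card n) w = c
  · obtain ⟨w, rfl⟩ := h
    rw [← Cfg.act_mul, theta_act_std A hE hn, theta_act_std A hE hn, map_mul, mul_assoc]
  · have h' : ¬ ∃ w, Cfg.act (Cfg.std n μ μ.card n) w = Cfg.act c g := by
      rintro ⟨w, hw⟩
      exact h ⟨w * g⁻¹, by rw [Cfg.act_mul, hw, ← Cfg.act_mul, mul_inv_cancel, Cfg.act_one]⟩
    rw [theta, Finsupp.linearCombination_single, Finsupp.linearCombination_single, dif_neg h,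
      dif_neg h', smul_zero, zero_mul]

end CellGen

/-! ### Moving configurations into standard position -/

lemma Antitone.sum_le_sum_range_card {f : ℕ → ℕ} (hf : Antitone f) (s : Finset ℕ) :
    ∑ i ∈ s, f i ≤ ∑ i ∈ Finset.range s.card, f i := by
  induction s using Finset.induction_on_max with
  | empty => simp
  | insert a s ha ih =>
    have hna : a ∉ s := fun h => lt_irrefl a (ha a h)
    rw [Finset.sum_insert hna, Finset.card_insert_of_notMem hna, Finset.sum_range_succ, add_comm]
    have : s.card ≤ a := by
      have := Finset.card_le_card (fun x hx => Finset.mem_range.mpr (ha x hx) : s ⊆ Finset.range a)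
      rwa [Finset.card_range] at this
    exact add_le_add ih (hf this)

lemma exists_perm_antitone {α : ℕ → ℕ} {N : ℕ} (hN : ∀ i, N ≤ i → α i = 0) :
    ∃ σ : Equiv.Perm ℕ, Antitone (α ∘ σ) ∧ ∀ i, N ≤ i → σ i = i := by
  let f : Fin N → ℕᵒᵈ := fun i => OrderDual.toDual (α i)
  let σ := (Tuple.sort f).extendDomain (Fin.equivSubtype (n := N))
  have h1 : ∀ i (hi : i < N), σ i = (Tuple.sort f ⟨i, hi⟩).val := fun i hi => by
    rw [show σ i = _ from Equiv.Perm.extendDomain_apply_subtype (p := (· < N)) _ _ hi]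
    rfl
  have h2 : ∀ i, N ≤ i → σ i = i := fun i hi =>
    Equiv.Perm.extendDomain_apply_not_subtype _ _ (by omega)
  refine ⟨σ, fun i j hij => ?_, h2⟩
  by_cases hj : j < N
  · have := Tuple.monotone_sort f (a := ⟨i, by omega⟩) (b := ⟨j, hj⟩) (by simpa using hij)
    rw [Function.comp_apply, Function.comp_apply, h1 j hj, h1 i (by omega)]
    exact this
  · rw [Function.comp_apply, h2 j (by omega), hN j (by omega)]
    exact Nat.zero_le _

namespace Cfg

section Transport

variable {n : ℕ}

open scoped Classical in
/-- The points labelled by a row. -/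
def rowPoints (c : Cfg n) : Finset (Fin n) := Finset.univ.filter fun p => ∃ j, c p = Slot.row j

lemma mem_rowPoints {c : Cfg n} {p : Fin n} : p ∈ rowPoints c ↔ ∃ j, c p = Slot.row j := by
  simp [rowPoints]

lemma card_rowPoints {c : Cfg n} {N : ℕ} (hN : ∀ i, N ≤ i → wt c i = 0) :
    (rowPoints c).card = ∑ i ∈ Finset.range N, wt c i := by
  classical
  have : rowPoints c = (Finset.range N).biUnion (rowSet c) := by
    ext p
    rw [mem_rowPoints, Finset.mem_biUnion]
    constructor
    · rintro ⟨j, hj⟩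
      refine ⟨j, ?_, mem_rowSet.mpr hj⟩
      rw [Finset.mem_range]
      by_contra! h
      have := hN j h
      rw [wt, Finset.card_eq_zero] at this
      have h' := mem_rowSet.mpr hj
      rw [this] at h'
      simp at h'
    · rintro ⟨j, _, hj⟩
      exact ⟨j, mem_rowSet.mp hj⟩
  rw [this, Finset.card_biUnion]
  · rfl
  · intro i _ j _ hij
    refine Finset.disjoint_left.mpr fun p h1 h2 => ?_
    rw [mem_rowSet] at h1 h2
    rw [h1, Slot.row.injEq] at h2
    exact hij h2

lemma card_rowPoints_act (c : Cfg n) (g : Equiv.Perm (Fin n)) :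
    (rowPoints (act c g)).card = (rowPoints c).card := by
  have : (rowPoints (act c g)).map g.toEmbedding = rowPoints c := by
    ext p
    simp only [Finset.mem_map_equiv, mem_rowPoints, act_eq_row_iff, Equiv.apply_symm_apply]
  rw [← this, Finset.card_map]

lemma exists_stdFrom {c : Cfg n} (hc : IsValid n c) {l : ℕ} (hn : n = (rowPoints c).card + 2 * l) :
    ∃ u, StdFrom (rowPoints c).card (act c u) := by
  set m := (rowPoints c).card with hm
  have key : ∀ d ≤ l, ∃ u, StdFrom (m + 2 * (l - d)) (act c u) := by
    intro d hd
    induction d with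
    | zero => exact ⟨1, fun t p q hp hq => by omega⟩
    | succ d ih =>
      obtain ⟨u, hu⟩ := ih (by omega)
      obtain ⟨k, hk⟩ : ∃ k, l - d = k + 1 := ⟨l - d - 1, by omega⟩
      have hk' : l - (d + 1) = k := by omega
      rw [hk] at hu
      rw [hk']
      have hv := hc.act u
      have hn' : n = m + 2 * (k + 1) + 2 * d := by omega
      obtain ⟨p, q, hp, hpq⟩ : ∃ p q : Fin n, p.val < m + 2 * (k + 1) ∧
          act c u p = Slot.arc q := by
        by_contra! hno
        have hsub : (Finset.univ : Finset (Fin (m + 2 * (k + 1)))).map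
            (Fin.castLEEmb (by omega : m + 2 * (k + 1) ≤ n)) ⊆ rowPoints (act c u) := by
          intro p hp
          rw [Finset.mem_map] at hp
          obtain ⟨p, -, rfl⟩ := hp
          rw [mem_rowPoints]
          rcases h : act c u (Fin.castLEEmb (by omega : m + 2 * (k + 1) ≤ n) p) with _ | j | q
          · have h1 := (hv.absent_iff _).mp h
            have h2 := p.2
            have h3 : (Fin.castLEEmb (by omega : m + 2 * (k + 1) ≤ n) p).val = p.val := rfl
            omega
          · exact ⟨j, rfl⟩
          · exact absurd h (hno _ q p.2)
        have := Finset.card_le_card hsub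
        rw [Finset.card_map, Finset.card_univ, Fintype.card_fin, card_rowPoints_act] at this
        omega
      have hqp := hv.arc_symm _ _ hpq
      have hq : q.val < m + 2 * (k + 1) := by
        by_contra! h
        obtain ⟨r, hr, h'⟩ := hu.exists_arc hn' hv h
        rw [hqp.1, Slot.arc.injEq] at h'
        rw [h'] at hp
        omega
      obtain ⟨a, ha⟩ : ∃ a : Fin n, a.val = m + 2 * k := ⟨⟨m + 2 * k, by omega⟩, rfl⟩
      obtain ⟨b, hb⟩ : ∃ b : Fin n, b.val = m + 2 * k + 1 := ⟨⟨m + 2 * k + 1, by omega⟩, rfl⟩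
      have hab : a ≠ b := fun h => by rw [h] at ha; omega
      have hf1 : FixesFrom (m + 2 * (k + 1)) (Equiv.swap a p) := fun r hr =>
        Equiv.swap_apply_of_ne_of_ne (by rintro rfl; omega) (by rintro rfl; omega)
      have hb' := hf1.lt (p := b) (by omega)
      have hf2 : FixesFrom (m + 2 * (k + 1)) (Equiv.swap (Equiv.swap a p b) q) := fun r hr =>
        Equiv.swap_apply_of_ne_of_ne (by rintro rfl; omega) (by rintro rfl; omega)
      have hf := hf2.mul hf1
      have ga : (Equiv.swap (Equiv.swap a p b) q * Equiv.swap a p) a = p := by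
        rw [Equiv.Perm.mul_apply, Equiv.swap_apply_left, Equiv.swap_apply_of_ne_of_ne _ hqp.2.symm]
        intro h
        exact hab ((Equiv.swap a p).injective (by rw [Equiv.swap_apply_left, ← h]))
      have gb : (Equiv.swap (Equiv.swap a p b) q * Equiv.swap a p) b = q := by
        rw [Equiv.Perm.mul_apply, Equiv.swap_apply_left]
      refine ⟨u * (Equiv.swap (Equiv.swap a p b) q * Equiv.swap a p), fun t r s hr hs => ?_⟩
      rw [act_mul]
      rcases t with _ | t
      · obtain rfl : r = a := by ext; omega
        obtain rfl : s = b := by ext; omega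
        apply act_of_arc
        rw [ga, gb, hpq]
      · exact hu.act hf t r s (by omega) (by omega)
  obtain ⟨u, hu⟩ := key l le_rfl
  rw [Nat.sub_self] at hu
  exact ⟨u, hu⟩

lemma StdFrom.exists_row {c : Cfg n} {l : ℕ} (hn : n = (rowPoints c).card + 2 * l)
    (hc : IsValid n c) (h : StdFrom (rowPoints c).card c) {p : Fin n}
    (hp : p.val < (rowPoints c).card) : ∃ j, c p = Slot.row j := by
  set m := (rowPoints c).card with hm
  have hsub : rowPoints c ⊆ (Finset.univ : Finset (Fin m)).map
      (Fin.castLEEmb (by omega : m ≤ n)) := by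
    intro q hq
    obtain ⟨j, hj⟩ := mem_rowPoints.mp hq
    rw [Finset.mem_map]
    refine ⟨⟨q, ?_⟩, Finset.mem_univ _, rfl⟩
    by_contra! hq'
    obtain ⟨r, _, hr⟩ := h.exists_arc hn hc hq'
    simp [hr] at hj
  have := Finset.eq_of_subset_of_card_le hsub (by rw [Finset.card_map]; simp [← hm])
  rw [← mem_rowPoints, this, Finset.mem_map]
  exact ⟨⟨p, hp⟩, Finset.mem_univ _, rfl⟩

lemma exists_fixesFrom_act_eq {c d : Cfg n} {l m : ℕ} (hn : n = m + 2 * l) (hc : IsValid n c)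
    (hd : IsValid n d) (hcs : StdFrom m c) (hds : StdFrom m d)
    (hcr : (rowPoints c).card = m) (hdr : (rowPoints d).card = m)
    (hw : ∀ i, wt c i = wt d i) : ∃ v, FixesFrom m v ∧ act c v = d := by
  classical
  let f : Cfg n → Fin n → Slot n := fun c p => if p.val < m then c p else Slot.arc p
  have hrow : ∀ {c : Cfg n}, IsValid n c → StdFrom m c → (rowPoints c).card = m →
      ∀ p : Fin n, p.val < m → ∃ j, c p = Slot.row j := by
    intro c hc h hr p hp
    subst hr
    exact h.exists_row hn hc hp
  have hfib : ∀ {c : Cfg n}, IsValid n c → StdFrom m c → (rowPoints c).card = m →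
      ∀ x, Fintype.card {p // f c p = x} = match x with
        | Slot.absent => 0
        | Slot.row j => wt c j
        | Slot.arc q => if q.val < m then 0 else 1 := by
    intro c hc h hr x
    rw [Fintype.card_subtype]
    rcases x with _ | j | q
    · simp only [Finset.card_eq_zero, Finset.filter_eq_empty_iff, Finset.mem_univ, true_imp_iff]
      intro p hp
      simp only [f] at hp
      split_ifs at hp with hpm
      obtain ⟨j, hj⟩ := hrow hc h hr p hpm
      simp [hj] at hp
    · simp only [wt]
      congr 1
      ext p
      simp only [Finset.mem_filter, Finset.mem_univ, true_and, mem_rowSet, f]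
      split_ifs with hpm
      · rfl
      · obtain ⟨q, _, hq⟩ := h.exists_arc hn hc (p := p) (by omega)
        simp [hq]
    · simp only
      split_ifs with hq
      · rw [Finset.card_eq_zero, Finset.filter_eq_empty_iff]
        intro p _ hp
        simp only [f] at hp
        split_ifs at hp with hpm
        · obtain ⟨j, hj⟩ := hrow hc h hr p hpm
          simp [hj] at hp
        · rw [Slot.arc.injEq] at hp
          rw [hp] at hpm
          exact hpm hq
      · rw [Finset.card_eq_one]
        refine ⟨q, ?_⟩
        ext p
        simp only [Finset.mem_filter, Finset.mem_univ, true_and, Finset.mem_singleton, f]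
        split_ifs with hpm
        · obtain ⟨j, hj⟩ := hrow hc h hr p hpm
          simp only [hj, reduceCtorEq, false_iff]
          rintro rfl
          exact hq hpm
        · simp
  have hfc := hfib hc hcs hcr
  have hfd := hfib hd hds hdr
  have heq : ∀ x, Fintype.card {p // f d p = x} = Fintype.card {p // f c p = x} := by
    intro x
    rw [hfc, hfd]
    rcases x with _ | j | q
    · rfl
    · exact (hw j).symm
    · rfl
  let v := Equiv.ofFiberEquiv fun x => Fintype.equivOfCardEq (heq x)
  have hv : ∀ p, f c (v p) = f d p := fun p => Equiv.ofFiberEquiv_map _ p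
  have hfix : FixesFrom m v := by
    intro p hp
    have := hv p
    simp only [f, if_neg (not_lt.mpr hp)] at this
    split_ifs at this with hpm
    · obtain ⟨j, hj⟩ := hrow hc hcs hcr _ hpm
      simp [hj] at this
    · rwa [Slot.arc.injEq] at this
  refine ⟨v, hfix, (hcs.act hfix).ext hn (hc.act v) hd hds fun p hp => ?_⟩
  obtain ⟨j, hj⟩ := hrow hd hds hdr p hp
  have := hv p
  simp only [f, if_pos hp, if_pos (hfix.lt hp)] at this
  rw [hj] at this ⊢
  rwa [act_eq_row_iff]

/-- Rename the rows. -/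
def mapRows (σ : ℕ → ℕ) (c : Cfg n) : Cfg n := fun p =>
  match c p with
  | Slot.absent => Slot.absent
  | Slot.row j => Slot.row (σ j)
  | Slot.arc q => Slot.arc q

lemma mapRows_act (σ : ℕ → ℕ) (c : Cfg n) (g : Equiv.Perm (Fin n)) :
    mapRows σ (act c g) = act (mapRows σ c) g := by
  funext p
  simp only [mapRows, act]
  cases c (g p) <;> rfl

lemma mapRows_arc {σ : ℕ → ℕ} {c : Cfg n} {p q : Fin n} :
    mapRows σ c p = Slot.arc q ↔ c p = Slot.arc q := by
  simp only [mapRows]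
  cases c p <;> simp

lemma mapRows_row (σ : Equiv.Perm ℕ) {c : Cfg n} {p : Fin n} {j : ℕ} :
    mapRows σ c p = Slot.row j ↔ c p = Slot.row (σ⁻¹ j) := by
  simp only [mapRows]
  cases c p <;> simp [Equiv.eq_symm_apply]

lemma mapRows_absent {σ : ℕ → ℕ} {c : Cfg n} {p : Fin n} :
    mapRows σ c p = Slot.absent ↔ c p = Slot.absent := by
  simp only [mapRows]
  cases c p <;> simp

lemma mapRows_injective (σ : Equiv.Perm ℕ) : Function.Injective (mapRows (n := n) σ) := by
  intro c d h
  funext p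
  rcases hd : d p with _ | j | q
  · rw [← mapRows_absent (σ := σ), h, mapRows_absent, hd]
  · have := congrFun h p
    rw [(mapRows_row σ (c := d) (j := σ j)).mpr (by simp [hd]), mapRows_row] at this
    simpa using this
  · rw [← mapRows_arc (σ := σ), h, mapRows_arc, hd]

lemma wt_mapRows (σ : Equiv.Perm ℕ) (c : Cfg n) (j : ℕ) : wt (mapRows σ c) j = wt c (σ⁻¹ j) := by
  simp only [wt]
  congr 1
  ext p
  rw [mem_rowSet, mem_rowSet, mapRows_row]

lemma IsValid.mapRows {k : ℕ} {c : Cfg n} (hc : IsValid k c) (σ : ℕ → ℕ) :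
    IsValid k (mapRows σ c) :=
  ⟨fun p => by rw [mapRows_absent, hc.absent_iff], fun p q h => by
    rw [mapRows_arc] at h ⊢
    exact hc.arc_symm p q h⟩

lemma card_rowPoints_mapRows (σ : Equiv.Perm ℕ) (c : Cfg n) :
    (rowPoints (mapRows σ c)).card = (rowPoints c).card := by
  congr 1
  ext p
  simp only [mem_rowPoints, mapRows_row]
  exact ⟨fun ⟨j, hj⟩ => ⟨_, hj⟩, fun ⟨j, hj⟩ => ⟨σ j, by simpa using hj⟩⟩

lemma StdFrom.mapRows {m : ℕ} {c : Cfg n} (h : StdFrom m c) (σ : ℕ → ℕ) :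
    StdFrom m (mapRows σ c) := fun t p q hp hq => mapRows_arc.mpr (h t p q hp hq)

lemma card_rowPoints_std {μ : YoungDiagram} (hn : μ.card ≤ n) :
    (rowPoints (std n μ μ.card n)).card = μ.card := by
  rw [card_rowPoints (N := μ.card), Finset.sum_congr rfl fun i _ => wt_std hn le_rfl i,
    μ.sum_rowLen_of_le le_rfl]
  intro i hi
  rw [wt_std hn le_rfl, μ.rowLen_eq_zero_of_card_le hi]

end Transport

end Cfg

/-! ### Vanishing modulo higher cells -/

section HigherCells

lemma exists_sum_eq_mul_sum {G : Type*} [Group G] [DecidableEq G] {B : Type*} [Semiring B]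
    (π : G →* B) {H : Finset G} (h1 : 1 ∈ H) (hinv : ∀ g ∈ H, g⁻¹ ∈ H)
    (hmul : ∀ g ∈ H, ∀ h ∈ H, g * h ∈ H) (V : Finset G) (hV : ∀ v ∈ V, ∀ h ∈ H, v * h ∈ V) :
    ∃ a, ∑ v ∈ V, π v = a * ∑ h ∈ H, π h := by
  induction hc : V.card using Nat.strong_induction_on generalizing V with
  | _ k ih =>
    rcases V.eq_empty_or_nonempty with rfl | ⟨v, hv⟩
    · exact ⟨0, by simp⟩
    · have hsub : H.image (v * ·) ⊆ V := fun x hx => by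
        obtain ⟨h, hh, rfl⟩ := Finset.mem_image.mp hx
        exact hV v hv h hh
      have hlt : (V \ H.image (v * ·)).card < k := by
        rw [← hc]
        apply Finset.card_lt_card
        refine ⟨Finset.sdiff_subset, fun h => ?_⟩
        have := h hv
        rw [Finset.mem_sdiff] at this
        exact this.2 (Finset.mem_image.mpr ⟨1, h1, mul_one v⟩)
      obtain ⟨a, ha⟩ := ih _ hlt (V \ H.image (v * ·)) (fun w hw h hh => by
        rw [Finset.mem_sdiff] at hw ⊢
        refine ⟨hV w hw.1 h hh, fun hm => hw.2 ?_⟩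
        obtain ⟨g, hg, hgw⟩ := Finset.mem_image.mp hm
        exact Finset.mem_image.mpr ⟨g * h⁻¹, hmul g hg _ (hinv h hh), by
          rw [← mul_assoc, hgw, mul_inv_cancel_right]⟩) rfl
      refine ⟨a + π v, ?_⟩
      rw [← Finset.sum_sdiff hsub, ha, add_mul,
        Finset.sum_image (fun x _ y _ h => mul_left_cancel h),
        Finset.mul_sum, Finset.mul_sum]
      simp only [map_mul]

variable {R : Type} [CommRing R] {δ : R} {n : ℕ} (π : Equiv.Perm (Fin n) →* Brauer R δ n)

/-- The two-sided ideal generated by the cell generators above a given label. -/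
def aboveSpan (x : YoungDiagram × ℕ) : Submodule R (Brauer R δ n) :=
  Submodule.span R {y | ∃ (z : YoungDiagram × ℕ) (a b : Brauer R δ n),
    n = z.1.card + 2 * z.2 ∧ wGT z x ∧ y = a * cellGen π z.1 z.2 * b}

variable {π}

lemma mem_aboveSpan {x z : YoungDiagram × ℕ} (hz : n = z.1.card + 2 * z.2) (h : wGT z x)
    (a b : Brauer R δ n) : a * cellGen π z.1 z.2 * b ∈ aboveSpan π x :=
  Submodule.subset_span ⟨z, a, b, hz, h, rfl⟩

lemma mul_mem_aboveSpan {x : YoungDiagram × ℕ} {y : Brauer R δ n} (hy : y ∈ aboveSpan π x)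
    (b : Brauer R δ n) : y * b ∈ aboveSpan π x := by
  induction hy using Submodule.span_induction with
  | mem y hy =>
    obtain ⟨z, a, c, hz, h, rfl⟩ := hy
    rw [mul_assoc]
    exact mem_aboveSpan hz h _ _
  | zero => rw [zero_mul]; exact Submodule.zero_mem _
  | add y z _ _ h1 h2 => rw [add_mul]; exact Submodule.add_mem _ h1 h2
  | smul r y _ h => rw [smul_mul_assoc]; exact Submodule.smul_mem _ r h

lemma mul_mem_aboveSpan_left {x : YoungDiagram × ℕ} {y : Brauer R δ n} (hy : y ∈ aboveSpan π x)
    (b : Brauer R δ n) : b * y ∈ aboveSpan π x := by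
  induction hy using Submodule.span_induction with
  | mem y hy =>
    obtain ⟨z, a, c, hz, h, rfl⟩ := hy
    rw [← mul_assoc, ← mul_assoc]
    exact mem_aboveSpan hz h _ _
  | zero => rw [mul_zero]; exact Submodule.zero_mem _
  | add y z _ _ h1 h2 => rw [mul_add]; exact Submodule.add_mem _ h1 h2
  | smul r y _ h => rw [mul_smul_comm]; exact Submodule.smul_mem _ r h

open Cfg

open scoped Classical in
/-- The permutations carrying the standard configuration to a configuration obtained from `c` by
moving `p` labels from the row `j` to the row `j + 1`. -/
def lowerPerms (μ : YoungDiagram) (c : Cfg n) (j p : ℕ) : Finset (Equiv.Perm (Fin n)) :=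
  ((rowSet c j).powersetCard p).biUnion fun S => Finset.univ.filter fun g =>
    FixesFrom μ.card g ∧ act (std n μ μ.card n) g = relabel c S (j + 1)

lemma mem_lowerPerms {μ : YoungDiagram} {c : Cfg n} {j p : ℕ} {g : Equiv.Perm (Fin n)} :
    g ∈ lowerPerms μ c j p ↔ ∃ S, (S ⊆ rowSet c j ∧ S.card = p) ∧ FixesFrom μ.card g ∧
      act (std n μ μ.card n) g = relabel c S (j + 1) := by
  simp only [lowerPerms, Finset.mem_biUnion, Finset.mem_powersetCard, Finset.mem_filter,
    Finset.mem_univ, true_and]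

lemma mul_mem_lowerPerms {μ : YoungDiagram} {c : Cfg n} {j p : ℕ} {g h : Equiv.Perm (Fin n)}
    (hg : g ∈ lowerPerms μ c j p) (hf : FixesFrom μ.card h) (hc : act c h = c) :
    g * h ∈ lowerPerms μ c j p := by
  rw [mem_lowerPerms] at hg ⊢
  obtain ⟨S, ⟨hS, hS'⟩, hgf, hgS⟩ := hg
  refine ⟨S.map h⁻¹.toEmbedding, ⟨?_, by rw [Finset.card_map, hS']⟩, hgf.mul hf, ?_⟩
  · have := map_rowSet_act c h⁻¹ j
    have h2 : act c h⁻¹ = c := by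
      conv_lhs => rw [← hc]
      rw [← act_mul, mul_inv_cancel, act_one]
    rw [h2] at this
    rw [← this]
    exact Finset.map_subset_map.mpr hS
  · have hmap : (S.map h⁻¹.toEmbedding).map h.toEmbedding = S := by
      rw [Finset.map_map]
      ext x
      simp
    have := act_relabel c h (S.map h⁻¹.toEmbedding) (j + 1)
    rw [hc, hmap] at this
    rw [this, act_mul, hgS]

open scoped Classical in
lemma exists_sum_lowerPerms_eq (μ : YoungDiagram) (c : Cfg n) (j p : ℕ) :
    ∃ a, ∑ g ∈ lowerPerms μ c j p, π g =
      a * ∑ g with FixesFrom μ.card g ∧ act c g = c, π g := by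
  refine exists_sum_eq_mul_sum π (by simp [FixesFrom.one, act_one]) (fun g hg => ?_)
    (fun g hg h hh => ?_) _ (fun g hg h hh => ?_)
  · rw [Finset.mem_filter] at hg ⊢
    refine ⟨Finset.mem_univ _, hg.2.1.inv, ?_⟩
    conv_lhs => rw [← hg.2.2]
    rw [← act_mul, mul_inv_cancel, act_one]
  · rw [Finset.mem_filter] at hg hh ⊢
    exact ⟨Finset.mem_univ _, hg.2.1.mul hh.2.1, by rw [act_mul, hg.2.2, hh.2.2]⟩
  · rw [Finset.mem_filter] at hh
    exact mul_mem_lowerPerms hg hh.2.1 hh.2.2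

lemma wGT_of_lowered {μ ν : YoungDiagram} {α : ℕ → ℕ} {j p l : ℕ}
    (hw : ∀ i, α i + (if i = j + 1 then p + 1 else 0) =
      μ.rowLen i + if i = j then p + 1 else 0)
    (hdom : ∀ k, ∑ i ∈ Finset.range k, α i ≤ ∑ i ∈ Finset.range k, ν.rowLen i) :
    wGT (ν, l) (μ, l) := by
  have hsumw : ∀ k, ∑ i ∈ Finset.range k, α i + (if j + 1 < k then p + 1 else 0) =
      ∑ i ∈ Finset.range k, μ.rowLen i + if j < k then p + 1 else 0 := by
    intro k
    have := Finset.sum_congr (rfl : Finset.range k = Finset.range k) fun i _ => hw i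
    rw [Finset.sum_add_distrib, Finset.sum_add_distrib, Finset.sum_ite_eq' (Finset.range k),
      Finset.sum_ite_eq' (Finset.range k)] at this
    simpa only [Finset.mem_range] using this
  refine Or.inr ⟨rfl, fun k => ?_, ?_⟩
  · refine le_trans ?_ (hdom k)
    have := hsumw k
    simp only
    split_ifs at this <;> omega
  · rintro rfl
    have h1 := hsumw (j + 1)
    have h2 := hdom (j + 1)
    rw [if_neg (by omega), if_pos (by omega)] at h1
    simp only at h1 h2
    omega

open scoped Classical in
/-- The Young subgroup attached to a configuration is conjugate to the row stabilizer of the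
diagram whose rows are the sorted row sizes. -/
lemma exists_sum_stab_eq {c : Cfg n} (hc : IsValid n c) {l m : ℕ} (hn : n = m + 2 * l)
    (hm : (rowPoints c).card = m) (hs : StdFrom m c) {N : ℕ} (hN : ∀ i, N ≤ i → wt c i = 0) :
    ∃ (ν : YoungDiagram) (v : Equiv.Perm (Fin n)), ν.card = m ∧ FixesFrom m v ∧
      (∀ k, ∑ i ∈ Finset.range k, wt c i ≤ ∑ i ∈ Finset.range k, ν.rowLen i) ∧
      ∑ g with FixesFrom m g ∧ act c g = c, π g = π v⁻¹ * (∑ g ∈ RowStab n ν, π g) * π v := by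
  obtain ⟨σ, hσ, hσN⟩ := exists_perm_antitone hN
  obtain ⟨ν, hν⟩ := YoungDiagram.exists_rowLen_eq (α := wt c ∘ σ)
    (fun i => hσ (Nat.le_succ i)) (N := N) (by simp [hσN N le_rfl, hN N le_rfl])
  have hdom : ∀ k, ∑ i ∈ Finset.range k, wt c i ≤ ∑ i ∈ Finset.range k, ν.rowLen i := by
    intro k
    have h1 : ∑ i ∈ Finset.range k, wt c i = ∑ i ∈ (Finset.range k).image ⇑σ⁻¹, (wt c ∘ σ) i := by
      rw [Finset.sum_image (fun x _ y _ h => σ⁻¹.injective h)]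
      simp
    have h2 := hσ.sum_le_sum_range_card ((Finset.range k).image ⇑σ⁻¹)
    rw [Finset.card_image_of_injective _ σ⁻¹.injective, Finset.card_range, ← h1] at h2
    exact h2.trans (Finset.sum_le_sum fun i _ => (hν i).ge)
  have hwt : ∀ i, wt (mapRows ⇑σ⁻¹ c) i = ν.rowLen i := fun i => by
    rw [wt_mapRows, hν, inv_inv, Function.comp_apply]
  have hνN : ∀ i, N ≤ i → ν.rowLen i = 0 := fun i hi => by
    rw [hν, Function.comp_apply, hσN i hi, hN i hi]
  have hνm : ν.card = m := by
    rw [ν.card_eq_sum_rowLen hνN, ← hm, ← card_rowPoints_mapRows σ⁻¹ c, card_rowPoints (N := N)]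
    · exact Finset.sum_congr rfl fun i _ => (hwt i).symm
    · exact fun i hi => by rw [hwt, hνN i hi]
  subst hνm
  have hstd := std_isValid (μ := ν) hn le_rfl
  obtain ⟨v, hv, hvc⟩ := exists_fixesFrom_act_eq hn hstd (hc.mapRows ⇑σ⁻¹)
    (StdFrom.std ν ν.card) (hs.mapRows ⇑σ⁻¹) (card_rowPoints_std (by omega))
    (by rw [card_rowPoints_mapRows, hm]) (fun i => by rw [hwt, wt_std (by omega) le_rfl])
  refine ⟨ν, v, rfl, hv, hdom, ?_⟩
  have hiff : ∀ g, FixesFrom ν.card g ∧ act c g = c ↔ v * g * v⁻¹ ∈ RowStab n ν := by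
    intro g
    rw [mem_RowStab_iff hn]
    have e : act (std n ν ν.card n) (v * g * v⁻¹) = std n ν ν.card n ↔ act c g = c := by
      rw [act_mul, act_mul, hvc, ← mapRows_act]
      constructor
      · intro h
        apply mapRows_injective σ⁻¹
        rw [← hvc, ← h, ← act_mul, inv_mul_cancel, act_one]
      · intro h
        rw [h, ← hvc, ← act_mul, mul_inv_cancel, act_one]
    rw [e]
    refine and_congr_left fun _ => ⟨fun h => (hv.mul h).mul hv.inv, fun h => ?_⟩
    have := (hv.inv.mul h).mul hv
    rwa [← mul_assoc, ← mul_assoc, inv_mul_cancel, one_mul, inv_mul_cancel_right] at this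
  rw [Finset.mul_sum, Finset.sum_mul]
  refine Finset.sum_bij' (fun g _ => v * g * v⁻¹) (fun g _ => v⁻¹ * g * v) (fun g hg => ?_)
    (fun g hg => ?_) (fun g _ => by group) (fun g _ => by group) (fun g _ => ?_)
  · rw [Finset.mem_filter] at hg
    exact (hiff g).mp hg.2
  · rw [Finset.mem_filter, hiff]
    refine ⟨Finset.mem_univ _, ?_⟩
    convert hg using 1
    group
  · rw [← map_mul, ← map_mul]
    congr 1
    group

variable {E : Fin n → Fin n → Brauer R δ n}

lemma theta_eq_sum (A : ArcSystem δ π E)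
    (hE : ∀ j (h1 : 1 ≤ j) (h2 : j < n), brE R δ n j = E ⟨j - 1, by omega⟩ ⟨j, h2⟩)
    {μ : YoungDiagram} {l : ℕ} (hn : n = μ.card + 2 * l) {d : Cfg n}
    (hd : IsValid n d) (hs : StdFrom μ.card d) (hw : ∀ i, wt d i = μ.rowLen i)
    [DecidablePred fun g => FixesFrom μ.card g ∧ act (std n μ μ.card n) g = d] :
    theta π μ l (Finsupp.single d 1) =
      (∑ g with FixesFrom μ.card g ∧ act (std n μ μ.card n) g = d, π g) *
        eStairBr R δ n n l := by
  have hcard : (rowPoints d).card = μ.card := by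
    rw [card_rowPoints (N := μ.card), Finset.sum_congr rfl fun i _ => hw i,
      μ.sum_rowLen_of_le le_rfl]
    intro i hi
    rw [hw, μ.rowLen_eq_zero_of_card_le hi]
  obtain ⟨v, hv, rfl⟩ := exists_fixesFrom_act_eq hn (std_isValid (μ := μ) hn le_rfl) hd
    (StdFrom.std μ μ.card) hs (card_rowPoints_std (by omega)) hcard
    (fun i => by rw [hw, wt_std (by omega) le_rfl])
  rw [theta_act_std A hE hn, cellGen, mul_assoc, ← (A.commute_perm_eStairBr hE hn hv).eq,
    ← mul_assoc, Finset.sum_mul]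
  congr 1
  refine Finset.sum_bij' (fun g _ => g * v) (fun g _ => g * v⁻¹) (fun g hg => ?_)
    (fun g hg => ?_) (fun g _ => by simp) (fun g _ => by simp) (fun g _ => (map_mul _ _ _).symm)
  · rw [mem_RowStab_iff hn] at hg
    rw [Finset.mem_filter]
    exact ⟨Finset.mem_univ _, hg.1.mul hv, by rw [act_mul, hg.2]⟩
  · rw [Finset.mem_filter] at hg
    rw [mem_RowStab_iff hn]
    exact ⟨hg.2.1.mul hv.inv, by rw [act_mul, hg.2.2, ← act_mul, mul_inv_cancel, act_one]⟩

lemma theta_lowerOp_eq (A : ArcSystem δ π E)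
    (hE : ∀ j (h1 : 1 ≤ j) (h2 : j < n), brE R δ n j = E ⟨j - 1, by omega⟩ ⟨j, h2⟩)
    {μ : YoungDiagram} {l : ℕ} (hn : n = μ.card + 2 * l) {j p : ℕ}
    {c : Cfg n} (hc : IsValid n c) (hu : StdFrom μ.card c)
    (hw : ∀ i, wt c i + (if i = j + 1 then p else 0) = μ.rowLen i + if i = j then p else 0) :
    theta π μ l (lowerOp R j p (Finsupp.single c 1)) =
      (∑ g ∈ lowerPerms μ c j p, π g) * eStairBr R δ n n l := by
  classical
  have hsub : ∀ S ∈ (rowSet c j).powersetCard p, S ⊆ rowSet c j := fun S hS =>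
    (Finset.mem_powersetCard.mp hS).1
  have hinj : ∀ S ∈ (rowSet c j).powersetCard p, ∀ T ∈ (rowSet c j).powersetCard p,
      relabel c S (j + 1) = relabel c T (j + 1) → S ⊆ T := by
    intro S hS T hT h x hx
    by_contra hxT
    have := congrFun h x
    rw [relabel, relabel, if_pos hx, if_neg hxT, mem_rowSet.mp (hsub S hS hx),
      Slot.row.injEq] at this
    omega
  rw [lowerOp_single, map_sum, lowerPerms, Finset.sum_biUnion, Finset.sum_mul]
  · refine Finset.sum_congr rfl fun S hS => ?_
    rw [theta_eq_sum A hE hn (hc.relabel (hsub S hS) (j + 1))]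
    · intro t a b ha hb
      have := hu t a b ha hb
      rw [relabel, if_neg, this]
      intro hm
      rw [mem_rowSet.mp (hsub S hS hm)] at this
      cases this
    · intro i
      have h1 := wt_relabel (hsub S hS) (by omega : j ≠ j + 1) i
      have h2 := hw i
      rw [(Finset.mem_powersetCard.mp hS).2] at h1
      omega
  · intro S hS T hT hST
    refine Finset.disjoint_left.mpr fun g hg hg' => hST ?_
    have h1 := (Finset.mem_filter.mp hg).2.2
    have h2 := (Finset.mem_filter.mp hg').2.2
    exact (hinj S hS T hT (h1.symm.trans h2)).antisymm (hinj T hT S hS (h2.symm.trans h1))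

lemma theta_lowerOp_mem_of_stdFrom (A : ArcSystem δ π E)
    (hE : ∀ j (h1 : 1 ≤ j) (h2 : j < n), brE R δ n j = E ⟨j - 1, by omega⟩ ⟨j, h2⟩)
    {μ : YoungDiagram} {l : ℕ} (hn : n = μ.card + 2 * l) {j p : ℕ}
    {c : Cfg n} (hc : IsValid n c) (hu : StdFrom μ.card c) {N : ℕ}
    (hN : ∀ i, N ≤ i → wt c i = 0) (hcard : (rowPoints c).card = μ.card)
    (hw : ∀ i, wt c i + (if i = j + 1 then p + 1 else 0) =
      μ.rowLen i + if i = j then p + 1 else 0) :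
    theta π μ l (lowerOp R j (p + 1) (Finsupp.single c 1)) ∈ aboveSpan π (μ, l) := by
  obtain ⟨ν, v, hν, hv, hdom, hstab⟩ := exists_sum_stab_eq (π := π) hc hn hcard hu hN
  obtain ⟨a, ha⟩ := exists_sum_lowerPerms_eq (π := π) μ c j (p + 1)
  have key : theta π μ l (lowerOp R j (p + 1) (Finsupp.single c 1)) =
      (a * π v⁻¹) * cellGen π ν l * π v := by
    rw [theta_lowerOp_eq A hE hn hc hu hw, ha, hstab, cellGen]
    have := (A.commute_perm_eStairBr hE hn hv).eq
    simp only [mul_assoc, this]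
  rw [key]
  exact mem_aboveSpan (z := (ν, l)) (by simp only; omega) (wGT_of_lowered hw hdom) _ _

theorem theta_lowerOp_mem (A : ArcSystem δ π E)
    (hE : ∀ j (h1 : 1 ≤ j) (h2 : j < n), brE R δ n j = E ⟨j - 1, by omega⟩ ⟨j, h2⟩)
    {μ : YoungDiagram} {l : ℕ} (hn : n = μ.card + 2 * l) {j p : ℕ}
    {c : Cfg n} (hc : IsValid n c)
    (hw : ∀ i, wt c i + (if i = j + 1 then p + 1 else 0) =
      μ.rowLen i + if i = j then p + 1 else 0) :
    theta π μ l (lowerOp R j (p + 1) (Finsupp.single c 1)) ∈ aboveSpan π (μ, l) := by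
  obtain ⟨N, hN1, hN2⟩ : ∃ N, μ.card ≤ N ∧ j + 1 < N :=
    ⟨μ.card + j + 2, by omega, by omega⟩
  have hN : ∀ i, N ≤ i → wt c i = 0 := fun i hi => by
    have h1 := hw i
    rw [if_neg (by omega), if_neg (by omega), μ.rowLen_eq_zero_of_card_le (by omega)] at h1
    exact h1
  have hcard : (rowPoints c).card = μ.card := by
    rw [card_rowPoints hN, ← μ.sum_rowLen_of_le hN1]
    have := Finset.sum_congr (rfl : Finset.range N = Finset.range N) fun i _ => hw i
    rw [Finset.sum_add_distrib, Finset.sum_add_distrib, Finset.sum_ite_eq' (Finset.range N),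
      Finset.sum_ite_eq' (Finset.range N), if_pos (Finset.mem_range.mpr hN2),
      if_pos (Finset.mem_range.mpr (by omega))] at this
    omega
  obtain ⟨u, hu⟩ := exists_stdFrom hc (by rw [hcard]; exact hn)
  rw [hcard] at hu
  have := mul_mem_aboveSpan (theta_lowerOp_mem_of_stdFrom A hE hn (hc.act u) hu
    (fun i hi => by rw [wt_act, hN i hi]) (by rw [card_rowPoints_act, hcard])
    (fun i => by rw [wt_act, hw])) (π u⁻¹)
  rwa [← (theta_equivariant A hE hn).lowerOp_act, ← act_mul, mul_inv_cancel, act_one] at this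

theorem theta_lowSpan_mem (A : ArcSystem δ π E)
    (hE : ∀ j (h1 : 1 ≤ j) (h2 : j < n), brE R δ n j = E ⟨j - 1, by omega⟩ ⟨j, h2⟩)
    {μ : YoungDiagram} {l : ℕ} (hn : n = μ.card + 2 * l)
    {v : Cfg n →₀ R} (hv : v ∈ lowSpan R n μ.rowLen) : theta π μ l v ∈ aboveSpan π (μ, l) := by
  induction hv using Submodule.span_induction with
  | mem v hv =>
    obtain ⟨j, p, c, hc, hw, rfl⟩ := hv
    exact theta_lowerOp_mem A hE hn hc hw
  | zero => rw [map_zero]; exact Submodule.zero_mem _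
  | add y z _ _ h1 h2 => rw [map_add]; exact Submodule.add_mem _ h1 h2
  | smul r y _ h => rw [map_smul]; exact Submodule.smul_mem _ r h

end HigherCells

/-! ### The right module generated by a cell generator -/

section RightModule

open Cfg

lemma FixesFrom.exists_apply_two {n m : ℕ} {a b p q : Fin n} (ha : a.val < m) (hb : b.val < m)
    (hp : p.val < m) (hq : q.val < m) (hab : a ≠ b) (hpq : p ≠ q) :
    ∃ g : Equiv.Perm (Fin n), FixesFrom m g ∧ g a = p ∧ g b = q := by
  obtain ⟨σ, h1, h2⟩ := exists_perm_apply_two (α := {x : Fin n // x.val < m})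
    (a := ⟨a, ha⟩) (b := ⟨b, hb⟩) (p := ⟨p, hp⟩) (q := ⟨q, hq⟩)
    (fun h => hab (congrArg Subtype.val h)) (fun h => hpq (congrArg Subtype.val h))
  refine ⟨Equiv.Perm.ofSubtype σ, fun x hx => ?_, ?_, ?_⟩
  · exact Equiv.Perm.ofSubtype_apply_of_not_mem σ (by simpa using hx)
  · rw [Equiv.Perm.ofSubtype_apply_of_mem σ ha, h1]
  · rw [Equiv.Perm.ofSubtype_apply_of_mem σ hb, h2]

lemma RowStab_eq_singleton {n : ℕ} {μ : YoungDiagram} {l : ℕ} (hn : n = μ.card + 2 * l)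
    (hμ : ∀ i, μ.rowLen i ≤ 1) : RowStab n μ = {1} := by
  ext v
  rw [mem_RowStab_iff hn, Finset.mem_singleton]
  constructor
  · rintro ⟨hv, hs⟩
    ext1 p
    rcases lt_or_ge p.val μ.card with hp | hp
    · have h1 := std_row (μ := μ) (k := n) hp
      have h2 : std n μ μ.card n (v p) = Slot.row (rowOfNum μ (p.val + 1)) := by
        rw [← act_eq_row_iff, hs, h1]
      have hc : ((std n μ μ.card n).rowSet (rowOfNum μ (p.val + 1))).card ≤ 1 := by
        have := wt_std (μ := μ) (n := n) (k := n) (by omega) le_rfl (rowOfNum μ (p.val + 1))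
        rw [wt] at this
        rw [this]
        exact hμ _
      exact Finset.card_le_one.mp hc _ (mem_rowSet.mpr h2) _ (mem_rowSet.mpr h1)
    · exact hv p hp
  · rintro rfl
    exact ⟨FixesFrom.one, act_one _⟩

lemma YoungDiagram.exists_column (m : ℕ) :
    ∃ μ : YoungDiagram, μ.card = m ∧ ∀ i, μ.rowLen i ≤ 1 := by
  obtain ⟨μ, hμ⟩ := YoungDiagram.exists_rowLen_eq (α := fun i => if i < m then 1 else 0)
    (fun i => by split_ifs <;> omega) (N := m) (by simp)
  refine ⟨μ, ?_, fun i => by rw [hμ]; split_ifs <;> omega⟩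
  rw [μ.card_eq_sum_rowLen (N := m) (fun i hi => by rw [hμ, if_neg (by omega)]),
    Finset.sum_congr rfl fun i hi => by rw [hμ, if_pos (Finset.mem_range.mp hi)]]
  simp

variable {R : Type} [CommRing R] {δ : R} {n : ℕ} {π : Equiv.Perm (Fin n) →* Brauer R δ n}

lemma cellGen_of_rowLen_le_one {μ : YoungDiagram} {l : ℕ} (hn : n = μ.card + 2 * l)
    (hμ : ∀ i, μ.rowLen i ≤ 1) : cellGen π μ l = eStairBr R δ n n l := by
  rw [cellGen, RowStab_eq_singleton hn hμ, Finset.sum_singleton, map_one, one_mul]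

variable {E : Fin n → Fin n → Brauer R δ n}

lemma cellGen_mul_arc_of_lt (A : ArcSystem δ π E)
    (hE : ∀ j (h1 : 1 ≤ j) (h2 : j < n), brE R δ n j = E ⟨j - 1, by omega⟩ ⟨j, h2⟩)
    {μ : YoungDiagram} {l : ℕ} (hn : n = μ.card + 2 * l) {p q : Fin n}
    (hpq : p ≠ q) (hp : p.val < μ.card) (hq : q.val < μ.card) :
    cellGen π μ l * E p q ∈ aboveSpan π (μ, l) := by
  have hm : 2 ≤ μ.card := by
    by_contra h
    exact hpq (Fin.ext (by omega))
  obtain ⟨g, hg, hga, hgb⟩ := FixesFrom.exists_apply_two (m := μ.card)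
    (a := ⟨μ.card - 2, by omega⟩) (b := ⟨μ.card - 1, by omega⟩) (by simp only; omega)
    (by simp only; omega) hp hq (by simp only [ne_eq, Fin.mk.injEq]; omega) hpq
  obtain ⟨ν, hν, hν1⟩ := YoungDiagram.exists_column (μ.card - 2)
  have hnν : n = ν.card + 2 * (l + 1) := by omega
  have hc : Commute (E p q) (eStairBr R δ n n l) := by
    refine commute_eStairBr_of_arcs hE hn fun r s hr hs => A.comm _ _ _ _ ?_ ?_ ?_ ?_ <;>
      (rintro rfl; omega)
  have hs : eStairBr R δ n n (l + 1) =
      E ⟨μ.card - 2, by omega⟩ ⟨μ.card - 1, by omega⟩ * eStairBr R δ n n l := by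
    rw [eStairBr_succ_left (by omega)]
    congr 1
    exact brE_eq_of_val hE (by simp only; omega) (by simp only; omega)
  have key : cellGen π μ l * E p q =
      ((∑ v ∈ RowStab n μ, π v) * π g) * cellGen π ν (l + 1) * π g⁻¹ := by
    rw [cellGen_of_rowLen_le_one hnν hν1, hs, cellGen, mul_assoc, ← hc.eq, ← hga, ← hgb,
      A.conj' g]
    have := (A.commute_perm_eStairBr hE hn hg.inv).eq
    simp only [mul_assoc, this]
  rw [key]
  exact mem_aboveSpan (z := (ν, l + 1)) hnν (Or.inl (Nat.lt_succ_self l)) _ _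

lemma exists_eStairBr_eq_mul_arc (A : ArcSystem δ π E)
    (hE : ∀ j (h1 : 1 ≤ j) (h2 : j < n), brE R δ n j = E ⟨j - 1, by omega⟩ ⟨j, h2⟩)
    {m l : ℕ} (hn : n = m + 2 * l) {q : Fin n} (hq : m ≤ q.val) :
    ∃ q' y, q' ≠ q ∧ eStairBr R δ n n l = y * E q' q := by
  rcases cases_std hn q.val with h | h | ⟨t, ht, h | h⟩
  · omega
  · omega
  · obtain ⟨y, hy⟩ := A.exists_eStairBr_eq_mul hE hn ht h
      (q := ⟨m + 2 * t + 1, by omega⟩) rfl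
    refine ⟨⟨m + 2 * t + 1, by omega⟩, y, ?_, by rw [hy, A.symm]⟩
    intro he
    have := congrArg Fin.val he
    simp only at this
    omega
  · obtain ⟨y, hy⟩ := A.exists_eStairBr_eq_mul hE hn ht
      (p := ⟨m + 2 * t, by omega⟩) rfl h
    refine ⟨⟨m + 2 * t, by omega⟩, y, ?_, hy⟩
    intro he
    have := congrArg Fin.val he
    simp only at this
    omega

lemma cellGen_mul_arc_of_le (A : ArcSystem δ π E)
    (hE : ∀ j (h1 : 1 ≤ j) (h2 : j < n), brE R δ n j = E ⟨j - 1, by omega⟩ ⟨j, h2⟩)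
    {μ : YoungDiagram} {l : ℕ} (hn : n = μ.card + 2 * l) {p q : Fin n}
    (hpq : p ≠ q) (hq : μ.card ≤ q.val) :
    ∃ (r : R) (g : Equiv.Perm (Fin n)), cellGen π μ l * E p q = r • (cellGen π μ l * π g) := by
  obtain ⟨q', y, hne, hy⟩ := exists_eStairBr_eq_mul_arc A hE hn hq
  rcases eq_or_ne q' p with rfl | h
  · refine ⟨δ, 1, ?_⟩
    rw [map_one, mul_one, cellGen, mul_assoc, hy, mul_assoc y, A.sq, mul_smul_comm, mul_smul_comm]
  · refine ⟨1, Equiv.swap q' p, ?_⟩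
    rw [one_smul, cellGen, mul_assoc, hy, A.symm p q, mul_assoc y, A.chain q' q p hne hpq.symm h]
    simp only [mul_assoc]

theorem cellGen_mul_mem (A : ArcSystem δ π E)
    (hE : ∀ j (h1 : 1 ≤ j) (h2 : j < n), brE R δ n j = E ⟨j - 1, by omega⟩ ⟨j, h2⟩)
    {μ : YoungDiagram} {l : ℕ} (hn : n = μ.card + 2 * l)
    (hπ : ∀ j, π (swN n j) = brS R δ n j) (b : Brauer R δ n) :
    cellGen π μ l * b ∈ Submodule.span R (Set.range fun w => cellGen π μ l * π w) ⊔
      aboveSpan π (μ, l) := by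
  have hgen : ∀ g, cellGen π μ l * π g ∈
      Submodule.span R (Set.range fun w => cellGen π μ l * π w) ⊔ aboveSpan π (μ, l) :=
    fun g => Submodule.mem_sup_left (Submodule.subset_span ⟨g, rfl⟩)
  have hM : ∀ c : Brauer R δ n, (∀ g, cellGen π μ l * π g * c ∈
      Submodule.span R (Set.range fun w => cellGen π μ l * π w) ⊔ aboveSpan π (μ, l)) →
      ∀ x ∈ Submodule.span R (Set.range fun w => cellGen π μ l * π w) ⊔ aboveSpan π (μ, l),
        x * c ∈ Submodule.span R (Set.range fun w => cellGen π μ l * π w) ⊔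
          aboveSpan π (μ, l) := by
    intro c hc x hx
    obtain ⟨y, hy, z, hz, rfl⟩ := Submodule.mem_sup.mp hx
    rw [add_mul]
    refine Submodule.add_mem _ ?_ (Submodule.mem_sup_right (mul_mem_aboveSpan hz c))
    clear hx
    induction hy using Submodule.span_induction with
    | mem y hy =>
      obtain ⟨g, rfl⟩ := hy
      exact hc g
    | zero => rw [zero_mul]; exact Submodule.zero_mem _
    | add y z _ _ h1 h2 =>
      rw [add_mul]
      exact Submodule.add_mem _ h1 h2
    | smul r y _ h =>
      rw [smul_mul_assoc]
      exact Submodule.smul_mem _ r h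
  refine brauer_mul_induction (fun j h1 h2 => hM _ fun g => ?_) (fun j h1 h2 => hM _ fun g => ?_)
    b _ (by simpa using hgen 1)
  · rw [← hπ, mul_assoc, ← map_mul]
    exact hgen _
  · rw [hE j h1 h2, mul_assoc, A.conj, ← mul_assoc]
    have hpq : g ⟨j - 1, by omega⟩ ≠ g ⟨j, h2⟩ := by
      rw [g.injective.ne_iff, ne_eq, Fin.mk.injEq]
      omega
    generalize g ⟨j - 1, by omega⟩ = p at hpq
    generalize g ⟨j, h2⟩ = q at hpq
    have hle : ∀ p q : Fin n, p ≠ q → μ.card ≤ q.val → cellGen π μ l * E p q * π g ∈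
        Submodule.span R (Set.range fun w => cellGen π μ l * π w) ⊔ aboveSpan π (μ, l) := by
      intro p q hpq hq
      obtain ⟨r, h, hr⟩ := cellGen_mul_arc_of_le A hE hn hpq hq
      rw [hr, smul_mul_assoc, mul_assoc, ← map_mul]
      exact Submodule.smul_mem _ r (hgen _)
    rcases lt_or_ge q.val μ.card with hq | hq
    · rcases lt_or_ge p.val μ.card with hp | hp
      · exact Submodule.mem_sup_right
          (mul_mem_aboveSpan (cellGen_mul_arc_of_lt A hE hn hpq hp hq) _)
      · rw [A.symm]
        exact hle q p hpq.symm hp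
    · exact hle p q hpq hq

/-- Modulo higher cells, the right ideal generated by a cell generator is spanned by its products
with the path elements. -/
theorem cellGen_mul_mem_path (A : ArcSystem δ π E)
    (hE : ∀ j (h1 : 1 ≤ j) (h2 : j < n), brE R δ n j = E ⟨j - 1, by omega⟩ ⟨j, h2⟩)
    {μ : YoungDiagram} {l : ℕ} (hn : n = μ.card + 2 * l)
    (hπ : ∀ j, π (swN n j) = brS R δ n j) (b : Brauer R δ n) :
    cellGen π μ l * b ∈ Submodule.span R {y | ∃ pp, IsChain pp n ∧ pp n = (μ, l) ∧
      y = cellGen π μ l * pathProd R δ n pp n} ⊔ aboveSpan π (μ, l) := by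
  refine (sup_le ?_ le_sup_right : Submodule.span R (Set.range fun w => cellGen π μ l * π w) ⊔
    aboveSpan π (μ, l) ≤ _) (cellGen_mul_mem A hE hn hπ b)
  rw [Submodule.span_le]
  rintro _ ⟨w, rfl⟩
  have hwt : ∀ j, (act (std n μ μ.card n) w).wt j = μ.rowLen j := fun j => by
    rw [wt_act, wt_std (by omega) le_rfl]
  obtain ⟨v, hv, u, hu, hvu⟩ := Submodule.mem_sup.mp (single_mem_sup (R := R) n le_rfl
    (act (std n μ μ.card n) w) ((std_isValid hn le_rfl).act w))
  rw [show (act (std n μ μ.card n) w).wt = μ.rowLen from funext hwt] at hv hu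
  have h1 := congrArg (theta π μ l) hvu
  rw [theta_act_std A hE hn, map_add] at h1
  simp only [SetLike.mem_coe]
  rw [← h1]
  refine Submodule.add_mem _ (Submodule.mem_sup_left ?_)
    (Submodule.mem_sup_right (theta_lowSpan_mem A hE hn hu))
  clear h1 hvu
  induction hv using Submodule.span_induction with
  | mem v hv =>
    obtain ⟨pp, hpp, hrow, rfl⟩ := hv
    have h1 : (pp n).1 = μ := YoungDiagram.ext_rowLen hrow
    have h2 : (pp n).2 = l := by
      have := hpp.card_eq le_rfl
      rw [h1] at this
      omega
    refine Submodule.subset_span ⟨pp, hpp, Prod.ext h1 h2, ?_⟩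
    have := (theta_equivariant A hE hn).map_vPath hπ hpp (y := ∑ v ∈ RowStab n μ, π v) (by
      rw [h1, h2, theta_std A hE hn, cellGen])
    rwa [h1, theta_std A hE hn] at this
  | zero => rw [map_zero]; exact Submodule.zero_mem _
  | add y z _ _ h1 h2 => rw [map_add]; exact Submodule.add_mem _ h1 h2
  | smul r y _ h => rw [map_smul]; exact Submodule.smul_mem _ r h

end RightModule

/-! ### Spanning and the cellular axioms -/

section Labels

open Cfg

lemma YoungDiagram.finite_card_le (n : ℕ) : {μ : YoungDiagram | μ.card ≤ n}.Finite := by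
  have : Finite {μ : YoungDiagram | μ.card ≤ n} := by
    refine Finite.of_injective (β := Fin n → Fin (n + 1)) (fun μ i => ⟨μ.1.rowLen i, ?_⟩) ?_
    · have h1 := μ.1.sum_rowLen_le {i.val}
      have h2 : μ.1.card ≤ n := μ.2
      rw [Finset.sum_singleton] at h1
      omega
    · intro μ ν h
      refine Subtype.ext (YoungDiagram.ext_rowLen fun i => ?_)
      rcases lt_or_ge i n with hi | hi
      · exact congrArg Fin.val (congrFun h ⟨i, hi⟩)
      · have h1 : μ.1.card ≤ n := μ.2
        have h2 : ν.1.card ≤ n := ν.2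
        rw [μ.1.rowLen_eq_zero_of_card_le (h1.trans hi),
          ν.1.rowLen_eq_zero_of_card_le (h2.trans hi)]
  exact Set.toFinite _

lemma finite_labels (n : ℕ) : {x : YoungDiagram × ℕ | x.1.card + 2 * x.2 ≤ n}.Finite := by
  refine ((YoungDiagram.finite_card_le n).prod (Set.finite_Iic n)).subset fun x hx => ?_
  have h : x.1.card + 2 * x.2 ≤ n := hx
  exact ⟨(by omega : x.1.card ≤ n), (by omega : x.2 ≤ n)⟩

lemma WLam.eq_card_add {n : ℕ} (x : WLam n) : n = x.1.1.card + 2 * x.1.2 := by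
  have := x.2
  omega

instance WLam.finite (n : ℕ) : Finite (WLam n) :=
  ((finite_labels n).subset fun x hx => by
    have h : 2 * x.2 ≤ n ∧ x.1.card = n - 2 * x.2 := hx
    exact (by omega : x.1.card + 2 * x.2 ≤ n) :
    {x : YoungDiagram × ℕ | 2 * x.2 ≤ n ∧ x.1.card = n - 2 * x.2}.Finite).to_subtype

/-- The extension of a path to a sequence indexed by the natural numbers. -/
def WPath.extend {n : ℕ} {x : YoungDiagram × ℕ} (t : WPath n x) (j : ℕ) : YoungDiagram × ℕ :=
  if h : j < n + 1 then t.1 ⟨j, h⟩ else x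

lemma WPath.extend_val {n : ℕ} {x : YoungDiagram × ℕ} (t : WPath n x) (j : Fin (n + 1)) :
    t.extend j = t.1 j := dif_pos j.2

lemma WPath.isChain_extend {n : ℕ} {x : YoungDiagram × ℕ} (t : WPath n x) :
    IsChain t.extend n :=
  ⟨(t.extend_val 0).trans t.2.1, fun i hi => by
    have := t.2.2.2 ⟨i, hi⟩
    rwa [← t.extend_val, ← t.extend_val] at this⟩

instance WPath.finite (n : ℕ) (x : YoungDiagram × ℕ) : Finite (WPath n x) :=
  ((Set.Finite.pi' fun _ : Fin (n + 1) => finite_labels n).subset fun pp hpp k => by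
    have hc := WPath.isChain_extend (⟨pp, hpp⟩ : WPath n x)
    have h1 : k.val = _ := hc.card_eq (Nat.le_of_lt_succ k.2)
    have h3 := WPath.extend_val (⟨pp, hpp⟩ : WPath n x) k
    rw [h3] at h1
    have h2 := k.2
    exact (by simp only at h1; omega : (pp k).1.card + 2 * (pp k).2 ≤ n) :
    {pp : Fin (n + 1) → YoungDiagram × ℕ | pp 0 = (⊥, 0) ∧ pp (Fin.last n) = x ∧
      ∀ k : Fin n, WEdge (pp k.castSucc) (pp k.succ)}.Finite).to_subtype

lemma wGT_irrefl (x : YoungDiagram × ℕ) : ¬ wGT x x := by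
  rintro (h | h)
  · exact lt_irrefl _ h
  · exact h.2.2 rfl

lemma wGT_trans {x y z : YoungDiagram × ℕ} (h : wGT x y) (h' : wGT y z) : wGT x z := by
  rcases h with h | ⟨h1, h2, h3⟩ <;> rcases h' with h' | ⟨h1', h2', h3'⟩
  · exact Or.inl (h'.trans h)
  · exact Or.inl (h1' ▸ h)
  · exact Or.inl (h1 ▸ h')
  · refine Or.inr ⟨h1.trans h1', fun k => (h2' k).trans (h2 k), fun he => h3 ?_⟩
    rw [he] at h2
    have hs : ∀ k, ∑ i ∈ Finset.range k, z.1.rowLen i = ∑ i ∈ Finset.range k, y.1.rowLen i :=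
      fun k => le_antisymm (h2' k) (h2 k)
    rw [he]
    refine YoungDiagram.ext_rowLen fun i => ?_
    have h5 := hs i
    have h6 := hs (i + 1)
    rw [Finset.sum_range_succ, Finset.sum_range_succ] at h6
    omega

variable {R : Type} [CommRing R] {δ : R} {n : ℕ}

lemma prod_dStepBr_eq_pathProd (pp : ℕ → YoungDiagram × ℕ) (k : ℕ) :
    ((List.ofFn fun j : Fin k => dStepBr R δ n j (pp j) (pp (j + 1))).reverse).prod =
      pathProd R δ n pp k := by
  induction k with
  | zero => simp [pathProd]
  | succ k ih =>
    rw [List.ofFn_succ', List.concat_eq_append, List.reverse_append, List.prod_append, pathProd,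
      ← ih]
    simp

lemma exists_dPathBr_eq {pp : ℕ → YoungDiagram × ℕ} (hpp : IsChain pp n) :
    ∃ t : WPath n (pp n), dPathBr R δ n n t = pathProd R δ n pp n :=
  ⟨⟨fun j => pp j, hpp.1, rfl, fun k => hpp.2 k k.2⟩, prod_dStepBr_eq_pathProd pp n⟩

end Labels

section Spanning

open Cfg

variable {R : Type} [CommRing R] {δ : R} {n : ℕ} {π : Equiv.Perm (Fin n) →* Brauer R δ n}
  {st : Brauer R δ n →ₗ[R] Brauer R δ n}

lemma star_brauer_one (hs : ∀ j, st (brS R δ n j) = brS R δ n j)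
    : st 1 = 1 := by
  have := hs 0
  rwa [brS_out (by omega)] at this

lemma star_perm (hmul : ∀ x y, st (x * y) = st y * st x)
    (hs : ∀ j, st (brS R δ n j) = brS R δ n j)
    (hπ : ∀ j, π (swN n j) = brS R δ n j)
    (g : Equiv.Perm (Fin n)) : st (π g) = π g⁻¹ := by
  induction g using perm_induction_swN with
  | h1 => rw [inv_one, map_one, star_brauer_one hs]
  | hs j h1 h2 g ih =>
    have h3 : (swN n j)⁻¹ = swN n j := inv_eq_of_mul_eq_one_left (swN_mul_self n j)
    rw [map_mul, hmul, ih, hπ, hs, mul_inv_rev, map_mul, h3, hπ]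

lemma star_eStairBr (hmul : ∀ x y, st (x * y) = st y * st x)
    (hs : ∀ j, st (brS R δ n j) = brS R δ n j)
    (he : ∀ j, st (brE R δ n j) = brE R δ n j) {k l : ℕ} (h : 2 * l ≤ k) :
    st (eStairBr R δ n k l) = eStairBr R δ n k l := by
  induction l with
  | zero => rw [eStairBr_zero, star_brauer_one hs]
  | succ l ih =>
    rw [eStairBr_succ_left h, hmul, ih (by omega), he]
    refine (commute_eStairBr fun j h1 h2 => ?_).symm.eq
    by_cases h3 : (1 ≤ k - 2 * l - 1 ∧ k - 2 * l - 1 < n) ∧ 1 ≤ j ∧ j < n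
    · exact brE_mul_brE_comm h3.1 h3.2 (by omega)
    · rcases not_and_or.mp h3 with h3 | h3
      · rw [brE, dif_neg h3]
        exact Commute.one_left _
      · rw [show brE R δ n j = 1 from dif_neg h3]
        exact Commute.one_right _

lemma star_cellGen (hmul : ∀ x y, st (x * y) = st y * st x)
    (hs : ∀ j, st (brS R δ n j) = brS R δ n j)
    (hπ : ∀ j, π (swN n j) = brS R δ n j)
    (he : ∀ j, st (brE R δ n j) = brE R δ n j)
    {E : Fin n → Fin n → Brauer R δ n} (A : ArcSystem δ π E)
    (hE : ∀ j (h1 : 1 ≤ j) (h2 : j < n), brE R δ n j = E ⟨j - 1, by omega⟩ ⟨j, h2⟩)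
    {μ : YoungDiagram} {l : ℕ} (hn : n = μ.card + 2 * l) :
    st (cellGen π μ l) = cellGen π μ l := by
  rw [cellGen, hmul, star_eStairBr hmul hs he (by omega), map_sum, Finset.mul_sum, Finset.sum_mul]
  refine Finset.sum_bij' (fun v _ => v⁻¹) (fun v _ => v⁻¹) (fun v hv => RowStab_inv_mem hv)
    (fun v hv => RowStab_inv_mem hv) (fun v _ => inv_inv v) (fun v _ => inv_inv v)
    (fun v hv => ?_)
  rw [star_perm hmul hs hπ]
  exact ((A.commute_perm_eStairBr hE hn ((mem_RowStab_iff hn).mp hv).1.inv).eq).symm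

lemma star_mem_aboveSpan (hmul : ∀ x y, st (x * y) = st y * st x)
    (hs : ∀ j, st (brS R δ n j) = brS R δ n j)
    (hπ : ∀ j, π (swN n j) = brS R δ n j)
    (he : ∀ j, st (brE R δ n j) = brE R δ n j)
    {E : Fin n → Fin n → Brauer R δ n} (A : ArcSystem δ π E)
    (hE : ∀ j (h1 : 1 ≤ j) (h2 : j < n), brE R δ n j = E ⟨j - 1, by omega⟩ ⟨j, h2⟩)
    {x : YoungDiagram × ℕ} {y : Brauer R δ n} (hy : y ∈ aboveSpan π x) :
    st y ∈ aboveSpan π x := by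
  induction hy using Submodule.span_induction with
  | mem y hy =>
    obtain ⟨z, a, c, hz, h, rfl⟩ := hy
    rw [hmul, hmul, star_cellGen hmul hs hπ he A hE hz, ← mul_assoc]
    exact mem_aboveSpan hz h _ _
  | zero => rw [map_zero]; exact Submodule.zero_mem _
  | add y z _ _ h1 h2 => rw [map_add]; exact Submodule.add_mem _ h1 h2
  | smul r y _ h => rw [map_smul]; exact Submodule.smul_mem _ r h

/-- Right multiplication of a cell generator, expanded along paths. -/
lemma exists_cellGen_mul_eq {E : Fin n → Fin n → Brauer R δ n} (A : ArcSystem δ π E)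
    (hE : ∀ j (h1 : 1 ≤ j) (h2 : j < n), brE R δ n j = E ⟨j - 1, by omega⟩ ⟨j, h2⟩)
    (hπ : ∀ j, π (swN n j) = brS R δ n j) {x : YoungDiagram × ℕ} (hn : n = x.1.card + 2 * x.2)
    (b : Brauer R δ n) :
    ∃ r : WPath n x →₀ R, cellGen π x.1 x.2 * b -
      r.sum (fun v rv => rv • (cellGen π x.1 x.2 * dPathBr R δ n n v)) ∈ aboveSpan π x := by
  obtain ⟨u, hu, w, hw, h⟩ := Submodule.mem_sup.mp (cellGen_mul_mem_path A hE hn hπ b)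
  have hu' : u ∈ Submodule.span R
      (Set.range fun v : WPath n x => cellGen π x.1 x.2 * dPathBr R δ n n v) := by
    refine Submodule.span_mono ?_ hu
    rintro _ ⟨pp, hpp, hx, rfl⟩
    obtain ⟨t, ht⟩ := exists_dPathBr_eq (R := R) (δ := δ) hpp
    obtain rfl : pp n = x := hx
    exact ⟨t, by simp only [ht]⟩
  obtain ⟨r, rfl⟩ := Finsupp.mem_span_range_iff_exists_finsupp.mp hu'
  refine ⟨r, ?_⟩
  rw [← h, add_sub_cancel_left]
  exact hw

/-- The span of the cellular basis elements attached to the labels above `x`. -/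
def higherSpan (π : Equiv.Perm (Fin n) →* Brauer R δ n) (st : Brauer R δ n →ₗ[R] Brauer R δ n)
    (x : YoungDiagram × ℕ) : Submodule R (Brauer R δ n) :=
  Submodule.span R {y | ∃ (m : WLam n) (u w : WPath n m.1), wGT m.1 x ∧
    y = st (dPathBr R δ n n u) * cellGen π m.1.1 m.1.2 * dPathBr R δ n n w}

lemma higherSpan_mono {x z : YoungDiagram × ℕ} (h : wGT z x) :
    higherSpan π st z ≤ higherSpan π st x := by
  refine Submodule.span_mono ?_
  rintro _ ⟨m, u, w, hm, rfl⟩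
  exact ⟨m, u, w, wGT_trans hm h, rfl⟩

lemma mul_cellGen_mul_mem (hmul : ∀ x y, st (x * y) = st y * st x)
    (hs : ∀ j, st (brS R δ n j) = brS R δ n j)
    (hπ : ∀ j, π (swN n j) = brS R δ n j)
    (he : ∀ j, st (brE R δ n j) = brE R δ n j)
    (hst : ∀ y, st (st y) = y)
    {E : Fin n → Fin n → Brauer R δ n} (A : ArcSystem δ π E)
    (hE : ∀ j (h1 : 1 ≤ j) (h2 : j < n), brE R δ n j = E ⟨j - 1, by omega⟩ ⟨j, h2⟩)
    (x : WLam n) (a b : Brauer R δ n) :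
    a * cellGen π x.1.1 x.1.2 * b ∈ Submodule.span R {y | ∃ u w : WPath n x.1,
      y = st (dPathBr R δ n n u) * cellGen π x.1.1 x.1.2 * dPathBr R δ n n w} ⊔
      aboveSpan π x.1 := by
  obtain ⟨r, hr⟩ := exists_cellGen_mul_eq A hE hπ x.eq_card_add b
  obtain ⟨q, hq⟩ := exists_cellGen_mul_eq A hE hπ x.eq_card_add (st a)
  have hq' := star_mem_aboveSpan hmul hs hπ he A hE hq
  rw [map_sub, hmul, hst, star_cellGen hmul hs hπ he A hE x.eq_card_add, Finsupp.sum, map_sum]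
    at hq'
  simp only [map_smul, hmul, star_cellGen hmul hs hπ he A hE x.eq_card_add] at hq'
  have h1 := mul_mem_aboveSpan hq' b
  have h2 : ∀ u : WPath n x.1, st (dPathBr R δ n n u) * cellGen π x.1.1 x.1.2 * b ∈
      Submodule.span R {y | ∃ u w : WPath n x.1,
        y = st (dPathBr R δ n n u) * cellGen π x.1.1 x.1.2 * dPathBr R δ n n w} ⊔
        aboveSpan π x.1 := by
    intro u
    have h3 := mul_mem_aboveSpan_left hr (st (dPathBr R δ n n u))
    rw [mul_sub, ← mul_assoc, Finsupp.sum, Finset.mul_sum] at h3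
    rw [← sub_add_cancel (st (dPathBr R δ n n u) * cellGen π x.1.1 x.1.2 * b)]
    refine Submodule.add_mem _ (Submodule.mem_sup_right h3) (Submodule.mem_sup_left ?_)
    refine Submodule.sum_mem _ fun w _ => ?_
    rw [mul_smul_comm, ← mul_assoc]
    exact Submodule.smul_mem _ _ (Submodule.subset_span ⟨u, w, rfl⟩)
  rw [sub_mul, Finset.sum_mul] at h1
  rw [← sub_add_cancel (a * cellGen π x.1.1 x.1.2 * b)]
  refine Submodule.add_mem _ (Submodule.mem_sup_right h1) ?_
  refine Submodule.sum_mem _ fun u _ => ?_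
  rw [smul_mul_assoc]
  exact Submodule.smul_mem _ _ (h2 u)

theorem aboveSpan_le_higherSpan (hmul : ∀ x y, st (x * y) = st y * st x)
    (hs : ∀ j, st (brS R δ n j) = brS R δ n j)
    (hπ : ∀ j, π (swN n j) = brS R δ n j)
    (he : ∀ j, st (brE R δ n j) = brE R δ n j)
    (hst : ∀ y, st (st y) = y)
    {E : Fin n → Fin n → Brauer R δ n} (A : ArcSystem δ π E)
    (hE : ∀ j (h1 : 1 ≤ j) (h2 : j < n), brE R δ n j = E ⟨j - 1, by omega⟩ ⟨j, h2⟩)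
    (x : WLam n) : aboveSpan π x.1 ≤ higherSpan π st x.1 := by
  have : IsTrans (WLam n) fun a b => wGT a.1 b.1 := ⟨fun _ _ _ => wGT_trans⟩
  have : Std.Irrefl fun a b : WLam n => wGT a.1 b.1 := ⟨fun _ => wGT_irrefl _⟩
  induction x using (Finite.wellFounded_of_trans_of_irrefl
    (fun a b : WLam n => wGT a.1 b.1)).induction with
  | _ x ih =>
  rw [aboveSpan, Submodule.span_le]
  rintro _ ⟨z, a, b, hz, hzx, rfl⟩
  have hle := ih ⟨z, by omega, by omega⟩ hzx
  refine (sup_le ?_ (hle.trans (higherSpan_mono hzx)) : _ ≤ higherSpan π st x.1)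
    (mul_cellGen_mul_mem hmul hs hπ he hst A hE ⟨z, by omega, by omega⟩ a b)
  refine Submodule.span_mono ?_
  rintro _ ⟨u, w, rfl⟩
  exact ⟨⟨z, by omega, by omega⟩, u, w, hzx, rfl⟩

theorem span_cellular_eq_top (hmul : ∀ x y, st (x * y) = st y * st x)
    (hs : ∀ j, st (brS R δ n j) = brS R δ n j)
    (hπ : ∀ j, π (swN n j) = brS R δ n j)
    (he : ∀ j, st (brE R δ n j) = brE R δ n j)
    (hst : ∀ y, st (st y) = y)
    {E : Fin n → Fin n → Brauer R δ n} (A : ArcSystem δ π E)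
    (hE : ∀ j (h1 : 1 ≤ j) (h2 : j < n), brE R δ n j = E ⟨j - 1, by omega⟩ ⟨j, h2⟩) :
    Submodule.span R (Set.range fun p : (x : WLam n) × (WPath n x.1 × WPath n x.1) =>
      st (dPathBr R δ n n p.2.1) * cellGen π p.1.1.1 p.1.1.2 * dPathBr R δ n n p.2.2) = ⊤ := by
  rw [eq_top_iff]
  intro b _
  obtain ⟨μ, hμ, hμ1⟩ := YoungDiagram.exists_column n
  have h1 : cellGen π μ 0 = 1 := by
    rw [cellGen_of_rowLen_le_one (by omega) hμ1, eStairBr_zero]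
  have hb := mul_cellGen_mul_mem hmul hs hπ he hst A hE ⟨(μ, 0), by simp, by simpa⟩ 1 b
  simp only [h1, one_mul, mul_one] at hb
  refine (sup_le ?_ ((aboveSpan_le_higherSpan hmul hs hπ he hst A hE
    ⟨(μ, 0), by simp, by simpa⟩).trans ?_) : _ ≤ Submodule.span R (Set.range _)) hb
  · refine Submodule.span_mono ?_
    rintro _ ⟨u, w, rfl⟩
    exact ⟨⟨⟨(μ, 0), by simp, by simpa⟩, u, w⟩, by simp only [h1, mul_one]⟩
  · refine Submodule.span_mono ?_
    rintro _ ⟨m, u, w, _, rfl⟩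
    exact ⟨⟨m, u, w⟩, rfl⟩

end Spanning

/-! ### Counting walks in the Young lattice -/

namespace YoungDiagram

/-- The diagrams obtained from `l` by adding a node. -/
def upNbrs (l : YoungDiagram) : Finset YoungDiagram :=
  ((finite_card_le (l.card + 1)).subset fun _ h => h.2.le :
    {m : YoungDiagram | l ≤ m ∧ m.card = l.card + 1}.Finite).toFinset

/-- The diagrams obtained from `l` by removing a node. -/
def downNbrs (l : YoungDiagram) : Finset YoungDiagram :=
  ((finite_card_le l.card).subset fun m h => (show m.card ≤ l.card by
    have h2 : l.card = m.card + 1 := h.2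
    omega) :
    {m : YoungDiagram | m ≤ l ∧ l.card = m.card + 1}.Finite).toFinset

lemma mem_upNbrs {l m : YoungDiagram} : m ∈ upNbrs l ↔ l ≤ m ∧ m.card = l.card + 1 :=
  Set.Finite.mem_toFinset _

lemma mem_downNbrs {l m : YoungDiagram} : m ∈ downNbrs l ↔ m ≤ l ∧ l.card = m.card + 1 :=
  Set.Finite.mem_toFinset _

lemma card_sup_add_card_inf (l m : YoungDiagram) :
    (l ⊔ m).card + (l ⊓ m).card = l.card + m.card := by
  have := Finset.card_union_add_card_inter l.cells m.cells
  exact this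

lemma eq_of_le_of_card_le {l m : YoungDiagram} (h : l ≤ m) (hc : m.card ≤ l.card) : l = m :=
  YoungDiagram.ext (Finset.eq_of_subset_of_card_le h hc)

/-- The rows of `l` at the end of which a node can be added. -/
def addableRows (l : YoungDiagram) : Finset ℕ :=
  (Finset.range (l.card + 1)).filter fun j => j = 0 ∨ l.rowLen j < l.rowLen (j - 1)

/-- The rows of `l` from the end of which a node can be removed. -/
def removableRows (l : YoungDiagram) : Finset ℕ :=
  (Finset.range l.card).filter fun j => l.rowLen (j + 1) < l.rowLen j

lemma mem_removableRows {l : YoungDiagram} {j : ℕ} :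
    j ∈ removableRows l ↔ l.rowLen (j + 1) < l.rowLen j := by
  rw [removableRows, Finset.mem_filter, Finset.mem_range, and_iff_right_iff_imp]
  intro h
  by_contra hj
  rw [l.rowLen_eq_zero_of_card_le (i := j) (by omega)] at h
  omega

lemma mem_addableRows {l : YoungDiagram} {j : ℕ} :
    j ∈ addableRows l ↔ ∀ i, i + 1 = j → l.rowLen j < l.rowLen i := by
  have hiff : (j = 0 ∨ l.rowLen j < l.rowLen (j - 1)) ↔
      ∀ i, i + 1 = j → l.rowLen j < l.rowLen i := by
    cases j <;> simp
  rw [addableRows, Finset.mem_filter, Finset.mem_range, hiff, and_iff_right_iff_imp]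
  intro h
  by_contra hj
  have := h (j - 1) (by omega)
  rw [l.rowLen_eq_zero_of_card_le (i := j - 1) (by omega)] at this
  omega

lemma card_addableRows (l : YoungDiagram) : l.addableRows.card = l.removableRows.card + 1 := by
  have : l.addableRows = insert 0 (l.removableRows.map ⟨Nat.succ, Nat.succ_injective⟩) := by
    ext j
    rw [mem_addableRows, Finset.mem_insert, Finset.mem_map]
    cases j with
    | zero => simp
    | succ j =>
      constructor
      · exact fun h => Or.inr ⟨j, mem_removableRows.mpr (h j rfl), rfl⟩
      · rintro (h | ⟨i, hi, h⟩) k hk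
        · omega
        · have h1 : i + 1 = j + 1 := h
          obtain rfl : i = j := by omega
          obtain rfl : k = i := by omega
          exact mem_removableRows.mp hi
  rw [this, Finset.card_insert_of_notMem, Finset.card_map]
  simp

lemma rowLen_succ_le (l : YoungDiagram) (i : ℕ) : l.rowLen (i + 1) ≤ l.rowLen i :=
  l.rowLen_anti i (i + 1) (Nat.le_succ i)

lemma card_upNbrs (l : YoungDiagram) : l.upNbrs.card = l.addableRows.card := by
  symm
  have hex : ∀ j ∈ l.addableRows, ∃ m, AddNode l m j := by
    intro j hj
    rw [mem_addableRows] at hj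
    obtain ⟨m, hm⟩ := exists_rowLen_eq (α := fun i => l.rowLen i + if i = j then 1 else 0)
      (fun i => by
        have h1 := l.rowLen_succ_le i
        have h2 : i + 1 = j → l.rowLen (i + 1) < l.rowLen i := fun h => by rw [h]; exact hj i h
        split_ifs <;> omega) (N := l.card + j + 1)
      (by rw [l.rowLen_eq_zero_of_card_le (by omega), if_neg (by omega)])
    exact ⟨m, hm⟩
  choose! f hf using hex
  refine Finset.card_bij (fun j _ => f j) (fun j hj => ?_) (fun j hj k hk h => ?_)
    (fun m hm => ?_)
  · exact mem_upNbrs.mpr ⟨(hf j hj).le, (hf j hj).card⟩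
  · rw [← (hf j hj).addedRow_eq, ← (hf k hk).addedRow_eq, h]
  · rw [mem_upNbrs] at hm
    obtain ⟨j, hj⟩ := exists_addNode hm.1 hm.2
    have hmem : j ∈ l.addableRows := by
      rw [mem_addableRows]
      rintro i rfl
      have h1 := hj (i + 1)
      have h2 := hj i
      have h3 := m.rowLen_succ_le i
      rw [if_pos rfl] at h1
      rw [if_neg (by omega)] at h2
      omega
    refine ⟨j, hmem, YoungDiagram.ext_rowLen fun i => ?_⟩
    rw [hf j hmem i, hj i]

lemma card_downNbrs (l : YoungDiagram) : l.downNbrs.card = l.removableRows.card := by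
  symm
  have hex : ∀ j ∈ l.removableRows, ∃ m, AddNode m l j := by
    intro j hj
    rw [mem_removableRows] at hj
    obtain ⟨m, hm⟩ := exists_rowLen_eq (α := fun i => l.rowLen i - if i = j then 1 else 0)
      (fun i => by
        have h1 := l.rowLen_succ_le i
        have h2 : i = j → l.rowLen (i + 1) < l.rowLen i := fun h => h ▸ hj
        split_ifs <;> omega) (N := l.card)
      (by rw [l.rowLen_eq_zero_of_card_le le_rfl, Nat.zero_sub])
    refine ⟨m, fun i => ?_⟩
    rw [hm]
    have h2 : i = j → 0 < l.rowLen i := fun h => by rw [h]; omega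
    split_ifs <;> omega
  choose! f hf using hex
  refine Finset.card_bij (fun j _ => f j) (fun j hj => ?_) (fun j hj k hk h => ?_)
    (fun m hm => ?_)
  · exact mem_downNbrs.mpr ⟨(hf j hj).le, (hf j hj).card⟩
  · rw [← (hf j hj).addedRow_eq, ← (hf k hk).addedRow_eq, h]
  · rw [mem_downNbrs] at hm
    obtain ⟨j, hj⟩ := exists_addNode hm.1 hm.2
    have hmem : j ∈ l.removableRows := by
      rw [mem_removableRows]
      have h1 := hj (j + 1)
      have h2 := hj j
      have h3 := m.rowLen_succ_le j
      rw [if_pos rfl] at h2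
      rw [if_neg (by omega)] at h1
      omega
    refine ⟨j, hmem, YoungDiagram.ext_rowLen fun i => ?_⟩
    have h1 := hf j hmem i
    have h2 := hj i
    omega

/-- The up operator on functions on the Young lattice. -/
def opU (f : YoungDiagram → ℕ) (l : YoungDiagram) : ℕ := ∑ m ∈ l.downNbrs, f m

/-- The down operator on functions on the Young lattice. -/
def opD (f : YoungDiagram → ℕ) (l : YoungDiagram) : ℕ := ∑ m ∈ l.upNbrs, f m

/-- The Young lattice is a differential poset. -/
theorem opD_opU (f : YoungDiagram → ℕ) (l : YoungDiagram) :
    opD (opU f) l = opU (opD f) l + f l := by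
  classical
  have h1 : opD (opU f) l = l.upNbrs.card * f l +
      ∑ v ∈ l.upNbrs.sigma fun m => m.downNbrs.erase l, f v.2 := by
    rw [Finset.sum_sigma, ← smul_eq_mul, ← Finset.sum_const, ← Finset.sum_add_distrib, opD]
    refine Finset.sum_congr rfl fun m hm => ?_
    rw [opU, Finset.add_sum_erase]
    rw [mem_upNbrs] at hm
    exact mem_downNbrs.mpr hm
  have h2 : opU (opD f) l = l.downNbrs.card * f l +
      ∑ v ∈ l.downNbrs.sigma fun m => m.upNbrs.erase l, f v.2 := by
    rw [Finset.sum_sigma, ← smul_eq_mul, ← Finset.sum_const, ← Finset.sum_add_distrib, opU]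
    refine Finset.sum_congr rfl fun m hm => ?_
    rw [opD, Finset.add_sum_erase]
    rw [mem_downNbrs] at hm
    exact mem_upNbrs.mpr hm
  have h3 : ∑ v ∈ l.upNbrs.sigma fun m => m.downNbrs.erase l, f v.2 =
      ∑ v ∈ l.downNbrs.sigma fun m => m.upNbrs.erase l, f v.2 := by
    have hup : ∀ m k : YoungDiagram, l ≤ m → k ≤ m → m.card = l.card + 1 → m.card = k.card + 1 →
        k ≠ l → l ⊔ k = m ∧ (l ⊓ k).card + 1 = l.card := by
      intro m k h1 h2 h3 h4 h5
      have hlt : l.card < (l ⊔ k).card := by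
        by_contra h
        have h6 : l = l ⊔ k := eq_of_le_of_card_le le_sup_left (by omega)
        have h7 : k ≤ l := by rw [h6]; exact le_sup_right
        exact h5 (eq_of_le_of_card_le h7 (by omega))
      have h6 : l ⊔ k = m := eq_of_le_of_card_le (sup_le h1 h2) (by omega)
      refine ⟨h6, ?_⟩
      have := card_sup_add_card_inf l k
      rw [h6] at this
      omega
    have hdown : ∀ m k : YoungDiagram, m ≤ l → m ≤ k → l.card = m.card + 1 → k.card = m.card + 1 →
        k ≠ l → l ⊓ k = m ∧ (l ⊔ k).card = l.card + 1 := by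
      intro m k h1 h2 h3 h4 h5
      have hlt : (l ⊓ k).card < l.card := by
        by_contra h
        have h6 : l ⊓ k = l := eq_of_le_of_card_le inf_le_left (by omega)
        have h7 : l ≤ k := by rw [← h6]; exact inf_le_right
        exact h5 (eq_of_le_of_card_le h7 (by omega)).symm
      have h6 : m = l ⊓ k := eq_of_le_of_card_le (le_inf h1 h2) (by omega)
      refine ⟨h6.symm, ?_⟩
      have := card_sup_add_card_inf l k
      rw [← h6] at this
      omega
    refine Finset.sum_bij' (fun v _ => ⟨l ⊓ v.2, v.2⟩) (fun v _ => ⟨l ⊔ v.2, v.2⟩) ?_ ?_ ?_ ?_ ?_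
    · rintro ⟨m, k⟩ h
      simp only [Finset.mem_sigma, Finset.mem_erase, mem_upNbrs, mem_downNbrs] at h ⊢
      obtain ⟨h5, h6⟩ := hup m k h.1.1 h.2.2.1 h.1.2 h.2.2.2 h.2.1
      exact ⟨⟨inf_le_left, h6.symm⟩, h.2.1, inf_le_right, by omega⟩
    · rintro ⟨m, k⟩ h
      simp only [Finset.mem_sigma, Finset.mem_erase, mem_upNbrs, mem_downNbrs] at h ⊢
      obtain ⟨h5, h6⟩ := hdown m k h.1.1 h.2.2.1 h.1.2 h.2.2.2 h.2.1
      exact ⟨⟨le_sup_left, h6⟩, h.2.1, le_sup_right, by omega⟩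
    · rintro ⟨m, k⟩ h
      simp only [Finset.mem_sigma, Finset.mem_erase, mem_upNbrs, mem_downNbrs] at h
      obtain ⟨h5, h6⟩ := hup m k h.1.1 h.2.2.1 h.1.2 h.2.2.2 h.2.1
      simp only [h5]
    · rintro ⟨m, k⟩ h
      simp only [Finset.mem_sigma, Finset.mem_erase, mem_upNbrs, mem_downNbrs] at h
      obtain ⟨h5, h6⟩ := hdown m k h.1.1 h.2.2.1 h.1.2 h.2.2.2 h.2.1
      simp only [h5]
    · exact fun _ _ => rfl
  rw [h1, h2, h3, card_upNbrs, card_downNbrs, card_addableRows]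
  ring

/-- The number of walks of length `k` from the empty diagram to `l` in the Young lattice. -/
def walks : ℕ → YoungDiagram → ℕ
  | 0 => fun l => if l.card = 0 then 1 else 0
  | k + 1 => fun l => opU (walks k) l + opD (walks k) l

lemma walks_zero (l : YoungDiagram) : walks 0 l = if l.card = 0 then 1 else 0 := rfl

lemma card_bot : (⊥ : YoungDiagram).card = 0 := Finset.card_empty

lemma walks_succ (k : ℕ) (l : YoungDiagram) :
    walks (k + 1) l = opU (walks k) l + opD (walks k) l := rfl

lemma opD_add (f g : YoungDiagram → ℕ) (l : YoungDiagram) :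
    opD (fun m => f m + g m) l = opD f l + opD g l := Finset.sum_add_distrib

lemma opD_walks (k : ℕ) (l : YoungDiagram) : opD (walks (k + 1)) l = (k + 1) * walks k l := by
  have key : ∀ k, (∀ l, opD (walks k) l = k * walks (k - 1) l) →
      ∀ l, opD (walks (k + 1)) l = (k + 1) * walks k l := by
    intro k ih l
    have h1 : opD (walks (k + 1)) l = opD (opU (walks k)) l + opD (opD (walks k)) l :=
      opD_add _ _ l
    have h2 : opU (opD (walks k)) l = k * opU (walks (k - 1)) l := by
      rw [opU, opU, Finset.mul_sum]
      exact Finset.sum_congr rfl fun m _ => ih m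
    have h3 : opD (opD (walks k)) l = k * opD (walks (k - 1)) l := by
      rw [opD, opD, Finset.mul_sum]
      exact Finset.sum_congr rfl fun m _ => ih m
    have h4 : k * walks k l = k * (opU (walks (k - 1)) l + opD (walks (k - 1)) l) := by
      cases k with
      | zero => simp
      | succ k => rfl
    rw [h1, opD_opU, h2, h3, add_mul, h4]
    ring
  induction k generalizing l with
  | zero =>
    refine key 0 (fun l => ?_) l
    rw [zero_mul, opD]
    refine Finset.sum_eq_zero fun m hm => ?_
    rw [mem_upNbrs] at hm
    exact if_neg (by omega)
  | succ k ih => exact key (k + 1) (fun l => ih l) l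

lemma walks_two_mul (n : ℕ) {l : YoungDiagram} (hl : l.card = 0) :
    walks (2 * n) l = Nat.doubleFactorial (2 * n - 1) := by
  induction n with
  | zero => exact if_pos hl
  | succ n ih =>
    rw [show 2 * (n + 1) = 2 * n + 1 + 1 by ring, walks_succ, opD_walks, ih]
    have h0 : opU (walks (2 * n + 1)) l = 0 := by
      refine Finset.sum_eq_zero fun m hm => ?_
      rw [mem_downNbrs] at hm
      omega
    rw [h0, zero_add]
    cases n with
    | zero => rfl
    | succ n =>
      rw [show 2 * (n + 1) - 1 = 2 * n + 1 by omega,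
        show 2 * (n + 1) + 1 + 1 - 1 = 2 * n + 1 + 2 by omega, Nat.doubleFactorial_add_two]
      ring

lemma walks_eq_zero {k : ℕ} {l : YoungDiagram} (h : k < l.card) : walks k l = 0 := by
  induction k generalizing l with
  | zero => exact if_neg (by omega)
  | succ k ih =>
    rw [walks_succ, opU, opD,
      Finset.sum_eq_zero fun m hm => ih (by rw [mem_downNbrs] at hm; omega),
      Finset.sum_eq_zero fun m hm => ih (by rw [mem_upNbrs] at hm; omega), add_zero]

/-- The finite set of diagrams with at most `N` nodes. -/
def smallDiagrams (N : ℕ) : Finset YoungDiagram := (finite_card_le N).toFinset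

lemma mem_smallDiagrams {N : ℕ} {l : YoungDiagram} : l ∈ smallDiagrams N ↔ l.card ≤ N :=
  Set.Finite.mem_toFinset _

open scoped Classical in
lemma walks_succ_eq {N k : ℕ} (hk : k ≤ N) (l : YoungDiagram) : walks (k + 1) l =
    ∑ m ∈ smallDiagrams N, if m ∈ l.downNbrs ∨ m ∈ l.upNbrs then walks k m else 0 := by
  have hd : Disjoint l.downNbrs l.upNbrs := by
    refine Finset.disjoint_left.mpr fun m h1 h2 => ?_
    rw [mem_downNbrs] at h1
    rw [mem_upNbrs] at h2
    omega
  rw [walks_succ, opU, opD, ← Finset.sum_union hd, ← Finset.sum_filter]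
  symm
  refine Finset.sum_subset (fun m hm => ?_) fun m hm hm' => ?_
  · exact Finset.mem_union.mpr (Finset.mem_filter.mp hm).2
  · refine walks_eq_zero ?_
    by_contra h
    exact hm' (Finset.mem_filter.mpr ⟨mem_smallDiagrams.mpr (by omega), Finset.mem_union.mp hm⟩)

lemma sum_walks_succ_mul {N k j : ℕ} (hk : k ≤ N) (hj : j ≤ N) :
    ∑ l ∈ smallDiagrams N, walks (k + 1) l * walks j l =
      ∑ l ∈ smallDiagrams N, walks k l * walks (j + 1) l := by
  classical
  simp only [walks_succ_eq hk, walks_succ_eq hj, Finset.sum_mul, Finset.mul_sum]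
  rw [Finset.sum_comm]
  refine Finset.sum_congr rfl fun l _ => Finset.sum_congr rfl fun m _ => ?_
  have : (l ∈ m.downNbrs ∨ l ∈ m.upNbrs) ↔ (m ∈ l.downNbrs ∨ m ∈ l.upNbrs) := by
    simp only [mem_downNbrs, mem_upNbrs]
    exact or_comm
  by_cases h : m ∈ l.downNbrs ∨ m ∈ l.upNbrs
  · rw [if_pos (this.mpr h), if_pos h]
  · rw [if_neg (fun h' => h (this.mp h')), if_neg h, zero_mul, mul_zero]

/-- The sum of the squares of the numbers of walks of length `n` is `(2n-1)!!`. -/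
theorem sum_walks_sq (n : ℕ) : ∑ l ∈ smallDiagrams (2 * n), walks n l * walks n l =
    Nat.doubleFactorial (2 * n - 1) := by
  have h : ∀ j ≤ n, ∑ l ∈ smallDiagrams (2 * n), walks n l * walks n l =
      ∑ l ∈ smallDiagrams (2 * n), walks (n - j) l * walks (n + j) l := by
    intro j hj
    induction j with
    | zero => rfl
    | succ j ih =>
      rw [ih (by omega), show n - j = (n - (j + 1)) + 1 by omega,
        sum_walks_succ_mul (by omega) (by omega), add_assoc]
  rw [h n le_rfl, Nat.sub_self, ← two_mul, Finset.sum_eq_single ⊥]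
  · rw [walks_two_mul n card_bot, walks_zero, if_pos card_bot, one_mul]
  · intro l _ hl
    rw [walks_zero, if_neg, zero_mul]
    intro h0
    exact hl (eq_of_le_of_card_le (l := ⊥) bot_le (by omega)).symm
  · intro h
    exact absurd (mem_smallDiagrams.mpr (by rw [card_bot]; omega)) h

end YoungDiagram

open YoungDiagram in
lemma WPath.natCard_le (n l : ℕ) (m : YoungDiagram) : Nat.card (WPath n (m, l)) ≤ walks n m := by
  classical
  induction n generalizing m l with
  | zero =>
    rw [walks_zero]
    have hs : Subsingleton (WPath 0 (m, l)) :=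
      ⟨fun a b => Subtype.ext (funext fun k => by
        rw [Subsingleton.elim (α := Fin 1) k 0, a.2.1, b.2.1])⟩
    split_ifs with h
    · exact Finite.card_le_one_iff_subsingleton.mpr hs
    · have : IsEmpty (WPath 0 (m, l)) := ⟨fun t => h (by
        have h1 : t.1 0 = (m, l) := t.2.2.1
        rw [t.2.1, Prod.mk.injEq] at h1
        rw [← h1.1, card_bot])⟩
      rw [Nat.card_of_isEmpty]
  | succ n ih =>
    have hd : Disjoint m.downNbrs m.upNbrs := by
      refine Finset.disjoint_left.mpr fun m h1 h2 => ?_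
      rw [mem_downNbrs] at h1
      rw [mem_upNbrs] at h2
      omega
    have hstep : ∀ t : WPath (n + 1) (m, l), (t.1 (Fin.last n).castSucc).1 ∈ m.downNbrs ∪ m.upNbrs ∧
        (t.1 (Fin.last n).castSucc).2 =
          if (t.1 (Fin.last n).castSucc).1 ≤ m then l else l - 1 := by
      intro t
      have h1 := t.2.2.2 (Fin.last n)
      have h2 : t.1 (Fin.last n).succ = (m, l) := t.2.2.1
      rw [h2] at h1
      rw [Finset.mem_union, mem_downNbrs, mem_upNbrs]
      rcases h1 with ⟨h3, h4, h5⟩ | ⟨h3, h4, h5⟩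
      · exact ⟨Or.inl ⟨h4, h5⟩, by rw [if_pos h4]; exact h3.symm⟩
      · refine ⟨Or.inr ⟨h4, h5⟩, ?_⟩
        rw [if_neg]
        · simp only at h3
          omega
        · intro h
          have h6 := Finset.card_le_card (show (t.1 (Fin.last n).castSucc).1.cells ⊆ m.cells from h)
          have h7 : (t.1 (Fin.last n).castSucc).1.card ≤ m.card := h6
          simp only at h5
          omega
    let f : WPath (n + 1) (m, l) → (y : {y // y ∈ m.downNbrs ∪ m.upNbrs}) ×
        WPath n (y.1, if y.1 ≤ m then l else l - 1) := fun t =>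
      ⟨⟨_, (hstep t).1⟩, ⟨fun k => t.1 k.castSucc, t.2.1,
        Prod.ext rfl (hstep t).2, fun k => t.2.2.2 k.castSucc⟩⟩
    have hf : Function.Injective f := by
      intro a b hab
      have h1 := congrArg (fun v => v.2.1) hab
      refine Subtype.ext (funext fun k => ?_)
      cases k using Fin.lastCases with
      | last => exact a.2.2.1.trans b.2.2.1.symm
      | cast k => exact congrFun h1 k
    refine (Nat.card_le_card_of_injective f hf).trans ?_
    rw [Nat.card_sigma, walks_succ, opU, opD, ← Finset.sum_union hd,
      ← Finset.sum_coe_sort (m.downNbrs ∪ m.upNbrs)]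
    exact Finset.sum_le_sum fun y _ => ih _ _

open YoungDiagram in
/-- The number of pairs of paths with the same endpoint is at most the number of Brauer
diagrams. -/
theorem natCard_pathPairs_le (n : ℕ) :
    Nat.card ((x : WLam n) × (WPath n x.1 × WPath n x.1)) ≤
      Nat.doubleFactorial (2 * n - 1) := by
  classical
  have := Fintype.ofFinite (WLam n)
  rw [Nat.card_sigma, ← sum_walks_sq]
  have hinj : Function.Injective fun x : WLam n => x.1.1 := by
    intro x y h
    have h1 := x.eq_card_add
    have h2 := y.eq_card_add
    have h3 : x.1.1 = y.1.1 := h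
    rw [h3] at h1
    exact Subtype.ext (Prod.ext h3 (by omega))
  calc ∑ x : WLam n, Nat.card (WPath n x.1 × WPath n x.1)
      ≤ ∑ x : WLam n, walks n x.1.1 * walks n x.1.1 := by
        refine Finset.sum_le_sum fun x _ => ?_
        rw [Nat.card_prod]
        exact Nat.mul_le_mul (WPath.natCard_le _ _ _) (WPath.natCard_le _ _ _)
    _ = ∑ l ∈ Finset.univ.map ⟨fun x : WLam n => x.1.1, hinj⟩, walks n l * walks n l := by
        rw [Finset.sum_map]
        rfl
    _ ≤ _ := by
        refine Finset.sum_le_sum_of_subset fun l hl => ?_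
        rw [Finset.mem_map] at hl
        obtain ⟨x, _, rfl⟩ := hl
        have := x.eq_card_add
        exact mem_smallDiagrams.mpr (show x.1.1.card ≤ 2 * n by omega)

/-! ### The diagram representation -/

/-- A perfect matching of `X`, given by the involution exchanging matched points. -/
abbrev Pairing (X : Type) : Type := {f : X → X // (∀ x, f (f x) = x) ∧ ∀ x, f x ≠ x}

namespace Pairing

variable {X : Type}

lemma apply_apply (f : Pairing X) (x : X) : f.1 (f.1 x) = x := f.2.1 x

lemma apply_ne (f : Pairing X) (x : X) : f.1 x ≠ x := f.2.2 x

lemma injective (f : Pairing X) : ∀ x y, f.1 x = f.1 y → x = y := fun x y h => by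
  rw [← f.apply_apply x, h, f.apply_apply]

/-- Relabel the points of a matching. -/
def relabel (g : Equiv.Perm X) (f : Pairing X) : Pairing X :=
  ⟨fun x => g (f.1 (g.symm x)), fun x => by simp [f.apply_apply], fun x h => by
    rw [← Equiv.eq_symm_apply] at h
    exact f.apply_ne _ h⟩

lemma relabel_apply (g : Equiv.Perm X) (f : Pairing X) (x : X) :
    (relabel g f).1 x = g (f.1 (g.symm x)) := rfl

lemma relabel_one (f : Pairing X) : relabel 1 f = f := rfl

lemma relabel_mul (g h : Equiv.Perm X) (f : Pairing X) :
    relabel (g * h) f = relabel g (relabel h f) := rfl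

variable {R : Type} [CommRing R] (δ : R)

/-- The linear operator sending a matching `f` to `δ ^ (φ f).1` times `(φ f).2`. -/
def op (φ : Pairing X → ℕ × Pairing X) : Module.End R (Pairing X →₀ R) :=
  Finsupp.linearCombination R fun f => Finsupp.single (φ f).2 (δ ^ (φ f).1)

lemma op_single (φ : Pairing X → ℕ × Pairing X) (f : Pairing X) (r : R) :
    op δ φ (Finsupp.single f r) = Finsupp.single (φ f).2 (r * δ ^ (φ f).1) := by
  rw [op, Finsupp.linearCombination_single, Finsupp.smul_single, smul_eq_mul]

lemma op_mul (φ ψ : Pairing X → ℕ × Pairing X) : op δ φ * op δ ψ =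
    op δ fun f => ((ψ f).1 + (φ (ψ f).2).1, (φ (ψ f).2).2) := by
  refine Finsupp.lhom_ext fun f r => ?_
  rw [Module.End.mul_apply, op_single, op_single, op_single, mul_assoc, pow_add]

lemma op_one : op δ (fun f : Pairing X => (0, f)) = 1 := by
  refine Finsupp.lhom_ext fun f r => ?_
  rw [op_single, pow_zero, mul_one, Module.End.one_apply]

lemma op_congr {φ ψ : Pairing X → ℕ × Pairing X} (h1 : ∀ f, (φ f).1 = (ψ f).1)
    (h2 : ∀ f, (φ f).2 = (ψ f).2) : op δ φ = op δ ψ :=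
  congrArg _ (funext fun f => Prod.ext (h1 f) (h2 f))

variable [DecidableEq X]

/-- Match `p` with `q`, and their former partners with each other. -/
def join (p q : X) (hpq : p ≠ q) (f : Pairing X) : Pairing X :=
  ⟨fun x => if x = p then q else if x = q then p else if x = f.1 p then f.1 q
    else if x = f.1 q then f.1 p else f.1 x,
  fun x => by
    have h0 := f.injective
    have h1 := f.2.1
    have h2 := f.2.2
    have h3 := h1 x
    grind,
  fun x => by
    have h0 := f.injective
    have h1 := f.2.1
    have h2 := f.2.2
    have h3 := h1 x
    grind⟩

lemma join_apply (p q : X) (hpq : p ≠ q) (f : Pairing X) (x : X) :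
    (join p q hpq f).1 x = if x = p then q else if x = q then p else if x = f.1 p then f.1 q
      else if x = f.1 q then f.1 p else f.1 x := rfl

lemma join_apply_left (p q : X) (hpq : p ≠ q) (f : Pairing X) : (join p q hpq f).1 p = q :=
  if_pos rfl

lemma join_apply_right (p q : X) (hpq : p ≠ q) (f : Pairing X) : (join p q hpq f).1 q = p := by
  rw [join_apply, if_neg hpq.symm, if_pos rfl]

lemma join_of_apply_eq {p q : X} (hpq : p ≠ q) {f : Pairing X} (h : f.1 p = q) :
    join p q hpq f = f := by
  refine Subtype.ext (funext fun x => ?_)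
  rw [join_apply]
  have h1 := f.2.1
  grind

lemma join_symm {p q : X} (hpq : p ≠ q) (f : Pairing X) :
    join q p hpq.symm f = join p q hpq f := by
  refine Subtype.ext (funext fun x => ?_)
  rw [join_apply, join_apply]
  have h0 := f.injective
  have h1 := f.2.1
  have h2 := f.2.2
  have h3 := h1 x
  grind

lemma relabel_join (g : Equiv.Perm X) {p q : X} (hpq : p ≠ q) (f : Pairing X) :
    relabel g (join p q hpq f) = join (g p) (g q) (g.injective.ne hpq) (relabel g f) := by
  refine Subtype.ext (funext fun x => ?_)
  simp only [relabel_apply, join_apply, Equiv.symm_apply_apply, ← Equiv.symm_apply_eq]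
  split_ifs <;> rfl

lemma relabel_swap_of_apply_eq {p q : X} {f : Pairing X} (h : f.1 p = q) :
    relabel (Equiv.swap p q) f = f := by
  refine Subtype.ext (funext fun x => ?_)
  have h0 := f.injective
  have h1 := f.2.1
  have h3 := h1 x
  rw [relabel_apply, Equiv.symm_swap, Equiv.swap_apply_def, Equiv.swap_apply_def]
  grind

lemma relabel_swap_join {p q : X} (hpq : p ≠ q) (f : Pairing X) :
    relabel (Equiv.swap p q) (join p q hpq f) = join p q hpq f :=
  relabel_swap_of_apply_eq (join_apply_left _ _ _ _)

lemma join_relabel_swap {p q : X} (hpq : p ≠ q) (f : Pairing X) :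
    join p q hpq (relabel (Equiv.swap p q) f) = join p q hpq f := by
  rw [← relabel_swap_join hpq f, relabel_join]
  refine Subtype.ext (funext fun x => ?_)
  rw [join_apply, join_apply]
  simp only [Equiv.swap_apply_left, Equiv.swap_apply_right]
  have h1 := (relabel (Equiv.swap p q) f).2.1
  have h2 := (relabel (Equiv.swap p q) f).2.2
  grind

lemma join_join_join {a b c : X} (hab : a ≠ b) (hbc : b ≠ c) (hac : a ≠ c) (f : Pairing X) :
    join a b hab (join b c hbc (join a b hab f)) = join a b hab f := by
  refine Subtype.ext (funext fun x => ?_)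
  have h0 := f.injective
  have h1 := f.2.1
  have h2 := f.2.2
  have h3 := h1 x
  simp only [join_apply]
  grind

lemma relabel_relabel_join {a b c : X} (hab : a ≠ b) (hbc : b ≠ c) (hac : a ≠ c) (f : Pairing X) :
    relabel (Equiv.swap a b) (relabel (Equiv.swap b c) (join a b hab f)) =
      join b c hbc (join a b hab f) := by
  refine Subtype.ext (funext fun x => ?_)
  have h0 := f.injective
  have h1 := f.2.1
  have h2 := f.2.2
  have h3 := h1 x
  by_cases ha : x = a
  · subst ha
    simp only [relabel_apply, Equiv.symm_swap, Equiv.swap_apply_def, join_apply]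
    grind
  by_cases hb : x = b
  · subst hb
    simp only [relabel_apply, Equiv.symm_swap, Equiv.swap_apply_def, join_apply]
    grind
  by_cases hc : x = c
  · subst hc
    simp only [relabel_apply, Equiv.symm_swap, Equiv.swap_apply_def, join_apply]
    grind
  simp only [relabel_apply, Equiv.symm_swap, Equiv.swap_apply_def, join_apply, if_neg ha,
    if_neg hb, if_neg hc]
  grind

lemma join_comm {a b c d : X} (hab : a ≠ b) (hcd : c ≠ d) (hac : a ≠ c) (had : a ≠ d)
    (hbc : b ≠ c) (hbd : b ≠ d) (f : Pairing X) :
    join a b hab (join c d hcd f) = join c d hcd (join a b hab f) := by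
  refine Subtype.ext (funext fun x => ?_)
  have h0 := f.injective
  have h1 := f.2.1
  have h2 := f.2.2
  have h3 := h1 x
  simp only [join_apply]
  grind (splits := 40)

lemma join_relabel_join {a b c : X} (hab : a ≠ b) (hbc : b ≠ c) (hac : a ≠ c) (f : Pairing X) :
    join a b hab (relabel (Equiv.swap b c) (join a b hab f)) = join a b hab f := by
  refine Subtype.ext (funext fun x => ?_)
  have h0 := f.injective
  have h1 := f.2.1
  have h2 := f.2.2
  have h3 := h1 x
  simp only [relabel_apply, Equiv.symm_swap, Equiv.swap_apply_def, join_apply]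
  grind (splits := 40)

lemma join_relabel_relabel {a b c : X} (hab : a ≠ b) (hbc : b ≠ c) (hac : a ≠ c) (f : Pairing X) :
    join a b hab (relabel (Equiv.swap b c) (relabel (Equiv.swap a b) f)) =
      join a b hab (join b c hbc f) := by
  refine Subtype.ext (funext fun x => ?_)
  have h0 := f.injective
  have h1 := f.2.1
  have h2 := f.2.2
  have h3 := h1 x
  simp only [relabel_apply, Equiv.symm_swap, Equiv.swap_apply_def, join_apply]
  grind (splits := 40)

/-- The number of loops closed by joining `p` and `q`. -/
def loops (p q : X) (f : Pairing X) : ℕ := if f.1 p = q then 1 else 0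

lemma loops_of_ne {p q : X} {f : Pairing X} (h : f.1 p ≠ q) : loops p q f = 0 := if_neg h

lemma loops_join (p q : X) (hpq : p ≠ q) (f : Pairing X) : loops p q (join p q hpq f) = 1 :=
  if_pos (join_apply_left _ _ _ _)

lemma loops_symm (p q : X) (f : Pairing X) : loops q p f = loops p q f :=
  if_congr ⟨fun h => by rw [← h, f.apply_apply], fun h => by rw [← h, f.apply_apply]⟩ rfl rfl

lemma loops_relabel (g : Equiv.Perm X) (p q : X) (f : Pairing X) :
    loops (g p) (g q) (relabel g f) = loops p q f := by
  simp only [loops, relabel_apply, Equiv.symm_apply_apply, g.apply_eq_iff_eq]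

lemma loops_relabel_swap (p q : X) (f : Pairing X) :
    loops p q (relabel (Equiv.swap p q) f) = loops p q f := by
  rw [← loops_symm, ← loops_relabel (Equiv.swap p q), Equiv.swap_apply_left,
    Equiv.swap_apply_right, ← relabel_mul, Equiv.swap_mul_self, relabel_one]

lemma loops_join_of_ne {a b c : X} (hab : a ≠ b) (hac : a ≠ c) (f : Pairing X) :
    loops b c (join a b hab f) = 0 :=
  loops_of_ne (by rw [join_apply_right]; exact hac)

lemma loops_join_of_ne_left {a b c : X} (hbc : b ≠ c) (hac : a ≠ c)
    (f : Pairing X) : loops a b (join b c hbc f) = 0 := by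
  rw [← loops_symm]
  exact loops_of_ne (by rw [join_apply_left]; exact hac.symm)

lemma loops_relabel_swap_join {a b c : X} (hab : a ≠ b) (hbc : b ≠ c) (hac : a ≠ c)
    (f : Pairing X) : loops a b (relabel (Equiv.swap b c) (join a b hab f)) = 0 := by
  refine loops_of_ne ?_
  rw [relabel_apply, Equiv.symm_swap, Equiv.swap_apply_of_ne_of_ne hab hac, join_apply_left,
    Equiv.swap_apply_left]
  exact hbc.symm

lemma loops_relabel_relabel {a b c : X} (hab : a ≠ b) (hbc : b ≠ c) (hac : a ≠ c) (f : Pairing X) :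
    loops a b (relabel (Equiv.swap b c) (relabel (Equiv.swap a b) f)) = loops b c f := by
  rw [← relabel_mul]
  conv_rhs => rw [← loops_relabel (Equiv.swap b c * Equiv.swap a b)]
  rw [Equiv.Perm.mul_apply, Equiv.Perm.mul_apply, Equiv.swap_apply_right,
    Equiv.swap_apply_of_ne_of_ne hab hac]
  rw [Equiv.swap_apply_of_ne_of_ne hac.symm hbc.symm, Equiv.swap_apply_right]

lemma loops_add_loops_join {a b c d : X} (hab : a ≠ b) (hcd : c ≠ d) (hac : a ≠ c) (had : a ≠ d)
    (hbc : b ≠ c) (hbd : b ≠ d) (f : Pairing X) :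
    loops c d f + loops a b (join c d hcd f) = loops a b f + loops c d (join a b hab f) := by
  have h0 := f.injective
  have h1 := f.2.1
  have h2 := f.2.2
  simp only [loops, join_apply]
  grind (splits := 40)

/-- The operator of a transposition. -/
def opSwap (a b : X) : Module.End R (Pairing X →₀ R) :=
  op δ fun f => (0, relabel (Equiv.swap a b) f)

/-- The operator of a horizontal arc. -/
def opJoin {a b : X} (hab : a ≠ b) : Module.End R (Pairing X →₀ R) :=
  op δ fun f => (loops a b f, join a b hab f)

lemma opSwap_symm (a b : X) : opSwap δ b a = opSwap δ a b := by
  rw [opSwap, Equiv.swap_comm, opSwap]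

lemma opJoin_symm {a b : X} (hab : a ≠ b) : opJoin δ hab.symm = opJoin δ hab :=
  op_congr δ (loops_symm a b) (join_symm hab)

lemma opSwap_mul_self (a b : X) : opSwap δ a b * opSwap δ a b = 1 := by
  rw [opSwap, op_mul, ← op_one]
  refine op_congr δ (fun f => rfl) fun f => ?_
  simp only [← relabel_mul, Equiv.swap_mul_self, relabel_one]

lemma opJoin_mul_self {a b : X} (hab : a ≠ b) :
    opJoin δ hab * opJoin δ hab = algebraMap R _ δ * opJoin δ hab := by
  rw [opJoin, op_mul, ← Algebra.smul_def]
  refine Finsupp.lhom_ext fun f r => ?_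
  rw [LinearMap.smul_apply, op_single, op_single, Finsupp.smul_single, loops_join,
    join_of_apply_eq hab (join_apply_left _ _ _ _)]
  congr 1
  rw [smul_eq_mul]
  ring

lemma opSwap_braid {a b c : X} (hab : a ≠ b) (hbc : b ≠ c) (hac : a ≠ c) :
    opSwap δ a b * opSwap δ b c * opSwap δ a b = opSwap δ b c * opSwap δ a b * opSwap δ b c := by
  simp only [opSwap, op_mul]
  refine op_congr δ (fun f => rfl) fun f => ?_
  simp only [← relabel_mul]
  congr 1
  rw [← mul_assoc, ← mul_assoc, Equiv.swap_comm a b, Equiv.swap_comm b c,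
    Equiv.swap_mul_swap_mul_swap hbc.symm hac.symm, Equiv.swap_comm b a, Equiv.swap_comm c b,
    Equiv.swap_mul_swap_mul_swap hab hac, Equiv.swap_comm]

lemma opSwap_comm {a b c d : X} (hac : a ≠ c) (had : a ≠ d) (hbc : b ≠ c) (hbd : b ≠ d) :
    opSwap δ a b * opSwap δ c d = opSwap δ c d * opSwap δ a b := by
  simp only [opSwap, op_mul]
  refine op_congr δ (fun f => rfl) fun f => ?_
  simp only [← relabel_mul]
  congr 1
  rw [Equiv.mul_swap_eq_swap_mul, Equiv.swap_apply_of_ne_of_ne hac.symm hbc.symm,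
    Equiv.swap_apply_of_ne_of_ne had.symm hbd.symm]

lemma opSwap_opJoin_comm {a b c d : X} (hcd : c ≠ d) (hac : a ≠ c) (had : a ≠ d) (hbc : b ≠ c)
    (hbd : b ≠ d) : opSwap δ a b * opJoin δ hcd = opJoin δ hcd * opSwap δ a b := by
  have hc := Equiv.swap_apply_of_ne_of_ne hac.symm hbc.symm
  have hd := Equiv.swap_apply_of_ne_of_ne had.symm hbd.symm
  simp only [opSwap, opJoin, op_mul]
  refine op_congr δ (fun f => ?_) fun f => ?_
  · have := loops_relabel (Equiv.swap a b) c d f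
    rw [hc, hd] at this
    simp only [this, add_comm]
  · have := relabel_join (Equiv.swap a b) hcd f
    simp only [hc, hd] at this
    exact this

lemma opJoin_comm {a b c d : X} (hab : a ≠ b) (hcd : c ≠ d) (hac : a ≠ c) (had : a ≠ d)
    (hbc : b ≠ c) (hbd : b ≠ d) :
    opJoin δ hab * opJoin δ hcd = opJoin δ hcd * opJoin δ hab := by
  simp only [opJoin, op_mul]
  exact op_congr δ (loops_add_loops_join hab hcd hac had hbc hbd)
    (join_comm hab hcd hac had hbc hbd)

lemma opJoin_mul_opJoin_mul_opJoin {a b c : X} (hab : a ≠ b) (hbc : b ≠ c) (hac : a ≠ c) :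
    opJoin δ hab * opJoin δ hbc * opJoin δ hab = opJoin δ hab := by
  simp only [opJoin, op_mul]
  refine op_congr δ (fun f => ?_) (join_join_join hab hbc hac)
  simp only [loops_join_of_ne hab hac, loops_join_of_ne_left hbc hac, add_zero]

lemma opSwap_mul_opSwap_mul_opJoin {a b c : X} (hab : a ≠ b) (hbc : b ≠ c) (hac : a ≠ c) :
    opSwap δ a b * opSwap δ b c * opJoin δ hab = opJoin δ hbc * opJoin δ hab := by
  simp only [opSwap, opJoin, op_mul]
  refine op_congr δ (fun f => ?_) (relabel_relabel_join hab hbc hac)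
  simp only [loops_join_of_ne hab hac, add_zero]

lemma opJoin_mul_opSwap_mul_opSwap {a b c : X} (hab : a ≠ b) (hbc : b ≠ c) (hac : a ≠ c) :
    opJoin δ hab * opSwap δ b c * opSwap δ a b = opJoin δ hab * opJoin δ hbc := by
  simp only [opSwap, opJoin, op_mul]
  refine op_congr δ (fun f => ?_) (join_relabel_relabel hab hbc hac)
  simp only [loops_join_of_ne_left hbc hac, loops_relabel_relabel hab hbc hac, add_zero, zero_add]

lemma opSwap_mul_opJoin {a b : X} (hab : a ≠ b) :
    opSwap δ a b * opJoin δ hab = opJoin δ hab := by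
  simp only [opSwap, opJoin, op_mul]
  exact op_congr δ (fun f => add_zero _) (relabel_swap_join hab)

lemma opJoin_mul_opSwap {a b : X} (hab : a ≠ b) :
    opJoin δ hab * opSwap δ a b = opJoin δ hab := by
  simp only [opSwap, opJoin, op_mul]
  exact op_congr δ (fun f => (zero_add _).trans (loops_relabel_swap a b f)) (join_relabel_swap hab)

lemma opJoin_mul_opSwap_mul_opJoin {a b c : X} (hab : a ≠ b) (hbc : b ≠ c) (hac : a ≠ c) :
    opJoin δ hab * opSwap δ b c * opJoin δ hab = opJoin δ hab := by
  simp only [opSwap, opJoin, op_mul]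
  refine op_congr δ (fun f => ?_) (join_relabel_join hab hbc hac)
  simp only [loops_relabel_swap_join hab hbc hac, add_zero]

end Pairing

section
variable {R : Type} [CommRing R] (δ : R) (n : ℕ)

/-- The `k`-th top point of a diagram, for `1 ≤ k ≤ n`. -/
def topPt {n : ℕ} (k : ℕ) (h1 : 1 ≤ k) (h2 : k ≤ n) : Fin n ⊕ Fin n := Sum.inl ⟨k - 1, by omega⟩

lemma topPt_ne {n j k : ℕ} (hj1 : 1 ≤ j) (hj2 : j ≤ n) (hk1 : 1 ≤ k) (hk2 : k ≤ n) (h : j ≠ k) :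
    topPt j hj1 hj2 ≠ topPt k hk1 hk2 := by
  intro h'
  have h2 := Fin.mk.inj (Sum.inl.inj h')
  omega

open Pairing in
/-- The action of the generators on diagrams. -/
def genOp : BrGen n → Module.End R (Pairing (Fin n ⊕ Fin n) →₀ R)
  | .S i => opSwap δ (topPt i.1 i.2.1 i.2.2.le) (topPt (i.1 + 1) (by omega) i.2.2)
  | .E i => opJoin δ (topPt_ne i.2.1 i.2.2.le (by omega) i.2.2 (by omega) :
      topPt i.1 i.2.1 i.2.2.le ≠ topPt (i.1 + 1) (by omega) i.2.2)

open Pairing in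
lemma genOp_rel {x y : FreeAlgebra R (BrGen n)} (h : BrRel R δ n x y) :
    FreeAlgebra.lift R (genOp δ n) x = FreeAlgebra.lift R (genOp δ n) y := by
  have hne : ∀ {j k : ℕ} {hj1 : 1 ≤ j} {hj2 : j ≤ n} {hk1 : 1 ≤ k} {hk2 : k ≤ n} (_ : j ≠ k),
    topPt j hj1 hj2 ≠ topPt k hk1 hk2 := fun h => topPt_ne _ _ _ _ h
  induction h with
  | inv i =>
    simp only [map_mul, FreeAlgebra.lift_ι_apply, map_one]
    exact opSwap_mul_self δ _ _
  | idem i =>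
    simp only [map_mul, FreeAlgebra.lift_ι_apply, AlgHom.commutes]
    exact opJoin_mul_self δ _
  | braid i j h =>
    obtain ⟨i, hi⟩ := i
    obtain ⟨j, hj⟩ := j
    obtain rfl : j = i + 1 := h
    simp only [map_mul, FreeAlgebra.lift_ι_apply]
    exact opSwap_braid δ (hne (by dsimp only; omega)) (hne (by dsimp only; omega))
      (hne (by dsimp only; omega))
  | braidComm i j h =>
    simp only [map_mul, FreeAlgebra.lift_ι_apply]
    exact opSwap_comm δ (hne (by omega)) (hne (by omega)) (hne (by omega)) (hne (by omega))
  | seComm i j h =>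
    simp only [map_mul, FreeAlgebra.lift_ι_apply]
    exact opSwap_opJoin_comm δ _ (hne (by omega)) (hne (by omega)) (hne (by omega))
      (hne (by omega))
  | eeComm i j h =>
    simp only [map_mul, FreeAlgebra.lift_ι_apply]
    exact opJoin_comm δ _ _ (hne (by omega)) (hne (by omega)) (hne (by omega)) (hne (by omega))
  | tangle1 i j h =>
    obtain ⟨i, hi⟩ := i
    obtain ⟨j, hj⟩ := j
    simp only [map_mul, FreeAlgebra.lift_ι_apply]
    obtain rfl | rfl : j = i + 1 ∨ i = j + 1 := h
    · exact opJoin_mul_opJoin_mul_opJoin δ _ _ (hne (by dsimp only; omega))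
    · rw [genOp, genOp, ← opJoin_symm, ← opJoin_symm δ (hne (by omega) :
        topPt j hj.1 hj.2.le ≠ topPt (j + 1) (by omega) hj.2)]
      exact opJoin_mul_opJoin_mul_opJoin δ _ _ (hne (by dsimp only; omega))
  | tangle2 i j h =>
    obtain ⟨i, hi⟩ := i
    obtain ⟨j, hj⟩ := j
    simp only [map_mul, FreeAlgebra.lift_ι_apply]
    obtain rfl | rfl : j = i + 1 ∨ i = j + 1 := h
    · exact opSwap_mul_opSwap_mul_opJoin δ _ _ (hne (by dsimp only; omega))
    · rw [genOp, genOp, genOp, genOp, ← opJoin_symm, ← opJoin_symm δ (hne (by omega) :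
        topPt j hj.1 hj.2.le ≠ topPt (j + 1) (by omega) hj.2),
        ← opSwap_symm, ← opSwap_symm δ (topPt j _ _)]
      exact opSwap_mul_opSwap_mul_opJoin δ _ _ (hne (by dsimp only; omega))
  | tangle3 i j h =>
    obtain ⟨i, hi⟩ := i
    obtain ⟨j, hj⟩ := j
    simp only [map_mul, FreeAlgebra.lift_ι_apply]
    obtain rfl | rfl : j = i + 1 ∨ i = j + 1 := h
    · exact opJoin_mul_opSwap_mul_opSwap δ _ _ (hne (by dsimp only; omega))
    · rw [genOp, genOp, genOp, genOp, ← opJoin_symm, ← opJoin_symm δ (hne (by omega) :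
        topPt j hj.1 hj.2.le ≠ topPt (j + 1) (by omega) hj.2),
        ← opSwap_symm δ (topPt (j + 1) _ _) (topPt (j + 1 + 1) _ _), ← opSwap_symm δ (topPt j _ _)]
      exact opJoin_mul_opSwap_mul_opSwap δ _ _ (hne (by dsimp only; omega))
  | untwistR i =>
    simp only [map_mul, FreeAlgebra.lift_ι_apply]
    exact opSwap_mul_opJoin δ _
  | untwistL i =>
    simp only [map_mul, FreeAlgebra.lift_ι_apply]
    exact opJoin_mul_opSwap δ _
  | untwistE i j h =>
    obtain ⟨i, hi⟩ := i
    obtain ⟨j, hj⟩ := j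
    simp only [map_mul, FreeAlgebra.lift_ι_apply]
    obtain rfl | rfl : j = i + 1 ∨ i = j + 1 := h
    · exact opJoin_mul_opSwap_mul_opJoin δ _ (hne (by dsimp only; omega))
        (hne (by dsimp only; omega))
    · rw [genOp, genOp, ← opJoin_symm, ← opSwap_symm δ (topPt j _ _)]
      exact opJoin_mul_opSwap_mul_opJoin δ _ (hne (by dsimp only; omega))
        (hne (by dsimp only; omega))

/-- The representation of the Brauer algebra on the free module of diagrams. -/
def brauerRep : Brauer R δ n →ₐ[R] Module.End R (Pairing (Fin n ⊕ Fin n) →₀ R) :=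
  RingQuot.liftAlgHom R ⟨FreeAlgebra.lift R (genOp δ n), fun _ _ h => genOp_rel δ n h⟩

lemma brauerRep_ι (g : BrGen n) :
    brauerRep δ n (RingQuot.mkAlgHom R (BrRel R δ n) (FreeAlgebra.ι R g)) = genOp δ n g := by
  rw [brauerRep, RingQuot.liftAlgHom_mkAlgHom_apply, FreeAlgebra.lift_ι_apply]

end

section
variable {R : Type} [CommRing R] (δ : R) {n : ℕ}

open Pairing

/-- The identity diagram. -/
def idPairing (n : ℕ) : Pairing (Fin n ⊕ Fin n) :=
  ⟨Sum.swap, Sum.swap_swap, fun x => by cases x <;> simp⟩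

/-- A diagram is reachable if it lies in the orbit of the identity diagram. -/
def Reachable (f : Pairing (Fin n ⊕ Fin n)) : Prop :=
  ∃ b : Brauer R δ n, brauerRep δ n b (Finsupp.single (idPairing n) 1) = Finsupp.single f 1

lemma reachable_idPairing : Reachable δ (idPairing n) := ⟨1, by rw [map_one, Module.End.one_apply]⟩

variable {δ}

lemma Reachable.relabel {f : Pairing (Fin n ⊕ Fin n)} (hf : Reachable δ f)
    (g : Equiv.Perm (Fin n)) : Reachable δ (relabel (Equiv.Perm.sumCongr g 1) f) := by
  induction g using perm_induction_swN with
  | h1 => rwa [Equiv.Perm.sumCongr_one, relabel_one]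
  | hs j h1 h2 g ih =>
    obtain ⟨b, hb⟩ := ih
    refine ⟨RingQuot.mkAlgHom R (BrRel R δ n) (FreeAlgebra.ι R (BrGen.S ⟨j, h1, h2⟩)) * b, ?_⟩
    rw [map_mul, Module.End.mul_apply, hb, brauerRep_ι, genOp, opSwap, op_single, pow_zero, mul_one,
      ← relabel_mul]
    congr 2
    rw [swN_of h1 h2, ← mul_one (1 : Equiv.Perm (Fin n)), ← Equiv.Perm.sumCongr_mul, mul_one,
      Equiv.Perm.sumCongr_swap_one]
    rfl

lemma Reachable.join {f : Pairing (Fin n ⊕ Fin n)} (hf : Reachable δ f) {a b : Fin n}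
    (hab : a ≠ b) (h : f.1 (Sum.inl a) ≠ Sum.inl b) :
    Reachable δ (join (Sum.inl a) (Sum.inl b) (Sum.inl_injective.ne hab) f) := by
  have hn : 1 < n := by
    by_contra hn
    have h1 := a.2
    have h2 := b.2
    exact hab (Fin.ext (by omega))
  obtain ⟨g, hga, hgb⟩ := exists_perm_apply_two (p := (⟨0, by omega⟩ : Fin n)) (q := ⟨1, hn⟩)
    hab (by simp)
  have h1 : Reachable δ (Pairing.join (topPt 1 le_rfl hn.le) (topPt 2 one_le_two hn)
      (topPt_ne _ _ _ _ (by omega)) (Pairing.relabel (Equiv.Perm.sumCongr g 1) f)) := by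
    obtain ⟨b', hb⟩ := hf.relabel g
    refine ⟨RingQuot.mkAlgHom R (BrRel R δ n) (FreeAlgebra.ι R (BrGen.E ⟨1, le_rfl, hn⟩)) * b', ?_⟩
    rw [map_mul, Module.End.mul_apply, hb, brauerRep_ι, genOp, opJoin, op_single, loops_of_ne,
      pow_zero, mul_one]
    · intro h'
      have h2 : topPt 1 le_rfl hn.le = Equiv.Perm.sumCongr g 1 (Sum.inl a) :=
        congrArg Sum.inl hga.symm
      have h3 : topPt (1 + 1) (by omega) hn = Equiv.Perm.sumCongr g 1 (Sum.inl b) :=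
        congrArg Sum.inl hgb.symm
      rw [relabel_apply] at h'
      dsimp only at h'
      rw [h2, h3, Equiv.symm_apply_apply] at h'
      exact h ((Equiv.Perm.sumCongr g 1).injective h')
  have h2 := h1.relabel g⁻¹
  rw [relabel_join, ← relabel_mul, Equiv.Perm.sumCongr_mul] at h2
  have h3 : Equiv.Perm.sumCongr g⁻¹ 1 (topPt 1 le_rfl hn.le) = (Sum.inl a : Fin n ⊕ Fin n) :=
    congrArg Sum.inl (by rw [Equiv.Perm.inv_eq_iff_eq, hga])
  have h4 : Equiv.Perm.sumCongr g⁻¹ 1 (topPt 2 one_le_two hn) = (Sum.inl b : Fin n ⊕ Fin n) :=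
    congrArg Sum.inl (by rw [Equiv.Perm.inv_eq_iff_eq, hgb])
  rw [inv_mul_cancel, one_mul, Equiv.Perm.sumCongr_one, relabel_one] at h2
  simpa only [h3, h4] using h2

/-- The top points matched with top points. -/
def topArcs (f : Pairing (Fin n ⊕ Fin n)) : Finset (Fin n) :=
  Finset.univ.filter fun a => (f.1 (Sum.inl a)).isLeft

lemma mem_topArcs {f : Pairing (Fin n ⊕ Fin n)} {a : Fin n} :
    a ∈ topArcs f ↔ (f.1 (Sum.inl a)).isLeft := by
  rw [topArcs, Finset.mem_filter, and_iff_right (Finset.mem_univ a)]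

lemma reachable_of_topArcs_eq_empty {f : Pairing (Fin n ⊕ Fin n)} (hf : topArcs f = ∅) :
    Reachable δ f := by
  have h1 : ∀ a, ∃ b, f.1 (Sum.inl a) = Sum.inr b := by
    intro a
    have h2 : a ∉ topArcs f := by rw [hf]; exact Finset.notMem_empty a
    rw [mem_topArcs] at h2
    rcases h : f.1 (Sum.inl a) with b | b
    · rw [h] at h2
      exact absurd rfl h2
    · exact ⟨b, rfl⟩
  choose g hg using h1
  have hginj : Function.Injective g := by
    intro a b hab
    refine Sum.inl_injective (f.injective _ _ ?_)
    rw [hg, hg, hab]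
  let e : Equiv.Perm (Fin n) := Equiv.ofBijective g (Finite.injective_iff_bijective.mp hginj)
  have h2 := (reachable_idPairing δ (n := n)).relabel e⁻¹
  convert h2
  refine Subtype.ext (funext fun x => ?_)
  cases x with
  | inl a => exact hg a
  | inr b =>
    obtain ⟨a, rfl⟩ := e.surjective b
    have h3 : f.1 (Sum.inr (e a)) = Sum.inl a := by
      rw [show (Sum.inr (e a) : Fin n ⊕ Fin n) = f.1 (Sum.inl a) from (hg a).symm,
        f.apply_apply]
    rw [h3]
    exact congrArg Sum.inl (e.symm_apply_apply a).symm

lemma exists_bottomArc {f : Pairing (Fin n ⊕ Fin n)} {a : Fin n} (ha : a ∈ topArcs f) :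
    ∃ c d, f.1 (Sum.inr c) = Sum.inr d := by
  by_contra h
  have h1 : ∀ c, ∃ b, f.1 (Sum.inr c) = Sum.inl b := by
    intro c
    rcases h' : f.1 (Sum.inr c) with b | b
    · exact ⟨b, rfl⟩
    · exact absurd ⟨c, b, h'⟩ h
  choose g hg using h1
  have hginj : Function.Injective g := by
    intro a b hab
    refine Sum.inr_injective (f.injective _ _ ?_)
    rw [hg, hg, hab]
  obtain ⟨c, rfl⟩ := Finite.surjective_of_injective hginj a
  rw [mem_topArcs, ← hg, f.apply_apply] at ha
  exact absurd ha (by simp)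

theorem reachable (f : Pairing (Fin n ⊕ Fin n)) : Reachable δ f := by
  induction hN : (topArcs f).card using Nat.strong_induction_on generalizing f with
  | _ N ih =>
    subst hN
    rcases (topArcs f).eq_empty_or_nonempty with h | ⟨a, ha⟩
    · exact reachable_of_topArcs_eq_empty h
    obtain ⟨c, d, hcd⟩ := exists_bottomArc ha
    rw [mem_topArcs, Sum.isLeft_iff] at ha
    obtain ⟨b, hb⟩ := ha
    have hab : a ≠ b := by
      rintro rfl
      exact f.apply_ne _ hb
    let f' := Pairing.join (Sum.inl a) (Sum.inr c) (by simp) f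
    have hf' : ∀ x, f'.1 x = if x = Sum.inl a then Sum.inr c else if x = Sum.inr c then Sum.inl a
        else if x = Sum.inl b then Sum.inr d else if x = Sum.inr d then Sum.inl b else f.1 x := by
      intro x
      rw [← hb, ← hcd]
      exact join_apply _ _ _ _ _
    have hba : f'.1 (Sum.inl a) = Sum.inr c := by rw [hf', if_pos rfl]
    have hbb : f'.1 (Sum.inl b) = Sum.inr d := by
      rw [hf', if_neg (by simpa using hab.symm), if_neg (by simp), if_pos rfl]
    have hlt : (topArcs f').card < (topArcs f).card := by
      refine Finset.card_lt_card ((Finset.ssubset_iff_of_subset fun x hx => ?_).mpr ⟨a, ?_, ?_⟩)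
      · rw [mem_topArcs] at hx ⊢
        rw [hf'] at hx
        split_ifs at hx <;> simp_all
      · rw [mem_topArcs, hb]
        rfl
      · rw [mem_topArcs, hba]
        simp
    have hreach := (ih _ hlt f' rfl).join hab (by rw [hba]; simp)
    convert hreach
    refine Subtype.ext (funext fun x => ?_)
    rw [join_apply, hba, hbb, hf']
    have h0 := f.2.1
    grind

variable (δ n) in
/-- The map from the Brauer algebra to the free module of diagrams. -/
def diagramMap : Brauer R δ n →ₗ[R] (Pairing (Fin n ⊕ Fin n) →₀ R) :=
  (LinearMap.applyₗ (Finsupp.single (idPairing n) 1)) ∘ₗ (brauerRep δ n).toLinearMap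

lemma diagramMap_surjective : Function.Surjective (diagramMap δ n) := by
  rw [← LinearMap.range_eq_top, eq_top_iff]
  intro v _
  induction v using Finsupp.induction_linear with
  | zero => exact Submodule.zero_mem _
  | add u v hu hv => exact Submodule.add_mem _ (hu trivial) (hv trivial)
  | single f r =>
    rw [← mul_one r, ← smul_eq_mul, ← Finsupp.smul_single]
    obtain ⟨b, hb⟩ := reachable (δ := δ) f
    exact Submodule.smul_mem _ _ ⟨b, hb⟩

end

/-- There are at least `(2n-1)!!` perfect matchings of `2n` points. -/
theorem doubleFactorial_le_card_pairing {X : Type} [Finite X] {n : ℕ} (hX : Nat.card X = 2 * n) :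
    Nat.doubleFactorial (2 * n - 1) ≤ Nat.card (Pairing X) := by
  classical
  have := Fintype.ofFinite X
  rw [Nat.card_eq_fintype_card] at hX
  let m : Multiset ℕ := Multiset.replicate n 2
  have hsum : m.sum = 2 * n := by rw [Multiset.sum_replicate, smul_eq_mul, mul_comm]
  have hcard := Equiv.Perm.card_of_cycleType X m
  rw [if_pos ⟨by rw [hsum, hX], fun a ha => (Multiset.eq_of_mem_replicate ha).ge⟩, hsum, hX,
    Nat.sub_self, Nat.factorial_zero, one_mul, Multiset.prod_replicate] at hcard
  have hprod : ∏ k ∈ m.toFinset, (m.count k).factorial = n.factorial := by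
    rcases Nat.eq_zero_or_pos n with rfl | hn
    · rfl
    · rw [show (Multiset.replicate n 2).toFinset = {2} by ext; simp [hn.ne'], Finset.prod_singleton,
        Multiset.count_replicate_self]
  rw [hprod, ← Nat.doubleFactorial_two_mul] at hcard
  have hdf : (2 * n).factorial / (Nat.doubleFactorial (2 * n)) =
      Nat.doubleFactorial (2 * n - 1) := by
    cases n with
    | zero => rfl
    | succ k =>
      rw [show 2 * (k + 1) = 2 * k + 1 + 1 by ring, Nat.factorial_eq_mul_doubleFactorial,
        Nat.add_sub_cancel]
      exact Nat.mul_div_cancel_left _ (Nat.doubleFactorial_pos _)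
  have hpair : ∀ g : Equiv.Perm X, g.cycleType = m → (∀ x, g (g x) = x) ∧ ∀ x, g x ≠ x := by
    intro g hg
    refine ⟨fun x => ?_, fun x => ?_⟩
    · have h1 : orderOf g ∣ 2 := by
        rw [← Equiv.Perm.lcm_cycleType, hg]
        exact Multiset.lcm_dvd.mpr fun a ha => (Multiset.eq_of_mem_replicate ha).dvd
      have h2 := orderOf_dvd_iff_pow_eq_one.mp h1
      rw [← Equiv.Perm.mul_apply, ← sq, h2, Equiv.Perm.one_apply]
    · have h1 : g.support = Finset.univ := by
        rw [← Finset.card_eq_iff_eq_univ, ← Equiv.Perm.sum_cycleType, hg, hsum, hX]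
      rw [← Equiv.Perm.mem_support, h1]
      exact Finset.mem_univ x
  rw [← hdf, ← hcard, ← Nat.card_eq_finsetCard]
  refine Nat.card_le_card_of_injective
    (fun g => have hg := Finset.mem_filter.mp g.2
      ⟨g.1, hpair g.1 hg.2⟩ : _ → Pairing X) fun g h hgh => ?_
  exact Subtype.ext (Equiv.coe_fn_injective (congrArg Subtype.val hgh))

/-- A spanning family with at most as many members as there are diagrams is linearly
independent. -/
theorem linearIndependent_of_span_eq_top {R : Type} [CommRing R] {δ : R} {n : ℕ} {ι : Type}
    [Finite ι] {v : ι → Brauer R δ n} (hv : Submodule.span R (Set.range v) = ⊤)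
    (hι : Nat.card ι ≤ Nat.doubleFactorial (2 * n - 1)) : LinearIndependent R v := by
  have hcard : Nat.card (Fin n ⊕ Fin n) = 2 * n := by
    rw [Nat.card_sum, Nat.card_fin, two_mul]
  obtain ⟨j⟩ : Nonempty (ι ↪ Pairing (Fin n ⊕ Fin n)) := by
    have := Fintype.ofFinite ι
    have := Fintype.ofFinite (Pairing (Fin n ⊕ Fin n))
    refine Function.Embedding.nonempty_of_card_le ?_
    rw [← Nat.card_eq_fintype_card, ← Nat.card_eq_fintype_card]
    exact hι.trans (doubleFactorial_le_card_pairing hcard)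
  have hinj := OrzechProperty.injective_of_surjective_of_injective
    (Finsupp.lmapDomain R R j) ((diagramMap δ n) ∘ₗ Finsupp.linearCombination R v)
    (Finsupp.mapDomain_injective j.injective) (by
      rw [LinearMap.coe_comp]
      refine diagramMap_surjective.comp ?_
      rw [← LinearMap.range_eq_top, Finsupp.range_linearCombination, hv])
  rw [LinearMap.coe_comp] at hinj
  exact hinj.of_comp

/-- **Statement 16** (Murphy-type cellular basis of the Brauer algebra).
Let `R = ℤ[δ]` be the generic ground ring (`δ` an indeterminate) and let
`B_i = Brauer R δ i` be the Brauer algebra, with its involution `*` fixing the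
generators `s_j, e_j` and with the permutation diagrams `s_v` (`v ∈ S_i`)
determined by reduced expressions.  Then for each `i ≥ 1` the set
`ℬ_i = {d_s* c_{(λ,l)} d_t : (λ,l) ∈ B̂_i, s,t ∈ B̂_i^{(λ,l)}}` is an `R`-basis of
`B_i`, and `(B_i, *, B̂_i, ⊵, ℬ_i)` is a cell datum for `B_i` (with
`B̂_i = {(λ,l) : 0 ≤ l ≤ ⌊i/2⌋, λ ⊢ i-2l}` ordered by `(λ,l) ⊵ (μ,m)` iff `l > m`,
or `l = m` and `λ ⊵ μ` in the dominance order, and with the index sets the paths on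
the branching diagram obtained by reflections from Young's lattice). -/
theorem brauer_cellular_basis
    (i : ℕ) (hi : 1 ≤ i)
    -- the involution of B_i, fixing the generators
    (st : Brauer (Polynomial ℤ) Polynomial.X i →ₗ[Polynomial ℤ]
      Brauer (Polynomial ℤ) Polynomial.X i)
    (hst_mul : ∀ x y, st (x * y) = st y * st x)
    (hst_st : ∀ x, st (st x) = x)
    (hst_s : ∀ j : ℕ, st (brS (Polynomial ℤ) Polynomial.X i j)
      = brS (Polynomial ℤ) Polynomial.X i j)
    (hst_e : ∀ j : ℕ, st (brE (Polynomial ℤ) Polynomial.X i j)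
      = brE (Polynomial ℤ) Polynomial.X i j)
    -- the permutation diagrams s_v, characterized by reduced expressions
    (sw : Equiv.Perm (Fin i) → Brauer (Polynomial ℤ) Polynomial.X i)
    (hsw1 : sw 1 = 1)
    (hswmul : ∀ (v : Equiv.Perm (Fin i)) (j : ℕ), 1 ≤ j → j < i →
      invCount (swN i j * v) = invCount v + 1 →
        sw (swN i j * v) = sw v * brS (Polynomial ℤ) Polynomial.X i j) :
    -- the set ℬ_i is an R-basis of B_i ...
    (LinearIndependent (Polynomial ℤ)
      (fun p : (x : WLam i) × (WPath i x.1 × WPath i x.1) =>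
        st (dPathBr (Polynomial ℤ) Polynomial.X i i p.2.1) *
          cBr (Polynomial ℤ) Polynomial.X i sw p.1.1.1 p.1.1.2 *
          dPathBr (Polynomial ℤ) Polynomial.X i i p.2.2) ∧
    Submodule.span (Polynomial ℤ) (Set.range
      (fun p : (x : WLam i) × (WPath i x.1 × WPath i x.1) =>
        st (dPathBr (Polynomial ℤ) Polynomial.X i i p.2.1) *
          cBr (Polynomial ℤ) Polynomial.X i sw p.1.1.1 p.1.1.2 *
          dPathBr (Polynomial ℤ) Polynomial.X i i p.2.2)) = ⊤) ∧
    -- ... the poset and index sets are finite ...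
    (Finite (WLam i) ∧ ∀ x : WLam i, Finite (WPath i x.1)) ∧
    -- ... the cellular multiplication axiom holds ...
    (∀ (x : WLam i) (t : WPath i x.1) (a : Brauer (Polynomial ℤ) Polynomial.X i),
      ∃ r : WPath i x.1 →₀ Polynomial ℤ, ∀ s : WPath i x.1,
        (st (dPathBr (Polynomial ℤ) Polynomial.X i i s) *
            cBr (Polynomial ℤ) Polynomial.X i sw x.1.1 x.1.2 *
            dPathBr (Polynomial ℤ) Polynomial.X i i t) * a
          - r.sum (fun v rv => rv •
              (st (dPathBr (Polynomial ℤ) Polynomial.X i i s) *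
                cBr (Polynomial ℤ) Polynomial.X i sw x.1.1 x.1.2 *
                dPathBr (Polynomial ℤ) Polynomial.X i i v)) ∈
        Submodule.span (Polynomial ℤ) {y : Brauer (Polynomial ℤ) Polynomial.X i |
          ∃ (m : WLam i) (u w : WPath i m.1), wGT m.1 x.1 ∧
            y = st (dPathBr (Polynomial ℤ) Polynomial.X i i u) *
              cBr (Polynomial ℤ) Polynomial.X i sw m.1.1 m.1.2 *
              dPathBr (Polynomial ℤ) Polynomial.X i i w}) ∧
    -- ... and the cellular star axiom holds.
    (∀ (x : WLam i) (s t : WPath i x.1),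
      st (st (dPathBr (Polynomial ℤ) Polynomial.X i i s) *
          cBr (Polynomial ℤ) Polynomial.X i sw x.1.1 x.1.2 *
          dPathBr (Polynomial ℤ) Polynomial.X i i t)
        - (st (dPathBr (Polynomial ℤ) Polynomial.X i i t) *
            cBr (Polynomial ℤ) Polynomial.X i sw x.1.1 x.1.2 *
            dPathBr (Polynomial ℤ) Polynomial.X i i s) ∈
        Submodule.span (Polynomial ℤ) {y : Brauer (Polynomial ℤ) Polynomial.X i |
          ∃ (m : WLam i) (u w : WPath i m.1), wGT m.1 x.1 ∧
            y = st (dPathBr (Polynomial ℤ) Polynomial.X i i u) *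
              cBr (Polynomial ℤ) Polynomial.X i sw m.1.1 m.1.2 *
              dPathBr (Polynomial ℤ) Polynomial.X i i w}) := by
  obtain ⟨π, hsw, hπ⟩ := exists_perm_hom (brS (Polynomial ℤ) Polynomial.X i)
    (fun j _ _ => brS_mul_self j) (fun j hj => brS_out hj) sw hsw1 hswmul
  obtain ⟨E, A, hE⟩ := exists_arcSystem π hπ
  have hspan := span_cellular_eq_top hst_mul hst_s hπ hst_e hst_st A hE
  have habove := aboveSpan_le_higherSpan hst_mul hst_s hπ hst_e hst_st A hE
  simp only [cBr_eq_cellGen π hsw]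
  refine ⟨⟨linearIndependent_of_span_eq_top hspan (natCard_pathPairs_le i), hspan⟩,
    ⟨inferInstance, fun x => inferInstance⟩, fun x t a => ?_, fun x s t => ?_⟩
  · obtain ⟨r, hr⟩ := exists_cellGen_mul_eq A hE hπ x.eq_card_add
      (dPathBr (Polynomial ℤ) Polynomial.X i i t * a)
    refine ⟨r, fun s => ?_⟩
    have hs := habove x (mul_mem_aboveSpan_left hr
      (st (dPathBr (Polynomial ℤ) Polynomial.X i i s)))
    simpa only [higherSpan, mul_sub, Finsupp.mul_sum, mul_smul_comm, mul_assoc] using hs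
  · rw [hst_mul, hst_mul, hst_st, star_cellGen hst_mul hst_s hπ hst_e A hE x.eq_card_add,
      mul_assoc, sub_self]
    exact Submodule.zero_mem _
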